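/- Let a and b be integers with 3 ∤ b, and suppose d = −4a³ + 9b² is square-free. Let r and s denote the 3-ranks of the class groups of ℚ(√d) and ℚ(√(−3d)) respectively. Then r = s if d > 0, and r = s + 1 if d < 0. -/

import Mathlib

open NumberField IntermediateField Module
open scoped nonZeroDivisors

noncomputable section

namespace PaperStmt

/-- The `p`-part (`p`-primary component / `p`-Sylow subgroup) of a commutative group. -/
def pPart (G : Type*) [CommGroup G] (p : ℕ) (hp : p.Prime) : Subgroup G :=
  haveI : Fact p.Prime := ⟨hp⟩
  CommGroup.primaryComponent G p

/-- The `p`-rank: `dim_{F_p} (G_p / G_p^p)`, read off as the exponent of `p`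
in the order of the elementary abelian group `G_p / G_p^p`. -/
def pRank (G : Type*) [CommGroup G] (p : ℕ) (hp : p.Prime) : ℕ :=
  (Nat.card
    (↥(pPart G p hp) ⧸ (powMonoidHom p : ↥(pPart G p hp) →* ↥(pPart G p hp)).range)).factorization
    p

/-- A square root of the integer `d` in `ℂ`. -/
def sqrtC (d : ℤ) : ℂ := (d : ℂ) ^ ((2 : ℂ)⁻¹)

lemma sqrtC_sq (d : ℤ) : sqrtC d ^ 2 = (d : ℂ) := by
  have h := Complex.cpow_nat_inv_pow (d : ℂ) (two_ne_zero)
  simp only [Nat.cast_ofNat] at h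
  simpa [sqrtC] using h


/-- The quadratic field `ℚ(√d)`, realised inside `ℂ`. -/
def quadField (d : ℤ) : IntermediateField ℚ ℂ := ℚ⟮sqrtC d⟯

lemma isIntegral_sqrtC (d : ℤ) : IsIntegral ℚ (sqrtC d) :=
  ⟨Polynomial.X ^ 2 - Polynomial.C (d : ℚ), Polynomial.monic_X_pow_sub_C _ two_ne_zero, by
    rw [Polynomial.eval₂_sub, Polynomial.eval₂_X_pow, Polynomial.eval₂_C, sqrtC_sq]
    simp⟩

instance (d : ℤ) : FiniteDimensional ℚ (quadField d) :=
  IntermediateField.adjoin.finiteDimensional (isIntegral_sqrtC d)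

instance (E : IntermediateField ℚ ℂ) [FiniteDimensional ℚ E] : NumberField E := ⟨⟩

/-! ### Eisenstein integers and the rational cubic symbol -/

/-- The Eisenstein integers `ℤ[ω]`, with `ω² = -1 - ω`. -/
abbrev Eis : Type := QuadraticAlgebra ℤ (-1) (-1)

/-- The primitive cube root of unity in the Eisenstein integers. -/
def omE : Eis := ⟨0, 1⟩

/-- The Eisenstein integer `A + B√-3`. -/
def rt (A B : ℤ) : Eis := ⟨A + B, 2 * B⟩

lemma Eis.norm_eq (z : Eis) : z.norm = z.re ^ 2 - z.re * z.im + z.im ^ 2 := by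
  rw [QuadraticAlgebra.norm_def]; ring

lemma Eis.norm_nonneg (z : Eis) : 0 ≤ z.norm := by
  rw [Eis.norm_eq]; nlinarith [sq_nonneg (2 * z.re - z.im), sq_nonneg z.im]

lemma Eis.norm_eq_zero {z : Eis} : z.norm = 0 ↔ z = 0 := by
  constructor
  · intro h
    rw [Eis.norm_eq] at h
    have h1 : z.im = 0 := by
      have : 3 * z.im ^ 2 ≤ 0 := by nlinarith [sq_nonneg (2 * z.re - z.im)]
      exact pow_eq_zero_iff (two_ne_zero) |>.1 (le_antisymm (by linarith) (sq_nonneg _))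
    have h2 : z.re = 0 := by
      rw [h1] at h
      exact pow_eq_zero_iff (two_ne_zero) |>.1 (by linarith)
    exact QuadraticAlgebra.ext h2 h1
  · rintro rfl; simp

lemma Eis.mul_star_eq (z : Eis) : z * star z = (z.norm : Eis) := by
  have := QuadraticAlgebra.algebraMap_norm_eq_mul_star z
  rw [← this]; rfl

instance : NoZeroDivisors Eis where
  eq_zero_or_eq_zero_of_mul_eq_zero {a b} h := by
    have h1 : a.norm * b.norm = 0 := by rw [← map_mul, h]; simp
    rcases mul_eq_zero.1 h1 with h2 | h2
    · exact .inl (Eis.norm_eq_zero.1 h2)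
    · exact .inr (Eis.norm_eq_zero.1 h2)

instance : IsDomain Eis := NoZeroDivisors.to_isDomain _

lemma omE_sq : omE ^ 2 + omE + 1 = 0 := by
  ext <;> simp [omE, pow_two, QuadraticAlgebra.re_one, QuadraticAlgebra.im_one]

lemma star_rt (A B : ℤ) : star (rt A B) = rt A (-B) := by
  ext <;> simp [rt] ; ring

lemma rt_norm (A B : ℤ) : (rt A B).norm = A ^ 2 + 3 * B ^ 2 := by
  rw [Eis.norm_eq]; simp only [rt]; ring

lemma rt_mul (A B C D : ℤ) : rt A B * rt C D = rt (A * C - 3 * B * D) (A * D + B * C) := by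
  ext <;> simp [rt] <;> ring

section residue

variable (q : ℕ) [Fact q.Prime]

/-- An algebraically closed field of characteristic `q`. -/
abbrev Kap : Type := AlgebraicClosure (ZMod q)

instance : CharP (Kap q) q :=
  charP_of_injective_algebraMap (algebraMap (ZMod q) (Kap q)).injective q

lemma exists_om : ∃ w : Kap q, w ^ 2 + w + 1 = 0 := by
  obtain ⟨w, hw⟩ :=
    IsAlgClosed.exists_root (Polynomial.X ^ 2 + Polynomial.X + 1 : Polynomial (Kap q))
    (by
      have : (Polynomial.X ^ 2 + Polynomial.X + 1 : Polynomial (Kap q)).degree = 2 := by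
        compute_degree!
      rw [this]; norm_num)
  exact ⟨w, by simpa using hw⟩

/-- A root of `X² + X + 1` in characteristic `q`. -/
def om : Kap q := (exists_om q).choose

lemma om_sq : om q ^ 2 + om q + 1 = 0 := (exists_om q).choose_spec

lemma om_cube : om q ^ 3 = 1 := by linear_combination (om q - 1) * om_sq q

lemma om_ne_one (h3 : q ≠ 3) : om q ≠ 1 := by
  intro h
  have h1 := om_sq q
  rw [h] at h1
  have h2 : ((3 : ℕ) : Kap q) = 0 := by push_cast; linear_combination h1
  rw [CharP.cast_eq_zero_iff (Kap q) q] at h2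
  exact h3 ((Nat.prime_dvd_prime_iff_eq Fact.out Nat.prime_three).1 h2)

lemma om_ne_zero : om q ≠ 0 := by
  intro h; have := om_sq q; rw [h] at this; simp at this

lemma om_sq_ne_one (h3 : q ≠ 3) : om q ^ 2 ≠ 1 := by
  intro h
  apply om_ne_one q h3
  have := om_cube q
  linear_combination this - om q * h

lemma om_sq_ne_om (h3 : q ≠ 3) : om q ^ 2 ≠ om q := by
  intro h
  apply om_ne_one q h3
  have := om_cube q
  rw [pow_succ, h] at this
  rw [← h, ← this]; ring

/-- Reduction of the Eisenstein integers into characteristic `q`. -/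
def rho : Eis →+* Kap q where
  toFun z := z.re + z.im * om q
  map_one' := by simp [QuadraticAlgebra.re_one, QuadraticAlgebra.im_one]
  map_zero' := by simp
  map_add' x y := by simp; ring
  map_mul' x y := by
    simp
    linear_combination (-(x.im : Kap q) * y.im) * om_sq q

lemma rho_apply (z : Eis) : rho q z = z.re + z.im * om q := rfl

lemma rho_omE : rho q omE = om q := by simp [rho_apply, omE]

lemma rho_star (z : Eis) : rho q (star z) = z.re + z.im * om q ^ 2 := by
  simp [rho_apply]
  linear_combination (- (z.im : Kap q)) * om_sq q

lemma intCast_pow_q (n : ℤ) : (n : Kap q) ^ q = n := by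
  have := ZMod.pow_card (n : ZMod q)
  have h := congrArg (algebraMap (ZMod q) (Kap q)) this
  rwa [map_pow, map_intCast] at h

lemma pow_mod_three (n : ℕ) : om q ^ n = om q ^ (n % 3) := by
  conv_lhs => rw [← Nat.div_add_mod n 3, pow_add, pow_mul, om_cube, one_pow, one_mul]

lemma om_pow_one (h : q % 3 = 1) : om q ^ q = om q := by
  exact (pow_mod_three q q).trans (by simp [h])

lemma om_pow_two (h : q % 3 = 2) : om q ^ q = om q ^ 2 := by
  exact (pow_mod_three q q).trans (by simp [h])

lemma rho_pow_one (h : q % 3 = 1) (z : Eis) : rho q z ^ q = rho q z := by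
  rw [rho_apply, add_pow_char, mul_pow, intCast_pow_q, intCast_pow_q, om_pow_one q h]

lemma rho_pow_two (h : q % 3 = 2) (z : Eis) : rho q z ^ q = rho q (star z) := by
  rw [rho_star, rho_apply, add_pow_char, mul_pow, intCast_pow_q, intCast_pow_q, om_pow_two q h]

lemma rho_ne_zero {z : Eis} (h : ¬ (q : ℤ) ∣ z.norm) : rho q z ≠ 0 := by
  intro h0
  apply h
  rw [← CharP.intCast_eq_zero_iff (Kap q) q]
  have : rho q (z.norm : Eis) = 0 := by rw [← Eis.mul_star_eq, map_mul, h0, zero_mul]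
  simpa using this

lemma rho_star_ne_zero {z : Eis} (h : ¬ (q : ℤ) ∣ z.norm) : rho q (star z) ≠ 0 :=
  rho_ne_zero q (by rwa [QuadraticAlgebra.norm_star])

/-- The value of the cubic symbol in characteristic `q`. -/
def cu (z : Eis) : Kap q :=
  if q % 3 = 1 then (rho q z / rho q (star z)) ^ ((q - 1) / 3)
  else if q % 3 = 2 then (rho q (star z) / rho q z) ^ ((q + 1) / 3) else 1

lemma cu_one (h : q % 3 = 1) (z : Eis) : cu q z = (rho q z / rho q (star z)) ^ ((q - 1) / 3) := by
  rw [cu, if_pos h]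

lemma cu_two (h : q % 3 = 2) (z : Eis) : cu q z = (rho q (star z) / rho q z) ^ ((q + 1) / 3) := by
  rw [cu, if_neg (by omega), if_pos h]

lemma cu_three (h : q = 3) (z : Eis) : cu q z = 1 := by
  rw [cu, if_neg (by omega), if_neg (by omega)]

lemma prime_mod_three (h3 : q ≠ 3) : q % 3 = 1 ∨ q % 3 = 2 := by
  have : ¬ 3 ∣ q := fun h => h3 ((Nat.prime_dvd_prime_iff_eq Nat.prime_three Fact.out).1 h).symm
  omega

lemma cu_mul (z w : Eis) : cu q (z * w) = cu q z * cu q w := by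
  simp only [cu, star_mul', map_mul]
  split_ifs
  · rw [← mul_pow]; congr 1; rw [div_mul_div_comm]
  · rw [← mul_pow]; congr 1; rw [div_mul_div_comm]
  · simp

lemma cu_star (z : Eis) : cu q (star z) = (cu q z)⁻¹ := by
  simp only [cu, star_star]
  split_ifs
  · rw [← inv_pow, inv_div]
  · rw [← inv_pow, inv_div]
  · simp

lemma cu_congr {z w : Eis} (h : rho q z = rho q w) (h' : rho q (star z) = rho q (star w)) :
    cu q z = cu q w := by
  simp only [cu, h, h']

lemma cu_pow_three {z : Eis} (h : ¬ (q : ℤ) ∣ z.norm) : cu q z ^ 3 = 1 := by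
  have hq : 2 ≤ q := (Fact.out : q.Prime).two_le
  have h1 := rho_ne_zero q h
  have h2 := rho_star_ne_zero q h
  rcases eq_or_ne q 3 with h3 | h3
  · rw [cu_three q h3, one_pow]
  rcases prime_mod_three q h3 with h3 | h3
  · rw [cu_one q h3, ← pow_mul, show (q - 1) / 3 * 3 = q - 1 by omega, div_pow]
    have e1 : rho q z ^ (q - 1) = 1 := by
      apply mul_right_cancel₀ h1
      rw [← pow_succ, Nat.sub_add_cancel (by omega), one_mul, rho_pow_one q h3]
    have e2 : rho q (star z) ^ (q - 1) = 1 := by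
      apply mul_right_cancel₀ h2
      rw [← pow_succ, Nat.sub_add_cancel (by omega), one_mul, rho_pow_one q h3]
    rw [e1, e2, div_one]
  · rw [cu_two q h3, ← pow_mul, show (q + 1) / 3 * 3 = q + 1 by omega, div_pow, pow_succ, pow_succ,
      rho_pow_two q h3, rho_pow_two q h3, star_star, mul_comm]
    exact div_self (mul_ne_zero h2 h1)

/-- Logarithm of a cube root of unity in characteristic `q`. -/
def lg (w : Kap q) : ZMod 3 := open Classical in
  if w = om q then 1 else if w = om q ^ 2 then 2 else 0

lemma lg_one (h3 : q ≠ 3) : lg q 1 = 0 := by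
  rw [lg, if_neg (om_ne_one q h3).symm, if_neg (om_sq_ne_one q h3).symm]

lemma lg_om : lg q (om q) = 1 := by rw [lg, if_pos rfl]

lemma lg_om_sq (h3 : q ≠ 3) : lg q (om q ^ 2) = 2 := by
  rw [lg, if_neg (om_sq_ne_om q h3), if_pos rfl]

lemma cube_root_cases {w : Kap q} (h : w ^ 3 = 1) : w = 1 ∨ w = om q ∨ w = om q ^ 2 := by
  have : (w - 1) * ((w - om q) * (w - om q ^ 2)) = 0 := by
    linear_combination h + (w - w ^ 2) * om_sq q + (w - 1) * om_cube q
  rcases mul_eq_zero.1 this with h | h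
  · exact .inl (sub_eq_zero.1 h)
  rcases mul_eq_zero.1 h with h | h
  · exact .inr (.inl (sub_eq_zero.1 h))
  · exact .inr (.inr (sub_eq_zero.1 h))

lemma lg_mul (h3 : q ≠ 3) {w v : Kap q} (hw : w ^ 3 = 1) (hv : v ^ 3 = 1) :
    lg q (w * v) = lg q w + lg q v := by
  have e3 : om q * om q ^ 2 = 1 := by rw [← om_cube q]; ring
  have e3' : om q ^ 2 * om q = 1 := by rw [← om_cube q]; ring
  have e4 : om q ^ 2 * om q ^ 2 = om q := by linear_combination om q * om_cube q
  have e5 : om q * om q = om q ^ 2 := by ring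
  rcases cube_root_cases q hw with rfl | rfl | rfl <;>
  rcases cube_root_cases q hv with rfl | rfl | rfl <;>
  simp only [one_mul, mul_one, lg_one q h3, lg_om, lg_om_sq q h3, e3, e3', e4, e5,
    zero_add, add_zero] <;> decide +revert

lemma lg_eq_zero (h3 : q ≠ 3) {w : Kap q} (hw : w ^ 3 = 1) : lg q w = 0 ↔ w = 1 := by
  rcases cube_root_cases q hw with rfl | rfl | rfl
  · simp [lg_one q h3]
  · simp [lg_om, om_ne_one q h3]
  · rw [lg_om_sq q h3]
    refine ⟨fun h => absurd h (by decide), fun h => absurd h (om_sq_ne_one q h3)⟩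

lemma lg_inv (h3 : q ≠ 3) {w : Kap q} (hw : w ^ 3 = 1) : lg q w⁻¹ = - lg q w := by
  have hw0 : w ≠ 0 := by rintro rfl; simp at hw
  have := lg_mul q h3 hw (show (w⁻¹) ^ 3 = 1 by rw [inv_pow, hw, inv_one])
  rw [mul_inv_cancel₀ hw0, lg_one q h3] at this
  linear_combination -this

end residue

open Classical in
/-- The additive rational cubic symbol `log (z / z̄)_q`. -/
def e (q : ℕ) (z : Eis) : ZMod 3 :=
  if h : q.Prime ∧ q ≠ 3 then haveI := Fact.mk h.1; lg q (cu q z) else 0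

lemma e_prime (q : ℕ) [hq : Fact q.Prime] (h3 : q ≠ 3) (z : Eis) : e q z = lg q (cu q z) := by
  rw [e, dif_pos ⟨hq.out, h3⟩]

lemma e_not {q : ℕ} (h : ¬ (q.Prime ∧ q ≠ 3)) (z : Eis) : e q z = 0 := dif_neg h

lemma e_mul {q : ℕ} {z w : Eis} (hz : ¬ (q : ℤ) ∣ z.norm) (hw : ¬ (q : ℤ) ∣ w.norm) :
    e q (z * w) = e q z + e q w := by
  by_cases h : q.Prime ∧ q ≠ 3
  · have := Fact.mk h.1
    simp only [e_prime q h.2]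
    rw [cu_mul, lg_mul q h.2 (cu_pow_three q hz) (cu_pow_three q hw)]
  · simp [e_not h]

lemma e_star {q : ℕ} {z : Eis} (hz : ¬ (q : ℤ) ∣ z.norm) : e q (star z) = - e q z := by
  by_cases h : q.Prime ∧ q ≠ 3
  · have := Fact.mk h.1
    simp only [e_prime q h.2]
    rw [cu_star, lg_inv q h.2 (cu_pow_three q hz)]
  · simp [e_not h]

lemma e_int_mul {q : ℕ} {n : ℤ} (hn : ¬ (q : ℤ) ∣ n) (z : Eis) : e q (n * z) = e q z := by
  by_cases h : q.Prime ∧ q ≠ 3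
  · have := Fact.mk h.1
    simp only [e_prime q h.2]
    have h0 : (n : Kap q) ≠ 0 := by rwa [Ne, CharP.intCast_eq_zero_iff (Kap q) q]
    have : cu q (n : Eis) = 1 := by
      simp only [cu, star_intCast, map_intCast, div_self h0, one_pow, ite_self]
    rw [cu_mul, this, one_mul]
  · simp [e_not h]

lemma e_congr {q : ℕ} {z w : Eis} (h1 : (q : ℤ) ∣ z.re - w.re) (h2 : (q : ℤ) ∣ z.im - w.im) :
    e q z = e q w := by
  by_cases h : q.Prime ∧ q ≠ 3
  · have := Fact.mk h.1
    simp only [e_prime q h.2]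
    rw [← CharP.intCast_eq_zero_iff (Kap q) q] at h1 h2
    push_cast at h1 h2
    rw [cu_congr q (z := z) (w := w)]
    · rw [rho_apply, rho_apply]; linear_combination h1 + om q * h2
    · rw [rho_star, rho_star]; linear_combination h1 + om q ^ 2 * h2
  · simp [e_not h]

lemma e_rt_congr {q : ℕ} {A B C D : ℤ} (h1 : (q : ℤ) ∣ A - C) (h2 : (q : ℤ) ∣ B - D) :
    e q (rt A B) = e q (rt C D) := by
  apply e_congr
  · simp only [rt]
    have := dvd_add h1 h2
    rwa [show A - C + (B - D) = A + B - (C + D) by ring] at this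
  · simp only [rt]
    have := dvd_mul_of_dvd_right h2 2
    rwa [mul_sub] at this

/-- `√-3` and any element with `z̄ = -z` has trivial symbol. -/
lemma e_rt_zero_mul {q : ℕ} {z : Eis} : e q (rt 0 1 * z) = e q z := by
  by_cases h : q.Prime ∧ q ≠ 3
  · have := Fact.mk h.1
    simp only [e_prime q h.2]
    have h0 : rho q (rt 0 1) ≠ 0 := by
      apply rho_ne_zero
      rw [rt_norm]
      intro h'
      have : q ∣ 3 := by exact_mod_cast (show (q : ℤ) ∣ 3 by simpa using h')
      exact h.2 ((Nat.prime_dvd_prime_iff_eq h.1 Nat.prime_three).1 this)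
    have hs : rho q (star (rt 0 1)) = - rho q (rt 0 1) := by
      rw [← map_neg]; congr 1
    have hm : (-1 : Kap q) ^ ((q - 1) / 3) = 1 ∨ q % 3 ≠ 1 := by
      by_cases h1 : q % 3 = 1
      · left
        have : Odd q := h.1.odd_of_ne_two (by rintro rfl; norm_num at h1)
        apply Even.neg_one_pow
        obtain ⟨k, hk⟩ := this
        rw [Nat.even_iff]; omega
      · right; exact h1
    have hm2 : (-1 : Kap q) ^ ((q + 1) / 3) = 1 ∨ q % 3 ≠ 2 := by
      by_cases h1 : q % 3 = 2
      · left
        rcases h.1.eq_two_or_odd' with h2 | this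
        · subst h2
          have : ((2 : ℕ) : Kap 2) = 0 := CharP.cast_eq_zero _ _
          push_cast at this
          norm_num
          linear_combination -this
        apply Even.neg_one_pow
        obtain ⟨k, hk⟩ := this
        rw [Nat.even_iff]; omega
      · right; exact h1
    have : cu q (rt 0 1) = 1 := by
      rcases prime_mod_three q h.2 with h1 | h1
      · rw [cu_one q h1, hs, div_neg, div_self h0]
        exact hm.resolve_right (by simpa using h1)
      · rw [cu_two q h1, hs, neg_div, div_self h0]
        exact hm2.resolve_right (by simpa using h1)
    rw [cu_mul, this, one_mul]
  · simp [e_not h]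

lemma e_two_rt (A B : ℤ) : e 2 (rt A B) = 0 := by
  have : Fact (Nat.Prime 2) := ⟨Nat.prime_two⟩
  rw [e_prime 2 (by norm_num)]
  have h2 : ((2 : ℕ) : Kap 2) = 0 := CharP.cast_eq_zero _ _
  push_cast at h2
  have h1 : rho 2 (star (rt A B)) = rho 2 (rt A B) := by
    rw [rho_star, rho_apply]
    simp only [rt]; push_cast
    linear_combination ((B : Kap 2) * om 2 ^ 2 - B * om 2) * h2
  rw [cu_two 2 (by norm_num), h1]
  by_cases h0 : rho 2 (rt A B) = 0
  · rw [h0]; norm_num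
    rw [lg, if_neg (om_ne_zero 2).symm, if_neg (pow_ne_zero 2 (om_ne_zero 2)).symm]
  · rw [div_self h0, one_pow, lg_one 2 (by norm_num)]

/-- The symbol extended additively to composite moduli. -/
def E (z : Eis) (n : ℕ) : ZMod 3 := n.factorization.sum fun q k => (k : ZMod 3) * e q z

lemma E_one (z : Eis) : E z 1 = 0 := by simp [E]

lemma E_mul (z : Eis) {m n : ℕ} (hm : m ≠ 0) (hn : n ≠ 0) : E z (m * n) = E z m + E z n := by
  rw [E, Nat.factorization_mul hm hn, Finsupp.sum_add_index']
  · rfl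
  · simp
  · intro a b c; push_cast; ring

lemma E_prime (z : Eis) {q : ℕ} (hq : q.Prime) : E z q = e q z := by
  rw [E, hq.factorization, Finsupp.sum_single_index] <;> simp

lemma E_congr_fun {z w : Eis} {n : ℕ} (h : ∀ q, q.Prime → q ∣ n → e q z = e q w) :
    E z n = E w n := by
  rw [E, E, Finsupp.sum, Finsupp.sum]
  refine Finset.sum_congr rfl fun q hq => ?_
  rw [Nat.support_factorization, Nat.mem_primeFactors] at hq
  rw [h q hq.1 hq.2.1]

lemma E_mul_left {z w : Eis} {n : ℕ} (hz : IsCoprime (n : ℤ) z.norm)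
    (hw : IsCoprime (n : ℤ) w.norm) :
    E (z * w) n = E z n + E w n := by
  rw [E, E, E, Finsupp.sum, Finsupp.sum, Finsupp.sum, ← Finset.sum_add_distrib]
  refine Finset.sum_congr rfl fun q hq => ?_
  rw [Nat.support_factorization, Nat.mem_primeFactors] at hq
  have key : ∀ t : ℤ, IsCoprime (n : ℤ) t → ¬ (q : ℤ) ∣ t := fun t ht h =>
    (Nat.prime_iff_prime_int.1 hq.1).not_isUnit
      (ht.isUnit_of_dvd' (Int.natCast_dvd_natCast.2 hq.2.1) h)
  rw [e_mul (key _ hz) (key _ hw), mul_add]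

lemma E_eq_zero {z : Eis} {n : ℕ} (h : ∀ q, q.Prime → q ∣ n → e q z = 0) : E z n = 0 := by
  rw [E, Finsupp.sum]
  refine Finset.sum_eq_zero fun q hq => ?_
  rw [Nat.support_factorization, Nat.mem_primeFactors] at hq
  rw [h q hq.1 hq.2.1, mul_zero]

/-! ### The cubic residue character and rational cubic reciprocity -/

/-- Evaluation of Eisenstein integers at a root of `X² + X + 1`. -/
def evE {R : Type*} [CommRing R] (r : R) (hr : r ^ 2 + r + 1 = 0) : Eis →+* R where
  toFun z := z.re + z.im * r
  map_one' := by simp [QuadraticAlgebra.re_one, QuadraticAlgebra.im_one]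
  map_zero' := by simp
  map_add' x y := by simp; ring
  map_mul' x y := by
    simp
    linear_combination (-(x.im : R) * y.im) * hr

lemma evE_apply {R : Type*} [CommRing R] (r : R) (hr : r ^ 2 + r + 1 = 0) (z : Eis) :
    evE r hr z = z.re + z.im * r := rfl

lemma evE_omE {R : Type*} [CommRing R] (r : R) (hr : r ^ 2 + r + 1 = 0) : evE r hr omE = r := by
  simp [evE_apply, omE]

lemma omE_cube : omE ^ 3 = 1 := by linear_combination (omE - 1) * omE_sq

lemma Eis.cube_root_cases {w : Eis} (h : w ^ 3 = 1) : w = 1 ∨ w = omE ∨ w = omE ^ 2 := by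
  have : (w - 1) * ((w - omE) * (w - omE ^ 2)) = 0 := by
    linear_combination h + (w - w ^ 2) * omE_sq + (w - 1) * omE_cube
  rcases mul_eq_zero.1 this with h | h
  · exact .inl (sub_eq_zero.1 h)
  rcases mul_eq_zero.1 h with h | h
  · exact .inr (.inl (sub_eq_zero.1 h))
  · exact .inr (.inr (sub_eq_zero.1 h))

lemma omE_ne_one : omE ≠ 1 := by
  intro h
  have := congrArg QuadraticAlgebra.im h
  simp [omE, QuadraticAlgebra.im_one] at this

lemma omE_primitive : IsPrimitiveRoot omE 3 :=
  IsPrimitiveRoot.iff_orderOf.2 (orderOf_eq_prime omE_cube omE_ne_one)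

lemma star_omE : star omE = omE ^ 2 := by
  ext <;> simp [omE, pow_two]

lemma star_cube_root {w : Eis} (h : w ^ 3 = 1) : star w = w ^ 2 := by
  rcases Eis.cube_root_cases h with rfl | rfl | rfl
  · simp
  · exact star_omE
  · rw [star_pow, star_omE]

section root

variable {F : Type*} [Field F] {r : F} (hr : r ^ 2 + r + 1 = 0) (h3 : (3 : F) ≠ 0)
include hr

lemma root_cube : r ^ 3 = 1 := by linear_combination (r - 1) * hr

include h3

lemma root_ne_one : r ≠ 1 := by
  rintro rfl
  apply h3; linear_combination hr

lemma root_ne_one_sq : r ^ 2 ≠ 1 := by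
  intro h
  apply root_ne_one hr h3
  linear_combination root_cube hr - r * h

lemma evE_inj {w v : Eis} (hw : w ^ 3 = 1) (hv : v ^ 3 = 1) (h : evE r hr w = evE r hr v) :
    w = v := by
  have h1 := root_ne_one hr h3
  have h2 := root_ne_one_sq hr h3
  have h4 : r ^ 2 ≠ r := by
    intro h
    have := root_cube hr
    have h0 : r ≠ 0 := by rintro rfl; simp at this
    apply h1
    apply mul_left_cancel₀ h0
    linear_combination h
  rcases Eis.cube_root_cases hw with rfl | rfl | rfl <;>
  rcases Eis.cube_root_cases hv with rfl | rfl | rfl <;>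
  simp_all [evE_omE, eq_comm]

end root

section character

variable (p : ℕ) [Fact p.Prime] (r : ZMod p)

open Classical in
/-- The underlying function of the cubic residue character. -/
def chiFun (a : ZMod p) : Eis :=
  if a = 0 then 0 else if a ^ ((p - 1) / 3) = 1 then 1
    else if a ^ ((p - 1) / 3) = r then omE else omE ^ 2

variable {p r} (hp : p % 3 = 1) (hr : r ^ 2 + r + 1 = 0)

include hp in
lemma zmod_three_ne_zero : (3 : ZMod p) ≠ 0 := by
  intro h
  have h2 : ((3 : ℕ) : ZMod p) = 0 := by exact_mod_cast h
  rw [ZMod.natCast_eq_zero_iff] at h2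
  have := (Nat.prime_dvd_prime_iff_eq Fact.out Nat.prime_three).1 h2
  subst this; norm_num at hp

lemma chiFun_cube {a : ZMod p} (ha : a ≠ 0) : chiFun p r a ^ 3 = 1 := by
  rw [chiFun, if_neg ha]
  split_ifs
  · simp
  · exact omE_cube
  · rw [← pow_mul, mul_comm, pow_mul, omE_cube, one_pow]

include hp in
lemma evE_chiFun (a : ZMod p) : evE r hr (chiFun p r a) = a ^ ((p - 1) / 3) := by
  have hp2 : 2 ≤ p := (Fact.out : p.Prime).two_le
  by_cases ha : a = 0
  · rw [chiFun, if_pos ha, ha, map_zero, zero_pow (by omega)]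
  have h3 : (a ^ ((p - 1) / 3)) ^ 3 = 1 := by
    rw [← pow_mul, show (p - 1) / 3 * 3 = p - 1 by omega, ZMod.pow_card_sub_one_eq_one ha]
  rw [chiFun, if_neg ha]
  split_ifs with h1 h2
  · rw [h1, map_one]
  · rw [h2, evE_omE]
  · rw [map_pow, evE_omE]
    have : (a ^ ((p - 1) / 3) - 1) * ((a ^ ((p - 1) / 3) - r) * (a ^ ((p - 1) / 3) - r ^ 2)) = 0 := by
      linear_combination h3 + (a ^ ((p - 1) / 3) - (a ^ ((p - 1) / 3)) ^ 2) * hr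
        + (a ^ ((p - 1) / 3) - 1) * root_cube hr
    rcases mul_eq_zero.1 this with h | h
    · exact absurd (sub_eq_zero.1 h) h1
    rcases mul_eq_zero.1 h with h | h
    · exact absurd (sub_eq_zero.1 h) h2
    · exact (sub_eq_zero.1 h).symm

/-- The cubic residue character modulo the prime determined by `r`. -/
def chi : MulChar (ZMod p) Eis where
  toFun := chiFun p r
  map_one' := by simp [chiFun]
  map_mul' a b := by
    by_cases ha : a = 0
    · simp [chiFun, ha]
    by_cases hb : b = 0
    · simp [chiFun, hb]
    apply evE_inj hr (zmod_three_ne_zero hp)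
    · exact chiFun_cube (mul_ne_zero ha hb)
    · rw [mul_pow, chiFun_cube ha, chiFun_cube hb, one_mul]
    · rw [map_mul, evE_chiFun hp, evE_chiFun hp, evE_chiFun hp, mul_pow]
  map_nonunit' a ha := by
    rw [isUnit_iff_ne_zero, not_not] at ha
    simp [chiFun, ha]

lemma chi_cube {a : ZMod p} (ha : a ≠ 0) : chi hp hr a ^ 3 = 1 := chiFun_cube ha

lemma evE_chi (a : ZMod p) : evE r hr (chi hp hr a) = a ^ ((p - 1) / 3) := evE_chiFun hp hr a

lemma chi_pow_three : chi hp hr ^ 3 = 1 := by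
  refine MulChar.ext fun a => ?_
  rw [MulChar.pow_apply_coe, chi_cube hp hr a.ne_zero, MulChar.one_apply_coe]

lemma chi_ne_one : chi hp hr ≠ 1 := by
  intro h
  obtain ⟨g, hg⟩ := IsCyclic.exists_generator (α := (ZMod p)ˣ)
  have ho : orderOf g = p - 1 := by
    rw [orderOf_eq_card_of_forall_mem_zpowers hg, Nat.card_eq_fintype_card, ZMod.card_units]
  have h1 := evE_chi hp hr (g : ZMod p)
  rw [h, MulChar.one_apply_coe, map_one] at h1
  have h2 : g ^ ((p - 1) / 3) = 1 := by ext; push_cast; exact h1.symm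
  have := orderOf_dvd_of_pow_eq_one h2
  have hp2 : 2 ≤ p := (Fact.out : p.Prime).two_le
  have := Nat.le_of_dvd (by omega) this
  omega

lemma chi_mul_self_ne_one : chi hp hr * chi hp hr ≠ 1 := by
  intro h
  apply chi_ne_one hp hr
  have := chi_pow_three hp hr
  rwa [pow_succ, pow_two, h, one_mul] at this

lemma chi_inv : (chi hp hr)⁻¹ = (chi hp hr).ringHomComp (starRingEnd Eis) := by
  rw [inv_eq_iff_mul_eq_one]
  refine MulChar.ext fun a => ?_
  have h := chi_cube hp hr a.ne_zero
  rw [MulChar.mul_apply, MulChar.ringHomComp_apply, MulChar.one_apply_coe, starRingEnd_apply,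
    star_cube_root h, ← pow_succ', h]

/-- The cubic Jacobi sum. -/
def Jac : Eis := jacobiSum (chi hp hr) (chi hp hr)

lemma Jac_star : star (Jac hp hr) = jacobiSum (chi hp hr)⁻¹ (chi hp hr)⁻¹ := by
  rw [chi_inv, jacobiSum_ringHomComp]; rfl

lemma Jac_norm : (Jac hp hr).norm = p := by
  have hinj : Function.Injective (algebraMap Eis (FractionRing Eis)) :=
    IsFractionRing.injective Eis (FractionRing Eis)
  have : CharZero (FractionRing Eis) := charZero_of_injective_algebraMap hinj
  have h := jacobiSum_mul_jacobiSum_inv (F := ZMod p) (F' := FractionRing Eis)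
    (χ := (chi hp hr).ringHomComp (algebraMap Eis (FractionRing Eis)))
    (φ := (chi hp hr).ringHomComp (algebraMap Eis (FractionRing Eis)))
    (by rw [ringChar.eq_zero, ZMod.ringChar_zmod_n]; exact (Fact.out : p.Prime).ne_zero.symm)
    (by rw [MulChar.ringHomComp_ne_one_iff hinj]; exact chi_ne_one hp hr)
    (by rw [MulChar.ringHomComp_ne_one_iff hinj]; exact chi_ne_one hp hr)
    (by rw [← MulChar.ringHomComp_mul, MulChar.ringHomComp_ne_one_iff hinj]
        exact chi_mul_self_ne_one hp hr)
  rw [MulChar.ringHomComp_inv, jacobiSum_ringHomComp, jacobiSum_ringHomComp, ← Jac_star,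
    ← map_mul, ZMod.card] at h
  have h2 : Jac hp hr * star (Jac hp hr) = (p : Eis) := hinj (by rw [map_natCast]; exact h)
  rw [Eis.mul_star_eq] at h2
  exact_mod_cast h2

lemma Jac_mod_three : (3 : ℤ) ∣ (Jac hp hr).re + 1 ∧ (3 : ℤ) ∣ (Jac hp hr).im := by
  obtain ⟨z, -, hz⟩ := exists_jacobiSum_eq_neg_one_add (F := ZMod p) (n := 3) (by norm_num)
    (chi_pow_three hp hr) (chi_pow_three hp hr) (by rw [ZMod.card]; omega) omE_primitive
  have h1 : Jac hp hr = -1 + 3 * (-(z * omE)) := by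
    rw [Jac, hz]; linear_combination z * omE_sq
  have re3 : (3 : Eis).re = 3 := QuadraticAlgebra.re_ofNat 3
  have im3 : (3 : Eis).im = 0 := QuadraticAlgebra.im_ofNat 3
  rw [h1]
  constructor
  · simp [QuadraticAlgebra.re_one, re3, im3]
  · simp only [QuadraticAlgebra.im_add, QuadraticAlgebra.im_neg, QuadraticAlgebra.im_one,
      QuadraticAlgebra.im_mul, re3, im3]
    exact ⟨-(z * omE).im, by simp⟩

lemma evE_Jac : evE r hr (Jac hp hr) = 0 := by
  have hp2 : 2 ≤ p := (Fact.out : p.Prime).two_le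
  rw [Jac, jacobiSum, map_sum]
  simp only [map_mul, evE_chi]
  set k := (p - 1) / 3 with hk
  let P : Polynomial (ZMod p) := (1 - Polynomial.X) ^ k
  have hdeg : P.natDegree ≤ k := by
    refine (Polynomial.natDegree_pow_le).trans ?_
    have : (1 - Polynomial.X : Polynomial (ZMod p)).natDegree ≤ 1 := by compute_degree
    nlinarith
  have h1 : ∀ x : ZMod p, x ^ k * (1 - x) ^ k =
      ∑ i ∈ Finset.range (k + 1), P.coeff i * x ^ (k + i) := by
    intro x
    have : (1 - x) ^ k = P.eval x := by simp [P]
    rw [this, Polynomial.eval_eq_sum_range' (Nat.lt_succ_of_le hdeg), Finset.mul_sum]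
    exact Finset.sum_congr rfl fun i _ => by ring
  simp only [h1]
  rw [Finset.sum_comm]
  refine Finset.sum_eq_zero fun i hi => ?_
  rw [← Finset.mul_sum, FiniteField.sum_pow_lt_card_sub_one, mul_zero]
  rw [ZMod.card]
  rw [Finset.mem_range] at hi
  omega

lemma Jac_dvd {z : Eis} (hz : evE r hr z = 0) : Jac hp hr ∣ z := by
  have hJ := evE_Jac hp hr
  rw [evE_apply] at hz hJ
  have h2 : ∀ n : ℤ, (n : ZMod p) = 0 → (p : ℤ) ∣ n := fun n h =>
    (ZMod.intCast_zmod_eq_zero_iff_dvd n p).1 h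
  obtain ⟨u, hu⟩ := h2 ((z * star (Jac hp hr)).re) (by
    simp
    linear_combination ((Jac hp hr).re - (Jac hp hr).im) * hz - (z.im : ZMod p) * r * hJ
      + z.im * (Jac hp hr).im * hr)
  obtain ⟨v, hv⟩ := h2 ((z * star (Jac hp hr)).im) (by
    simp
    linear_combination (z.im : ZMod p) * hJ - (Jac hp hr).im * hz)
  refine ⟨⟨u, v⟩, ?_⟩
  have hs : star (Jac hp hr) ≠ 0 := by
    intro h
    have h3 := Jac_norm hp hr
    rw [← QuadraticAlgebra.norm_star, h] at h3
    simp at h3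
    exact (Fact.out : p.Prime).ne_zero (by exact_mod_cast h3.symm)
  apply mul_right_cancel₀ hs
  rw [mul_right_comm, Eis.mul_star_eq, Jac_norm]
  ext
  · rw [hu]; simp
  · rw [hv]; simp

end character

section gauss

variable {p : ℕ} [Fact p.Prime] {r : ZMod p} (hp : p % 3 = 1) (hr : r ^ 2 + r + 1 = 0)
variable (q : ℕ) [Fact q.Prime]

/-- The cubic residue character with values in characteristic `q`. -/
def chiq : MulChar (ZMod p) (Kap q) := (chi hp hr).ringHomComp (rho q)

lemma rho_eq_evE : rho q = evE (om q) (om_sq q) := by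
  ext z; rfl

lemma kap_three_ne_zero (h3 : q ≠ 3) : (3 : Kap q) ≠ 0 := by
  intro h
  have h2 : ((3 : ℕ) : Kap q) = 0 := by exact_mod_cast h
  rw [CharP.cast_eq_zero_iff (Kap q) q] at h2
  exact h3 ((Nat.prime_dvd_prime_iff_eq Fact.out Nat.prime_three).1 h2)

lemma chiq_ne_one (h3 : q ≠ 3) : chiq hp hr q ≠ 1 := by
  intro h
  apply chi_ne_one hp hr
  refine MulChar.ext fun a => ?_
  rw [MulChar.one_apply_coe]
  apply evE_inj (om_sq q) (kap_three_ne_zero q h3) (chi_cube hp hr a.ne_zero) (one_pow 3)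
  rw [← rho_eq_evE, map_one]
  have := congrArg (fun f : MulChar (ZMod p) (Kap q) => f (a : ZMod p)) h
  simpa [chiq, MulChar.one_apply_coe] using this

lemma chiq_pow_three : chiq hp hr q ^ 3 = 1 := by
  rw [chiq, MulChar.ringHomComp_pow, chi_pow_three, MulChar.ringHomComp_one]

lemma chiq_orderOf (h3 : q ≠ 3) : orderOf (chiq hp hr q) = 3 :=
  orderOf_eq_prime (chiq_pow_three hp hr q) (chiq_ne_one hp hr q h3)

lemma chiq_inv_orderOf (h3 : q ≠ 3) : orderOf (chiq hp hr q)⁻¹ = 3 := by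
  rw [orderOf_inv, chiq_orderOf hp hr q h3]

lemma exists_primitive_addChar (hpq : q ≠ p) :
    ∃ ψ : AddChar (ZMod p) (Kap q), ψ.IsPrimitive := by
  have : NeZero (p : Kap q) := ⟨by
    rw [Ne, CharP.cast_eq_zero_iff (Kap q) q]
    intro h
    exact hpq ((Nat.prime_dvd_prime_iff_eq Fact.out Fact.out).1 h)⟩
  obtain ⟨ζ, hζ⟩ := HasEnoughRootsOfUnity.exists_primitiveRoot (Kap q) p
  exact ⟨_, AddChar.zmodChar_primitive_of_primitive_root p hζ⟩

lemma mulChar_neg_one {χ : MulChar (ZMod p) (Kap q)} (h : χ ^ 3 = 1) : χ (-1) = 1 := by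
  have h1 : χ (-1) ^ 3 = 1 := by
    have := MulChar.pow_apply_coe χ 3 (-1)
    rw [h, MulChar.one_apply_coe] at this
    simpa using this.symm
  have h2 : χ (-1) ^ 2 = 1 := by rw [← map_pow]; simp
  calc χ (-1) = χ (-1) * χ (-1) ^ 2 := by rw [h2, mul_one]
    _ = χ (-1) ^ 3 := by ring
    _ = 1 := h1

lemma gaussSum_cube {χ : MulChar (ZMod p) (Kap q)} (h : orderOf χ = 3)
    {ψ : AddChar (ZMod p) (Kap q)} (hψ : ψ.IsPrimitive) :
    gaussSum χ ψ ^ 3 = p * jacobiSum χ χ := by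
  have := gaussSum_pow_eq_prod_jacobiSum (χ := χ) (ψ := ψ) (by omega) hψ
  rw [h, mulChar_neg_one q (by rw [← h, pow_orderOf_eq_one]), ZMod.card] at this
  rw [this]; norm_num [Finset.prod_Ico_eq_prod_range]

lemma gaussSum_pow_char {χ : MulChar (ZMod p) (Kap q)} (hpq : q ≠ p)
    {ψ : AddChar (ZMod p) (Kap q)} :
    χ q * gaussSum χ ψ ^ q = χ q * ((χ ^ q)⁻¹ q * gaussSum (χ ^ q) ψ) := by
  have hu : IsUnit (q : ZMod p) := by
    rw [isUnit_iff_ne_zero, Ne, ZMod.natCast_eq_zero_iff]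
    intro h
    exact hpq.symm ((Nat.prime_dvd_prime_iff_eq Fact.out Fact.out).1 h)
  rw [gaussSum_frob, AddChar.pow_mulShift]
  have := gaussSum_mulShift_eq (χ ^ q) ψ hu.unit
  rw [IsUnit.unit_spec] at this
  rw [this]

lemma chiq_apply_inv (a : ZMod p) : (chiq hp hr q)⁻¹ a = (chiq hp hr q a)⁻¹ := by
  rw [MulChar.inv_apply_eq_inv, Ring.inverse_eq_inv']

theorem cu_Jac (hpq : q ≠ p) (h3 : q ≠ 3) : cu q (Jac hp hr) = rho q (chi hp hr q) := by
  obtain ⟨ψ, hψ⟩ := exists_primitive_addChar q hpq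
  set χ := chiq hp hr q with hχ
  have hq0 : (q : ZMod p) ≠ 0 := by
    rw [Ne, ZMod.natCast_eq_zero_iff]
    intro h
    exact hpq.symm ((Nat.prime_dvd_prime_iff_eq Fact.out Fact.out).1 h)
  have hp0 : (p : Kap q) ≠ 0 := by
    rw [Ne, CharP.cast_eq_zero_iff (Kap q) q]
    intro h
    exact hpq ((Nat.prime_dvd_prime_iff_eq Fact.out Fact.out).1 h)
  have hc : χ q = rho q (chi hp hr q) := rfl
  have hc3 : χ q ^ 3 = 1 := by rw [hc, ← map_pow, chi_cube hp hr hq0, map_one]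
  have hc0 : χ q ≠ 0 := by intro h; rw [h] at hc3; simp at hc3
  set g := gaussSum χ ψ with hg
  set g' := gaussSum χ⁻¹ ψ with hg'
  have hg0 : g ≠ 0 :=
    gaussSum_ne_zero_of_nontrivial (by rwa [ZMod.card]) (chiq_ne_one hp hr q h3) hψ
  have hg0' : g' ≠ 0 := gaussSum_ne_zero_of_nontrivial (by rwa [ZMod.card])
    (inv_ne_one.2 (chiq_ne_one hp hr q h3)) hψ
  have e1 : g ^ 3 = p * rho q (Jac hp hr) := by
    rw [hg, gaussSum_cube q (chiq_orderOf hp hr q h3) hψ, chiq, jacobiSum_ringHomComp]; rfl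
  have e2 : g' ^ 3 = p * rho q (star (Jac hp hr)) := by
    rw [hg', gaussSum_cube q (chiq_inv_orderOf hp hr q h3) hψ, chiq, MulChar.ringHomComp_inv,
      jacobiSum_ringHomComp, Jac_star]
  have hinv : χ⁻¹ q = (χ q)⁻¹ := chiq_apply_inv hp hr q q
  have f1 := gaussSum_pow_char (χ := χ) (ψ := ψ) q hpq
  have f2 := gaussSum_pow_char (χ := χ⁻¹) (ψ := ψ) q hpq
  have hc0' : χ⁻¹ q ≠ 0 := by rw [hinv]; exact inv_ne_zero hc0
  have f1' := mul_left_cancel₀ hc0 f1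
  have f2' := mul_left_cancel₀ hc0' f2
  rw [← hg] at f1'
  rw [← hg'] at f2'
  have hq2 : 2 ≤ q := (Fact.out : q.Prime).two_le
  have e3 : rho q (Jac hp hr) / rho q (star (Jac hp hr)) = (g / g') ^ 3 := by
    rw [div_pow, e1, e2, mul_div_mul_left _ _ hp0]
  have e4 : rho q (star (Jac hp hr)) / rho q (Jac hp hr) = (g' / g) ^ 3 := by
    rw [div_pow, e1, e2, mul_div_mul_left _ _ hp0]
  rw [← hc]
  rcases prime_mod_three q h3 with h1 | h1
  · have hpow : χ ^ q = χ := by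
      have : χ ^ q = χ ^ (3 * (q / 3) + q % 3) := by rw [Nat.div_add_mod]
      rw [this, h1, pow_add, pow_mul, chiq_pow_three]; simp
    rw [inv_pow, hpow, inv_inv] at f2'
    rw [hpow, hinv] at f1'
    have k1 : g ^ (q - 1) = (χ q)⁻¹ := by
      apply mul_right_cancel₀ hg0
      rw [← pow_succ, Nat.sub_add_cancel (by omega), f1']
    have k2 : g' ^ (q - 1) = χ q := by
      apply mul_right_cancel₀ hg0'
      rw [← pow_succ, Nat.sub_add_cancel (by omega), f2']
    rw [cu_one q h1, e3, ← pow_mul, show 3 * ((q - 1) / 3) = q - 1 by omega, div_pow, k1, k2]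
    field_simp
    rw [← hc3]
  · have hpow : χ ^ q = χ⁻¹ := by
      have : χ ^ q = χ ^ (3 * (q / 3) + q % 3) := by rw [Nat.div_add_mod]
      rw [this, h1, pow_add, pow_mul, chiq_pow_three, one_pow, one_mul, eq_inv_iff_mul_eq_one,
        ← pow_succ, chiq_pow_three]
    rw [inv_pow, hpow, inv_inv, inv_inv, hinv] at f2'
    rw [hpow, inv_inv] at f1'
    rw [cu_two q h1, e4, ← pow_mul, show 3 * ((q + 1) / 3) = q + 1 by omega, pow_succ, div_pow,
      f1', f2', ← hg, ← hg']
    field_simp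
    rw [hc3]

end gauss

lemma omE_pow_inj {a b : ZMod 3} (h : omE ^ a.val = omE ^ b.val) : a = b :=
  ZMod.val_injective 3 (omE_primitive.pow_inj (ZMod.val_lt a) (ZMod.val_lt b) h)

lemma omE_pow_add (a b : ZMod 3) : omE ^ (a + b).val = omE ^ a.val * omE ^ b.val := by
  rw [ZMod.val_add, ← pow_add]
  conv_rhs => rw [← Nat.div_add_mod (a.val + b.val) 3, pow_add, pow_mul, omE_cube]
  simp

lemma rho_lg (q : ℕ) [Fact q.Prime] (h3 : q ≠ 3) {w : Eis} (hw : w ^ 3 = 1) :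
    omE ^ (lg q (rho q w)).val = w := by
  rcases Eis.cube_root_cases hw with rfl | rfl | rfl
  · rw [map_one, lg_one q h3]; simp
  · rw [rho_omE, lg_om, ZMod.val_one'' (by norm_num)]; simp
  · rw [map_pow, rho_omE, lg_om_sq q h3]; rfl

section character
variable {p : ℕ} [Fact p.Prime] {r : ZMod p} (hp : p % 3 = 1) (hr : r ^ 2 + r + 1 = 0)

theorem E_Jac {m : ℕ} (hm0 : m ≠ 0) (hmp : ¬ p ∣ m) (hm3 : ¬ 3 ∣ m) :
    omE ^ (E (Jac hp hr) m).val = chi hp hr m := by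
  induction m using Nat.recOnMul with
  | zero => exact absurd rfl hm0
  | one => rw [E_one]; simp
  | prime q hq =>
    have := Fact.mk hq
    have hpq : q ≠ p := by rintro rfl; exact hmp dvd_rfl
    have h3 : q ≠ 3 := by rintro rfl; exact hm3 dvd_rfl
    have hq0 : (q : ZMod p) ≠ 0 := by rwa [Ne, ZMod.natCast_eq_zero_iff]
    rw [E_prime _ hq, e_prime q h3, cu_Jac hp hr q hpq h3, rho_lg q h3 (chi_cube hp hr hq0)]
  | mul a b iha ihb =>
    have ha0 : a ≠ 0 := by rintro rfl; simp at hm0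
    have hb0 : b ≠ 0 := by rintro rfl; simp at hm0
    rw [E_mul _ ha0 hb0, omE_pow_add, iha ha0 (fun h => hmp (h.mul_right _))
      (fun h => hm3 (h.mul_right _)), ihb hb0 (fun h => hmp (h.mul_left _))
      (fun h => hm3 (h.mul_left _)), Nat.cast_mul, map_mul]

theorem E_Jac_eq {m n : ℕ} (hm0 : m ≠ 0) (hn0 : n ≠ 0) (hmp : ¬ p ∣ m) (hnp : ¬ p ∣ n)
    (hm3 : ¬ 3 ∣ m) (hn3 : ¬ 3 ∣ n) {c : Eis} (h : Jac hp hr ∣ (m : Eis) - c ^ 3 * n) :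
    E (Jac hp hr) m = E (Jac hp hr) n := by
  apply omE_pow_inj
  rw [E_Jac hp hr hm0 hmp hm3, E_Jac hp hr hn0 hnp hn3]
  obtain ⟨w, hw⟩ := h
  have h1 := congrArg (evE r hr) hw
  rw [map_mul, evE_Jac, zero_mul, map_sub, map_mul, map_natCast, map_natCast, sub_eq_zero,
    map_pow] at h1
  have hm : (m : ZMod p) ≠ 0 := by rwa [Ne, ZMod.natCast_eq_zero_iff]
  have hc : evE r hr c ≠ 0 := by
    intro h0; rw [h0] at h1; simp at h1; exact hm h1
  rw [h1, map_mul, map_pow, chi_cube hp hr hc, one_mul]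

end character

lemma e_one_right (q : ℕ) : e q 1 = 0 := by
  by_cases h : q.Prime
  · have h1 : ¬ (q : ℤ) ∣ (1 : Eis).norm := by
      rw [map_one]; exact fun h' => (Nat.prime_iff_prime_int.1 h).not_isUnit (isUnit_of_dvd_one h')
    have := e_mul h1 h1
    rw [mul_one] at this
    simpa using this
  · exact e_not (fun h' => h h'.1) 1

lemma e_int {q : ℕ} {n : ℤ} (hn : ¬ (q : ℤ) ∣ n) : e q (n : Eis) = 0 := by
  rw [← mul_one (n : Eis), e_int_mul hn, e_one_right]

lemma not_dvd_of_isCoprime {n q : ℕ} {t : ℤ} (ht : IsCoprime (n : ℤ) t) (hq : q.Prime)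
    (hqn : q ∣ n) : ¬ (q : ℤ) ∣ t := fun h =>
  (Nat.prime_iff_prime_int.1 hq).not_isUnit (ht.isUnit_of_dvd' (Int.natCast_dvd_natCast.2 hqn) h)

lemma E_int {n : ℤ} {m : ℕ} (h : IsCoprime (m : ℤ) n) : E (n : Eis) m = 0 :=
  E_eq_zero fun _ hq hqm => e_int (not_dvd_of_isCoprime h hq hqm)

lemma exists_prime_factor_cases {z : Eis} {p : ℕ} [Fact p.Prime] (h3 : p ≠ 3)
    (hpz : (p : ℤ) ∣ z.norm) : (∃ w, z = (p : Eis) * w) ∨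
      ∃ (r : ZMod p) (hr : r ^ 2 + r + 1 = 0), p % 3 = 1 ∧ evE r hr z = 0 := by
  rw [Eis.norm_eq] at hpz
  by_cases hB : (p : ℤ) ∣ z.im
  · left
    have hA : (p : ℤ) ∣ z.re := by
      apply Int.Prime.dvd_pow' (k := 2) (Fact.out : p.Prime)
      obtain ⟨k, hk⟩ := hB
      obtain ⟨l, hl⟩ := hpz
      exact ⟨l + z.re * k - z.im * k, by linear_combination hl + z.re * hk - z.im * hk⟩
    obtain ⟨k, hk⟩ := hB
    obtain ⟨l, hl⟩ := hA
    exact ⟨⟨l, k⟩, by ext <;> simp [hk, hl]⟩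
  · right
    have hB' : (z.im : ZMod p) ≠ 0 := by rwa [Ne, ZMod.intCast_zmod_eq_zero_iff_dvd]
    have hn : (z.re : ZMod p) ^ 2 - z.re * z.im + z.im ^ 2 = 0 := by
      have := (ZMod.intCast_zmod_eq_zero_iff_dvd _ p).2 hpz
      push_cast at this; exact this
    set r : ZMod p := - z.re / z.im with hr
    have hr0 : r * z.im = - z.re := by rw [hr]; field_simp
    have hr1 : r ^ 2 + r + 1 = 0 := by
      have : (r ^ 2 + r + 1) * (z.im : ZMod p) ^ 2 = 0 := by
        linear_combination hn + (r * z.im - z.re + z.im) * hr0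
      exact (mul_eq_zero.1 this).resolve_right (pow_ne_zero 2 hB')
    refine ⟨r, hr1, ?_, ?_⟩
    · rcases prime_mod_three p h3 with h | h
      · exact h
      exfalso
      have h30 : (3 : ZMod p) ≠ 0 := by
        intro h
        have h2 : ((3 : ℕ) : ZMod p) = 0 := by exact_mod_cast h
        rw [ZMod.natCast_eq_zero_iff] at h2
        exact h3 ((Nat.prime_dvd_prime_iff_eq Fact.out Nat.prime_three).1 h2)
      have hr00 : r ≠ 0 := by intro h; rw [h] at hr1; simp at hr1
      have hone := ZMod.pow_card_sub_one_eq_one hr00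
      have hp2 : 2 ≤ p := (Fact.out : p.Prime).two_le
      rw [← Nat.div_add_mod (p - 1) 3, show (p - 1) % 3 = 1 by omega, pow_add, pow_mul,
        root_cube hr1, one_pow, one_mul, pow_one] at hone
      exact root_ne_one hr1 h30 hone
    · rw [evE_apply, mul_comm, hr0]; ring

/-- Rational cubic reciprocity. -/
theorem cubic_recip (N : ℕ) : ∀ z : Eis, z.norm = N → (3 : ℤ) ∣ z.im → ¬ (3 : ℤ) ∣ z.re →
    ∀ m n : ℕ, m ≠ 0 → n ≠ 0 → ¬ 3 ∣ m → ¬ 3 ∣ n → IsCoprime (m : ℤ) z.norm →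
    IsCoprime (n : ℤ) z.norm → ∀ c : Eis, z ∣ (m : Eis) - c ^ 3 * n → E z m = E z n := by
  induction N using Nat.strong_induction_on with
  | _ N ih =>
  intro z hN him hre m n hm0 hn0 hm3 hn3 hmz hnz c hc
  by_cases hN1 : N = 1
  · rw [hN1, Eis.norm_eq] at hN
    obtain ⟨k, hk⟩ := him
    have hk0 : k = 0 := by
      have : k ^ 2 < 1 := by
        rw [hk] at hN; push_cast at hN; nlinarith [sq_nonneg (2 * z.re - 3 * k)]
      exact pow_eq_zero_iff (two_ne_zero) |>.1 (by nlinarith [sq_nonneg k])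
    have hz : z = (z.re : Eis) := by ext <;> simp [hk, hk0]
    have hcop : ∀ t : ℤ, IsCoprime t z.re := fun t => by
      rw [hk, hk0] at hN
      refine ⟨0, z.re, ?_⟩
      push_cast at hN
      linarith
    rw [hz, E_int (hcop _), E_int (hcop _)]
  obtain ⟨p, hp, hpN⟩ := Nat.exists_prime_and_dvd hN1
  have := Fact.mk hp
  have hN0 : N ≠ 0 := by
    rintro rfl
    rw [Nat.cast_zero, Eis.norm_eq_zero] at hN
    rw [hN] at hre; simp at hre
  have hpz : (p : ℤ) ∣ z.norm := by rw [hN]; exact_mod_cast hpN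
  have hp3 : p ≠ 3 := by
    rintro rfl
    apply hre
    apply Int.Prime.dvd_pow' (k := 2) Nat.prime_three
    obtain ⟨k, hk⟩ := him
    obtain ⟨l, hl⟩ := hpz
    rw [Eis.norm_eq] at hl
    exact ⟨l + z.re * k - z.im * k, by
      push_cast at hl ⊢
      linear_combination hl + z.re * hk - z.im * hk⟩
  have key : ∀ y w : Eis, z = y * w → 1 < y.norm → (3 : ℤ) ∣ w.im → ¬ (3 : ℤ) ∣ w.re →
      (IsCoprime (m : ℤ) y.norm → IsCoprime (n : ℤ) y.norm → E y m = E y n) → E z m = E z n := by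
    intro y w hz hy h1 h2 hE
    have hnorm : z.norm = y.norm * w.norm := by rw [hz, map_mul]
    rw [hnorm] at hmz hnz
    obtain ⟨M, hM⟩ := Int.eq_ofNat_of_zero_le (Eis.norm_nonneg w)
    have hlt : M < N := by
      rw [hN, hM] at hnorm
      have : 0 < M := by
        rcases Nat.eq_zero_or_pos M with h | h
        · rw [h, Nat.cast_zero, mul_zero] at hnorm
          exact absurd (by exact_mod_cast hnorm) hN0
        · exact h
      have : (M : ℤ) < N := by rw [hnorm]; nlinarith
      exact_mod_cast this
    rw [hz, E_mul_left hmz.of_mul_right_left hmz.of_mul_right_right,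
      E_mul_left hnz.of_mul_right_left hnz.of_mul_right_right,
      hE hmz.of_mul_right_left hnz.of_mul_right_left,
      ih M hlt w hM h1 h2 m n hm0 hn0 hm3 hn3 hmz.of_mul_right_right hnz.of_mul_right_right c
        ((Dvd.intro_left y hz.symm).trans hc)]
  have h3p : ¬ (3 : ℤ) ∣ p := by
    intro h
    exact hp3 ((Nat.prime_dvd_prime_iff_eq Nat.prime_three hp).1 (by exact_mod_cast h)).symm
  rcases exists_prime_factor_cases hp3 hpz with ⟨w, hw⟩ | ⟨r, hr, hp1, hev⟩
  · refine key (p : Eis) w hw ?_ ?_ ?_ ?_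
    · rw [QuadraticAlgebra.norm_natCast]
      have := hp.one_lt
      nlinarith [(by exact_mod_cast this : (1 : ℤ) < p)]
    · rw [hw] at him
      simp at him
      exact (Int.Prime.dvd_mul' Nat.prime_three him).resolve_left (by exact_mod_cast h3p)
    · rw [hw] at hre
      intro h
      apply hre
      simpa using h.mul_left (p : ℤ)
    · intro h1 h2
      rw [QuadraticAlgebra.norm_natCast] at h1 h2
      have h1' := (IsCoprime.pow_right_iff two_pos).1 h1
      have h2' := (IsCoprime.pow_right_iff two_pos).1 h2
      have e1 := E_int h1'
      have e2 := E_int h2'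
      rw [Int.cast_natCast] at e1 e2
      rw [e1, e2]
  · obtain ⟨w, hw⟩ := Jac_dvd hp1 hr hev
    obtain ⟨⟨s, hs⟩, ⟨t, ht⟩⟩ := Jac_mod_three hp1 hr
    have hs' : (Jac hp1 hr).re = 3 * s - 1 := by linarith
    have him' : (3 : ℤ) ∣ w.im := by
      obtain ⟨k, hk⟩ := him
      rw [hw] at hk
      simp [hs', ht] at hk
      exact ⟨s * w.im + t * w.re - t * w.im - k, by linear_combination -hk⟩
    refine key (Jac hp1 hr) w hw ?_ him' ?_ ?_
    · rw [Jac_norm]; exact_mod_cast hp.one_lt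
    · rintro ⟨l, hl⟩
      apply hre
      rw [hw]
      simp [hs', ht, hl]
      obtain ⟨k, hk⟩ := him'
      exact ⟨(3 * s - 1) * l - t * w.im, by ring⟩
    · intro h1 h2
      rw [Jac_norm] at h1 h2
      refine E_Jac_eq hp1 hr hm0 hn0 ?_ ?_ hm3 hn3 ((Dvd.intro _ hw.symm).trans hc)
      · intro h
        exact not_dvd_of_isCoprime h1 hp h dvd_rfl
      · intro h
        exact not_dvd_of_isCoprime h2 hp h dvd_rfl

lemma e_rt_zero_left {q : ℕ} {A B : ℤ} (hA : (q : ℤ) ∣ A) (hB : ¬ (q : ℤ) ∣ B) :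
    e q (rt A B) = 0 := by
  rw [e_rt_congr (C := 0) (D := B) (by simpa using hA) (by simp)]
  have : rt 0 B = (B : Eis) * rt 0 1 := by ext <;> simp [rt, mul_comm]
  rw [this, e_int_mul hB, ← mul_one (rt 0 1), e_rt_zero_mul, e_one_right]

lemma e_rt_zero_right {q : ℕ} {A B : ℤ} (hA : ¬ (q : ℤ) ∣ A) (hB : (q : ℤ) ∣ B) :
    e q (rt A B) = 0 := by
  rw [e_rt_congr (C := A) (D := 0) (by simp) (by simpa using hB)]
  have : rt A 0 = (A : Eis) := by ext <;> simp [rt]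
  rw [this, e_int hA]

lemma int_prime_of_nat {q : ℕ} (hq : q.Prime) : Prime (q : ℤ) := Nat.prime_iff_prime_int.1 hq

lemma isCoprime_of_forall {a b : ℤ} (h : ∀ q : ℕ, q.Prime → (q : ℤ) ∣ a → (q : ℤ) ∣ b → False) :
    IsCoprime a b := by
  rw [Int.isCoprime_iff_gcd_eq_one]
  by_contra hne
  obtain ⟨q, hq, hqd⟩ := Nat.exists_prime_and_dvd hne
  have := Int.natCast_dvd_natCast.2 hqd
  exact h q hq (this.trans (Int.gcd_dvd_left ..)) (this.trans (Int.gcd_dvd_right ..))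

lemma coprime_false {a b : ℤ} (h : IsCoprime a b) {q : ℕ} (hq : q.Prime)
    (h1 : (q : ℤ) ∣ a) (h2 : (q : ℤ) ∣ b) : False :=
  (int_prime_of_nat hq).not_isUnit (h.isUnit_of_dvd' h1 h2)

theorem recip {D u v s t v' t' : ℤ} {k : ℕ} (huv : IsCoprime u v) (hst : IsCoprime s t)
    (hn : IsCoprime (u ^ 2 - D * v ^ 2) (s ^ 2 + 3 * D * t ^ 2))
    (hX : ¬ (3 : ℤ) ∣ u ^ 2 - D * v ^ 2) (hY : ¬ (3 : ℤ) ∣ s ^ 2 + 3 * D * t ^ 2)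
    (hv : v = 3 ^ (k + 2) * v') (ht : t = 3 ^ k * t') (hv' : ¬ (3 : ℤ) ∣ v')
    (ht' : ¬ (3 : ℤ) ∣ t') :
    E (rt (v * s) (-(u * t))) (u ^ 2 - D * v ^ 2).natAbs =
      E (rt (v * s) (-(u * t))) (s ^ 2 + 3 * D * t ^ 2).natAbs := by
  obtain ⟨g0, hg0⟩ : ∃ g0 : ℤ, g0 = (Int.gcd v' t' : ℤ) := ⟨_, rfl⟩
  obtain ⟨v1, hv1⟩ : g0 ∣ v' := hg0 ▸ Int.gcd_dvd_left ..
  obtain ⟨t1, ht1⟩ : g0 ∣ t' := hg0 ▸ Int.gcd_dvd_right ..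
  have hv'0 : v' ≠ 0 := by rintro rfl; simp at hv'
  have hg00 : g0 ≠ 0 := by rintro rfl; simp [hv1] at hv'0
  have hcop : IsCoprime v1 t1 := by
    rw [Int.isCoprime_iff_gcd_eq_one]
    have h1 : Int.gcd v' t' = g0.natAbs * Int.gcd v1 t1 := by
      rw [← Int.gcd_mul_left, ← hv1, ← ht1]
    have h2 : g0.natAbs = Int.gcd v' t' := by rw [hg0]; simp
    have h3 : g0.natAbs ≠ 0 := by simpa using hg00
    rw [← h2] at h1
    exact (Nat.eq_of_mul_eq_mul_left (Nat.pos_of_ne_zero h3) (by rw [mul_one]; exact h1)).symm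
  have h3v1 : ¬ (3 : ℤ) ∣ v1 := fun h => hv' (hv1 ▸ h.mul_left _)
  have h3t1 : ¬ (3 : ℤ) ∣ t1 := fun h => ht' (ht1 ▸ h.mul_left _)
  set g : ℤ := 3 ^ k * g0 with hg
  have hvg : v = g * (9 * v1) := by rw [hv, hv1, hg]; ring
  have htg : t = g * t1 := by rw [ht, ht1, hg]; ring
  have h3u : ¬ (3 : ℤ) ∣ u := by
    intro h
    exact hX (dvd_sub (h.pow two_ne_zero) (((Dvd.intro_left (g * 3 * v1)
      (by rw [hvg]; ring) : (3 : ℤ) ∣ v).pow two_ne_zero).mul_left _))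
  set nX := u ^ 2 - D * v ^ 2 with hnX
  set nY := s ^ 2 + 3 * D * t ^ 2 with hnY
  set z2 := rt (-(u * t1)) (-(3 * v1 * s)) with hz2
  have hz : rt (v * s) (-(u * t)) = (g : Eis) * (rt 0 1 * z2) := by
    rw [hz2, rt_mul, hvg, htg]; ext <;> simp [rt] <;> ring
  have hnorm : z2.norm = 27 * v1 ^ 2 * nY + t1 ^ 2 * nX := by
    rw [hz2, rt_norm, hnX, hnY, hvg, htg]; ring
  have hgv : ∀ q : ℕ, (q : ℤ) ∣ g → (q : ℤ) ∣ v := fun q h => hvg ▸ h.mul_right _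
  have hgt : ∀ q : ℕ, (q : ℤ) ∣ g → (q : ℤ) ∣ t := fun q h => htg ▸ h.mul_right _
  have vX : ∀ q : ℕ, q.Prime → (q : ℤ) ∣ v → (q : ℤ) ∣ nX → False := by
    intro q hq h1 h2
    have : (q : ℤ) ∣ u ^ 2 := by
      have := dvd_add h2 ((h1.pow two_ne_zero).mul_left D)
      rwa [hnX, sub_add_cancel] at this
    exact coprime_false huv hq ((int_prime_of_nat hq).dvd_of_dvd_pow this) h1
  have tY : ∀ q : ℕ, q.Prime → (q : ℤ) ∣ t → (q : ℤ) ∣ nY → False := by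
    intro q hq h1 h2
    have : (q : ℤ) ∣ s ^ 2 := by
      have := dvd_sub h2 ((h1.pow two_ne_zero).mul_left (3 * D))
      rwa [hnY, add_sub_cancel_right] at this
    exact coprime_false hst hq ((int_prime_of_nat hq).dvd_of_dvd_pow this) h1
  have v1v : ∀ q : ℕ, (q : ℤ) ∣ v1 → (q : ℤ) ∣ v := fun q h => hvg ▸ (h.mul_left _).mul_left _
  have t1t : ∀ q : ℕ, (q : ℤ) ∣ t1 → (q : ℤ) ∣ t := fun q h => htg ▸ (h.mul_left _)
  -- reduce to `z2`
  have redX : E (rt (v * s) (-(u * t))) nX.natAbs = E z2 nX.natAbs := by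
    refine E_congr_fun fun q hq hqn => ?_
    rw [hz, e_int_mul, e_rt_zero_mul]
    exact fun h => vX q hq (hgv q h) (Int.natCast_dvd.2 hqn)
  have redY : E (rt (v * s) (-(u * t))) nY.natAbs = E z2 nY.natAbs := by
    refine E_congr_fun fun q hq hqn => ?_
    rw [hz, e_int_mul, e_rt_zero_mul]
    exact fun h => tY q hq (hgt q h) (Int.natCast_dvd.2 hqn)
  have nX0 : nX.natAbs ≠ 0 := by rw [Int.natAbs_ne_zero]; intro h; exact hX (h ▸ dvd_zero _)
  have nY0 : nY.natAbs ≠ 0 := by rw [Int.natAbs_ne_zero]; intro h; exact hY (h ▸ dvd_zero _)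
  have t10 : t1.natAbs ^ 2 ≠ 0 := by
    apply pow_ne_zero; rw [Int.natAbs_ne_zero]; intro h; exact h3t1 (h ▸ dvd_zero _)
  have v10 : v1.natAbs ^ 2 ≠ 0 := by
    apply pow_ne_zero; rw [Int.natAbs_ne_zero]; intro h; exact h3v1 (h ▸ dvd_zero _)
  have hp3 : Prime (3 : ℤ) := Int.prime_three
  have E_t1 : E z2 (t1.natAbs ^ 2) = 0 := by
    refine E_eq_zero fun q hq hqn => ?_
    have h1 : (q : ℤ) ∣ t1 := Int.natCast_dvd.2 (hq.dvd_of_dvd_pow hqn)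
    by_cases h3 : q = 3
    · exact e_not (by simp [h3]) _
    refine e_rt_zero_left (by simpa using h1.mul_left u) ?_
    rw [dvd_neg]
    intro h
    rcases (int_prime_of_nat hq).dvd_or_dvd h with h | h
    · rcases (int_prime_of_nat hq).dvd_or_dvd h with h | h
      · exact h3 ((Nat.prime_dvd_prime_iff_eq hq Nat.prime_three).1 (by exact_mod_cast h))
      · exact coprime_false hcop hq h h1
    · exact coprime_false hst hq h (t1t q h1)
  have E_v1 : E z2 (v1.natAbs ^ 2) = 0 := by
    refine E_eq_zero fun q hq hqn => ?_
    have h1 : (q : ℤ) ∣ v1 := Int.natCast_dvd.2 (hq.dvd_of_dvd_pow hqn)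
    refine e_rt_zero_right ?_ (by rw [dvd_neg, mul_assoc]; exact (h1.mul_right _).mul_left _)
    rw [dvd_neg]
    intro h
    rcases (int_prime_of_nat hq).dvd_or_dvd h with h | h
    · exact coprime_false huv hq h (v1v q h1)
    · exact coprime_false hcop hq h1 h
  have copm : IsCoprime (t1 ^ 2 * nX) (27 * v1 ^ 2 * nY) := by
    refine isCoprime_of_forall fun q hq h1 h2 => ?_
    have hqp := int_prime_of_nat hq
    have h2' : q = 3 ∨ (q : ℤ) ∣ v1 ∨ (q : ℤ) ∣ nY := by
      rcases hqp.dvd_or_dvd h2 with h | h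
      · rcases hqp.dvd_or_dvd h with h | h
        · left
          have : q ∣ 3 ^ 3 := by exact_mod_cast h
          exact (Nat.prime_dvd_prime_iff_eq hq Nat.prime_three).1 (hq.dvd_of_dvd_pow this)
        · exact Or.inr (Or.inl (hqp.dvd_of_dvd_pow h))
      · exact Or.inr (Or.inr h)
    rcases hqp.dvd_or_dvd h1 with h | h
    · have h := hqp.dvd_of_dvd_pow h
      rcases h2' with rfl | h' | h'
      · exact h3t1 (by exact_mod_cast h)
      · exact coprime_false hcop hq h' h
      · exact tY q hq (t1t q h) h'
    · rcases h2' with rfl | h' | h'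
      · exact hX (by exact_mod_cast h)
      · exact vX q hq (v1v q h') h
      · exact coprime_false hn hq h h'
  have cop1 : IsCoprime (t1 ^ 2 * nX) z2.norm := by
    rw [hnorm]
    simpa using copm.add_mul_left_right 1
  have cop2 : IsCoprime (v1 ^ 2 * nY) z2.norm := by
    rw [hnorm]
    have : IsCoprime (v1 ^ 2 * nY) (t1 ^ 2 * nX) :=
      (IsCoprime.of_isCoprime_of_dvd_right copm (Dvd.intro_left 27 (by ring))).symm
    have := this.add_mul_left_right 27
    rwa [show t1 ^ 2 * nX + v1 ^ 2 * nY * 27 = 27 * v1 ^ 2 * nY + t1 ^ 2 * nX by ring] at this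
  have abs1 : ((t1.natAbs ^ 2 * nX.natAbs : ℕ) : ℤ) = |t1 ^ 2 * nX| := by
    push_cast; rw [abs_mul, abs_pow]
  have abs2 : ((v1.natAbs ^ 2 * nY.natAbs : ℕ) : ℤ) = |v1 ^ 2 * nY| := by
    push_cast; rw [abs_mul, abs_pow]
  have n31 : ¬ 3 ∣ t1.natAbs ^ 2 * nX.natAbs := by
    intro h
    rcases Nat.prime_three.dvd_mul.1 h with h | h
    · exact h3t1 (Int.natCast_dvd.2 (Nat.prime_three.dvd_of_dvd_pow h))
    · exact hX (Int.natCast_dvd.2 h)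
  have n32 : ¬ 3 ∣ v1.natAbs ^ 2 * nY.natAbs := by
    intro h
    rcases Nat.prime_three.dvd_mul.1 h with h | h
    · exact h3v1 (Int.natCast_dvd.2 (Nat.prime_three.dvd_of_dvd_pow h))
    · exact hY (Int.natCast_dvd.2 h)
  have hdvd : ∃ c : Eis, z2 ∣ ((t1.natAbs ^ 2 * nX.natAbs : ℕ) : Eis) -
      c ^ 3 * ((v1.natAbs ^ 2 * nY.natAbs : ℕ) : Eis) := by
    have hz2d : z2 ∣ ((27 * (v1 ^ 2 * nY) + t1 ^ 2 * nX : ℤ) : Eis) := by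
      rw [← mul_assoc, ← hnorm, ← Eis.mul_star_eq]; exact dvd_mul_right _ _
    rw [← Int.cast_natCast, ← Int.cast_natCast (v1.natAbs ^ 2 * nY.natAbs), abs1, abs2]
    rcases abs_choice (t1 ^ 2 * nX) with h1 | h1 <;> rcases abs_choice (v1 ^ 2 * nY) with h2 | h2 <;>
      rw [h1, h2]
    · exact ⟨-3, by convert hz2d using 1; push_cast; ring⟩
    · exact ⟨3, by convert hz2d using 1; push_cast; ring⟩
    · exact ⟨3, by rw [← dvd_neg]; convert hz2d using 1; push_cast; ring⟩
    · exact ⟨-3, by rw [← dvd_neg]; convert hz2d using 1; push_cast; ring⟩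
  obtain ⟨c, hc⟩ := hdvd
  have key := cubic_recip z2.norm.natAbs z2 (Int.natAbs_of_nonneg (Eis.norm_nonneg _)).symm
    ⟨-(2 * (v1 * s)), by simp [hz2, rt]; ring⟩ (by
      simp only [hz2, rt]
      intro h
      have : (3 : ℤ) ∣ u * t1 := by
        have := dvd_add h (Dvd.intro (v1 * s) rfl : (3 : ℤ) ∣ 3 * (v1 * s))
        rw [show -(u * t1) + -(3 * v1 * s) + 3 * (v1 * s) = -(u * t1) by ring, dvd_neg] at this
        exact this
      rcases hp3.dvd_or_dvd this with h | h
      exacts [h3u h, h3t1 h])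
    (t1.natAbs ^ 2 * nX.natAbs) (v1.natAbs ^ 2 * nY.natAbs) (mul_ne_zero t10 nX0)
    (mul_ne_zero v10 nY0) n31 n32 (by rw [abs1]; exact (IsCoprime.abs_left_iff _ _).2 cop1)
    (by rw [abs2]; exact (IsCoprime.abs_left_iff _ _).2 cop2) c hc
  rw [E_mul _ t10 nX0, E_mul _ v10 nY0, E_t1, E_v1, zero_add, zero_add] at key
  rw [redX, redY, key]

section

open UniqueFactorizationMonoid

/-- The data of a quadratic number field generated by a square root of `D`, in the form
needed for explicit computations with its integers. -/
structure QF (K : Type*) [Field K] [NumberField K] (D : ℤ) where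
  δ : 𝓞 K
  sq : δ ^ 2 = (D : 𝓞 K)
  conj : 𝓞 K ≃+* 𝓞 K
  conj_δ : conj δ = -δ
  half : ∀ x : 𝓞 K, ∃ u v : ℤ, 2 * x = u + v * δ
  rank : finrank ℤ (𝓞 K) = 2
  D_ne : D ≠ 0

namespace QF

variable {K : Type*} [Field K] [NumberField K] {D : ℤ} (S : QF K D)

include S in
lemma δ_ne : S.δ ≠ 0 := by
  intro h
  have := S.sq
  rw [h, zero_pow two_ne_zero] at this
  exact S.D_ne (by exact_mod_cast this.symm)

lemma indep {u v : ℤ} (h : (u : 𝓞 K) + v * S.δ = 0) : u = 0 ∧ v = 0 := by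
  have h2 := congrArg S.conj h
  simp only [map_add, map_mul, map_intCast, S.conj_δ, map_zero] at h2
  have hu : (2 * u : 𝓞 K) = 0 := by linear_combination h + h2
  have hu0 : (u : 𝓞 K) = 0 := by simpa using hu
  have hv : (v : 𝓞 K) * S.δ = 0 := by rw [hu0, zero_add] at h; exact h
  refine ⟨by exact_mod_cast hu0, ?_⟩
  have := (mul_eq_zero.1 hv).resolve_right S.δ_ne
  exact_mod_cast this

/-- Twice the rational part. -/
def U (x : 𝓞 K) : ℤ := (S.half x).choose

/-- Twice the irrational part. -/
def V (x : 𝓞 K) : ℤ := (S.half x).choose_spec.choose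

lemma two_mul_eq (x : 𝓞 K) : 2 * x = (S.U x : 𝓞 K) + S.V x * S.δ :=
  (S.half x).choose_spec.choose_spec

lemma UV_unique {x : 𝓞 K} {u v : ℤ} (h : 2 * x = (u : 𝓞 K) + v * S.δ) :
    S.U x = u ∧ S.V x = v := by
  have h1 := S.two_mul_eq x
  have h2 : ((S.U x - u : ℤ) : 𝓞 K) + ((S.V x - v : ℤ) : 𝓞 K) * S.δ = 0 := by
    push_cast; linear_combination h - h1
  have := S.indep h2
  omega

lemma coords_unique {u v u' v' : ℤ} (h : (u : 𝓞 K) + v * S.δ = u' + v' * S.δ) :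
    u = u' ∧ v = v' := by
  have h2 : ((u - u' : ℤ) : 𝓞 K) + ((v - v' : ℤ) : 𝓞 K) * S.δ = 0 := by
    push_cast; linear_combination h
  have := S.indep h2
  omega

lemma absNorm_conj_span (x : 𝓞 K) :
    Ideal.absNorm (Ideal.span {S.conj x}) = Ideal.absNorm (Ideal.span {x}) := by
  rw [Ideal.absNorm_span_singleton, Ideal.absNorm_span_singleton]
  congr 1
  let f : 𝓞 K ≃ₐ[ℤ] 𝓞 K := AlgEquiv.ofRingEquiv (f := S.conj) (fun r => by simp)
  exact Algebra.norm_eq_of_algEquiv f x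

include S in
lemma absNorm_int (n : ℤ) : Ideal.absNorm (Ideal.span {(n : 𝓞 K)}) = n.natAbs ^ 2 := by
  rw [← S.rank, ← Ideal.absNorm_span_natCast]
  congr 1
  rw [Ideal.span_singleton_eq_span_singleton]
  rcases Int.natAbs_eq n with h | h
  · conv_lhs => rw [h]
    simp
  · conv_lhs => rw [h]
    simp

lemma absNorm_prim (s t : ℤ) :
    Ideal.absNorm (Ideal.span {(s : 𝓞 K) + t * S.δ}) = (s ^ 2 - D * t ^ 2).natAbs := by
  have h1 : ((s : 𝓞 K) + t * S.δ) * S.conj (s + t * S.δ) = ((s ^ 2 - D * t ^ 2 : ℤ) : 𝓞 K) := by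
    simp only [map_add, map_mul, map_intCast, S.conj_δ]
    push_cast
    linear_combination (-(t : 𝓞 K) ^ 2) * S.sq
  have h2 := congrArg (fun y => Ideal.absNorm (Ideal.span {y})) h1
  simp only [← Ideal.span_singleton_mul_span_singleton, map_mul, S.absNorm_conj_span,
    S.absNorm_int] at h2
  refine Nat.pow_left_injective two_ne_zero ?_
  simp only [pow_two] at h2 ⊢
  exact h2

lemma absNorm_eq (x : 𝓞 K) :
    4 * Ideal.absNorm (Ideal.span {x}) = (S.U x ^ 2 - D * S.V x ^ 2).natAbs := by
  rw [← S.absNorm_prim, ← S.two_mul_eq, ← Ideal.span_singleton_mul_span_singleton, map_mul,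
    show (2 : 𝓞 K) = ((2 : ℤ) : 𝓞 K) by norm_num, S.absNorm_int]
  norm_num

lemma absNorm_map_conj (I : Ideal (𝓞 K)) :
    Ideal.absNorm (I.map (S.conj : 𝓞 K →+* 𝓞 K)) = Ideal.absNorm I := by
  rw [Ideal.absNorm_apply, Ideal.absNorm_apply, Submodule.cardQuot_apply, Submodule.cardQuot_apply]
  exact (Nat.card_congr (Ideal.quotientEquiv I _ S.conj rfl).toEquiv).symm

lemma mem_of_dvd {I : Ideal (𝓞 K)} {q : ℕ} (hq : (Ideal.absNorm I) = q) {n : ℤ}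
    (h : (q : ℤ) ∣ n) : (n : 𝓞 K) ∈ I := by
  obtain ⟨k, rfl⟩ := h
  have := Ideal.absNorm_mem I
  rw [hq] at this
  push_cast
  exact I.mul_mem_right _ this

lemma dvd_of_mem {I : Ideal (𝓞 K)} {q : ℕ} (hq : (Ideal.absNorm I) = q) (hp : q.Prime) {n : ℤ}
    (h : (n : 𝓞 K) ∈ I) : (q : ℤ) ∣ n := by
  by_contra hn
  have hc : IsCoprime (q : ℤ) n := (Nat.prime_iff_prime_int.1 hp).coprime_iff_not_dvd.2 hn
  obtain ⟨a, b, hab⟩ := hc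
  have h1 : (1 : 𝓞 K) ∈ I := by
    have h2 := congrArg (Int.cast : ℤ → 𝓞 K) hab
    push_cast at h2
    rw [← h2]
    have := Ideal.absNorm_mem I
    rw [hq] at this
    exact I.add_mem (I.mul_mem_left _ this) (I.mul_mem_left _ h)
  rw [(Ideal.eq_top_iff_one I).2 h1, Ideal.absNorm_top] at hq
  exact hp.one_lt.ne hq

open Classical in
/-- The local cubic symbol attached to the pair `(A, B)` at a degree one prime. -/
def le (A B : ℤ) (p : Ideal (𝓞 K)) : ZMod 3 :=
  if h : (Ideal.absNorm p).Prime ∧ ∃ h : ℤ, S.δ - h ∈ p then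
    e (Ideal.absNorm p) (rt A (B * h.2.choose)) else 0

lemma le_eq (A B : ℤ) {p : Ideal (𝓞 K)} {q : ℕ} (hq : Ideal.absNorm p = q) (hp : q.Prime) {h : ℤ}
    (hh : S.δ - h ∈ p) : S.le A B p = e q (rt A (B * h)) := by
  subst hq
  have H : (Ideal.absNorm p).Prime ∧ ∃ h : ℤ, S.δ - h ∈ p := ⟨hp, h, hh⟩
  rw [le, dif_pos H]
  apply e_rt_congr
  · simp
  · rw [← mul_sub]
    apply Dvd.dvd.mul_left
    apply dvd_of_mem rfl hp
    have := p.sub_mem hh H.2.choose_spec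
    push_cast
    convert this using 1; ring

lemma le_two (A B : ℤ) {p : Ideal (𝓞 K)} [p.IsPrime] (h2 : (2 : 𝓞 K) ∈ p) : S.le A B p = 0 := by
  by_cases H : (Ideal.absNorm p).Prime ∧ ∃ h : ℤ, S.δ - h ∈ p
  · obtain ⟨hp, h, hh⟩ := H
    have h1 : Ideal.absNorm p ∣ 2 := by
      have := dvd_of_mem rfl hp (n := 2) (by exact_mod_cast h2)
      exact_mod_cast this
    rw [S.le_eq A B ((Nat.prime_dvd_prime_iff_eq hp Nat.prime_two).1 h1) Nat.prime_two hh, e_two_rt]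
  · exact dif_neg H

/-- The additive cubic character attached to `(A, B)`. -/
def Lam (A B : ℤ) (I : Ideal (𝓞 K)) : ZMod 3 := ((normalizedFactors I).map (S.le A B)).sum

lemma Lam_mul (A B : ℤ) {I J : Ideal (𝓞 K)} (hI : I ≠ 0) (hJ : J ≠ 0) :
    S.Lam A B (I * J) = S.Lam A B I + S.Lam A B J := by
  rw [Lam, Lam, Lam, normalizedFactors_mul hI hJ, Multiset.map_add, Multiset.sum_add]

lemma Lam_one (A B : ℤ) : S.Lam A B 1 = 0 := by
  rw [Lam, normalizedFactors_one, Multiset.map_zero, Multiset.sum_zero]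

lemma Lam_pow (A B : ℤ) {I : Ideal (𝓞 K)} (hI : I ≠ 0) (n : ℕ) :
    S.Lam A B (I ^ n) = n * S.Lam A B I := by
  induction n with
  | zero => rw [pow_zero, Lam_one]; simp
  | succ n ih => rw [pow_succ, Lam_mul _ _ _ (pow_ne_zero _ hI) hI, ih]; push_cast; ring

lemma Lam_cube (A B : ℤ) {I : Ideal (𝓞 K)} (hI : I ≠ 0) : S.Lam A B (I ^ 3) = 0 := by
  rw [Lam_pow _ _ _ hI, show ((3 : ℕ) : ZMod 3) = 0 from rfl, zero_mul]

lemma Lam_prime (A B : ℤ) {p : Ideal (𝓞 K)} [p.IsPrime] (hp : p ≠ 0) :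
    S.Lam A B p = S.le A B p := by
  have : Irreducible p := (Ideal.prime_of_isPrime hp inferInstance).irreducible
  simp [Lam, normalizedFactors_irreducible this]

lemma isPrime_of_mem {I p : Ideal (𝓞 K)} (h : p ∈ normalizedFactors I) : p.IsPrime :=
  Ideal.isPrime_of_prime (prime_of_normalized_factor p h)

lemma le_of_mem {I p : Ideal (𝓞 K)} (h : p ∈ normalizedFactors I) : I ≤ p :=
  Ideal.le_of_dvd (dvd_of_mem_normalizedFactors h)

lemma Lam_congr {A B A' B' : ℤ} {I : Ideal (𝓞 K)}
    (h : ∀ p : Ideal (𝓞 K), p.IsPrime → I ≤ p → S.le A B p = S.le A' B' p) :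
    S.Lam A B I = S.Lam A' B' I := by
  rw [Lam, Lam]
  congr 1
  exact Multiset.map_congr rfl fun p hp => h p (isPrime_of_mem hp) (le_of_mem hp)

lemma Lam_eq_zero {A B : ℤ} {I : Ideal (𝓞 K)}
    (h : ∀ p : Ideal (𝓞 K), p.IsPrime → I ≤ p → S.le A B p = 0) : S.Lam A B I = 0 := by
  rw [Lam]
  apply Multiset.sum_eq_zero
  intro x hx
  obtain ⟨p, hp, rfl⟩ := Multiset.mem_map.1 hx
  exact h p (isPrime_of_mem hp) (le_of_mem hp)

lemma Lam_two (A B : ℤ) : S.Lam A B (Ideal.span {2}) = 0 :=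
  S.Lam_eq_zero fun _ _ h => S.le_two A B (h (Ideal.mem_span_singleton_self 2))

lemma absNorm_eq_prod {I : Ideal (𝓞 K)} (hI : I ≠ 0) :
    Ideal.absNorm I = ((normalizedFactors I).map Ideal.absNorm).prod := by
  conv_lhs => rw [← Ideal.prod_normalizedFactors_eq_self hI]
  rw [map_multiset_prod]

lemma E_multiset (z : Eis) (m : Multiset ℕ) (h : ∀ n ∈ m, n ≠ 0) :
    E z m.prod = (m.map (E z)).sum := by
  induction m using Multiset.induction_on with
  | empty => simp [E_one]
  | cons a s ih =>
    rw [Multiset.prod_cons, E_mul _ (h a (by simp)) (Multiset.prod_ne_zero fun h0 =>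
      h 0 (by simp [h0]) rfl), ih fun n hn => h n (by simp [hn])]
    simp

/-- A prime not containing `2` and containing an odd prime number has an integral residue for
every element, once `δ` has one. -/
lemma exists_int_sub_mem {p : Ideal (𝓞 K)} [p.IsPrime] (h2 : (2 : 𝓞 K) ∉ p) {h : ℤ}
    (hp : p ≠ ⊥) (hh : S.δ - h ∈ p) (x : 𝓞 K) : ∃ n : ℤ, x - n ∈ p := by
  have : ∃ m : ℤ, (2 * m - 1 : 𝓞 K) ∈ p := by
    have hne : Ideal.absNorm p ≠ 0 := by rwa [Ne, Ideal.absNorm_eq_zero_iff]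
    have hodd : ∃ N : ℕ, N % 2 = 1 ∧ (N : 𝓞 K) ∈ p := by
      obtain ⟨k, m, hm, hkm⟩ := Nat.exists_eq_two_pow_mul_odd hne
      refine ⟨m, Nat.odd_iff.1 hm, ?_⟩
      have := Ideal.absNorm_mem p
      rw [hkm] at this
      push_cast at this
      exact (Ideal.IsPrime.mem_or_mem ‹_› this).resolve_left fun h =>
        h2 (Ideal.IsPrime.mem_of_pow_mem ‹_› _ h)
    obtain ⟨N, hN, hm⟩ := hodd
    refine ⟨(N + 1) / 2, ?_⟩
    have h3 : (2 * (((N + 1) / 2 : ℤ)) - 1 : ℤ) = N := by omega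
    have := congrArg (Int.cast : ℤ → 𝓞 K) h3
    push_cast at this
    rw [this]; exact hm
  obtain ⟨m, hm⟩ := this
  refine ⟨m * (S.U x + S.V x * h), ?_⟩
  have h1 := S.two_mul_eq x
  push_cast
  have : x - m * (S.U x + S.V x * h) = -(2 * m - 1) * x + m * S.V x * (S.δ - h) := by
    linear_combination (m : 𝓞 K) * h1
  rw [this]
  exact p.add_mem (p.mul_mem_right _ (p.neg_mem hm)) (p.mul_mem_left _ hh)

lemma absNorm_prime_of_int {p : Ideal (𝓞 K)} [p.IsPrime] (hp : p ≠ ⊥)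
    (h : ∀ x : 𝓞 K, ∃ n : ℤ, x - n ∈ p) : (Ideal.absNorm p).Prime := by
  have hmax : p.IsMaximal := Ideal.IsPrime.isMaximal ‹_› hp
  obtain ⟨q, hq, hqp⟩ : ∃ q : ℕ, q.Prime ∧ (q : 𝓞 K) ∈ p := by
    obtain ⟨q, k, hk, -, hq, h1⟩ := Ideal.exists_prime_and_absNorm_eq_pow p
    have := Ideal.absNorm_mem p
    rw [h1] at this
    push_cast at this
    exact ⟨q, hq, Ideal.IsPrime.mem_of_pow_mem ‹_› _ this⟩
  have hcard : Nat.card (𝓞 K ⧸ p) ≤ q := by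
    have : NeZero q := ⟨hq.ne_zero⟩
    have hsurj : Function.Surjective fun i : Fin q => (Ideal.Quotient.mk p (i : ℕ)) := by
      intro y
      obtain ⟨x, rfl⟩ := Ideal.Quotient.mk_surjective y
      obtain ⟨n, hn⟩ := h x
      have hq0 : (0 : ℤ) < q := by exact_mod_cast hq.pos
      have h1 := Int.emod_lt_of_pos n hq0
      have h2 := Int.emod_nonneg n hq0.ne'
      refine ⟨⟨(n % q).toNat, by omega⟩, ?_⟩
      rw [eq_comm, Ideal.Quotient.eq]
      have e1 : (((n % q).toNat : ℕ) : 𝓞 K) = ((n % q : ℤ) : 𝓞 K) := by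
        rw [← Int.cast_natCast, Int.toNat_of_nonneg (Int.emod_nonneg n hq0.ne')]
      simp only []
      rw [e1, Int.emod_def]
      push_cast
      rw [sub_sub_eq_add_sub, add_sub_right_comm]
      exact p.add_mem hn (p.mul_mem_right _ hqp)
    have := Nat.card_le_card_of_surjective _ hsurj
    simpa using this
  rw [← Submodule.cardQuot_apply, ← Ideal.absNorm_apply] at hcard
  obtain ⟨q', k, hk, -, hq', h1⟩ := Ideal.exists_prime_and_absNorm_eq_pow p
  have hd : q' = q := by
    by_contra hne
    have hc : IsCoprime (Ideal.absNorm p : ℤ) q := by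
      rw [h1, Nat.isCoprime_iff_coprime]
      exact Nat.Coprime.pow_left _ ((Nat.coprime_primes hq' hq).2 hne)
    obtain ⟨a, b, hab⟩ := hc
    have h2 := congrArg (Int.cast : ℤ → 𝓞 K) hab
    push_cast at h2
    apply hmax.ne_top
    rw [Ideal.eq_top_iff_one, ← h2]
    exact p.add_mem (p.mul_mem_left _ (Ideal.absNorm_mem p)) (p.mul_mem_left _ hqp)
  subst hd
  have : k = 1 := by
    have : q' ^ k ≤ q' ^ 1 := by rw [← h1, pow_one]; exact hcard
    have := (Nat.pow_le_pow_iff_right hq'.one_lt).1 this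
    omega
  rw [h1, this, pow_one]; exact hq'

end QF

end

section

open UniqueFactorizationMonoid

lemma exists_prime_ideal_of_dvd_absNorm {K : Type*} [Field K] [NumberField K] {I : Ideal (𝓞 K)}
    {q : ℕ} (hq : q.Prime) (h : q ∣ Ideal.absNorm I) :
    ∃ P : Ideal (𝓞 K), P.IsPrime ∧ I ≤ P ∧ (q : 𝓞 K) ∈ P := by
  obtain ⟨P, hP, h1, h2⟩ := Ideal.exists_isMaximal_dvd_of_dvd_absNorm' hq _ h
  refine ⟨P, hP.isPrime, Ideal.le_of_dvd h2, ?_⟩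
  have : (q : ℤ) ∈ P.under ℤ := by rw [h1]; exact Ideal.mem_span_singleton_self _
  simpa [Ideal.mem_comap] using this

lemma one_mem_of_coprime {R : Type*} [CommRing R] {P : Ideal R} [hP : P.IsPrime] {a b : ℤ}
    (h : IsCoprime a b) (ha : (a : R) ∈ P) (hb : (b : R) ∈ P) : False := by
  obtain ⟨x, y, hxy⟩ := h
  apply hP.ne_top
  rw [Ideal.eq_top_iff_one]
  have := congrArg (Int.cast : ℤ → R) hxy
  push_cast at this
  rw [← this]
  exact P.add_mem (P.mul_mem_left _ ha) (P.mul_mem_left _ hb)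

namespace QF

variable {K : Type*} [Field K] [NumberField K] {D : ℤ} (S : QF K D)

lemma le_conj {A B : ℤ} {p : Ideal (𝓞 K)}
    (h : ∀ q : ℕ, q.Prime → q ≠ 2 → (q : 𝓞 K) ∈ p → ¬ (q : ℤ) ∣ A ^ 2 + 3 * B ^ 2 * D) :
    S.le A B (p.map (S.conj : 𝓞 K →+* 𝓞 K)) = - S.le A B p := by
  have key : ∀ h : ℤ, S.δ - h ∈ p.map (S.conj : 𝓞 K →+* 𝓞 K) → S.δ - (-h : ℤ) ∈ p := by
    intro h hh
    obtain ⟨x, hx, hxe⟩ := (Ideal.mem_map_of_equiv S.conj _).1 hh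
    have : x = -(S.δ - (-h : ℤ)) := by
      apply S.conj.injective
      rw [hxe]; simp [S.conj_δ]; ring
    rw [this] at hx
    simpa using p.neg_mem hx
  by_cases H : (Ideal.absNorm p).Prime ∧ ∃ h : ℤ, S.δ - h ∈ p
  · obtain ⟨hp, h0, hh⟩ := H
    have hh' : S.δ - (-h0 : ℤ) ∈ p.map (S.conj : 𝓞 K →+* 𝓞 K) := by
      have h1 := Ideal.mem_map_of_mem (S.conj : 𝓞 K →+* 𝓞 K) (p.neg_mem hh)
      convert h1 using 1
      simp [S.conj_δ, add_comm]
    rw [S.le_eq A B rfl hp hh, S.le_eq A B (S.absNorm_map_conj p) hp hh']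
    by_cases h2 : Ideal.absNorm p = 2
    · rw [h2, e_two_rt, e_two_rt, neg_zero]
    have h3 := h _ hp h2 (Ideal.absNorm_mem p)
    rw [← e_star, star_rt]
    · congr 2; ring
    · rw [rt_norm]
      intro h4
      apply h3
      have h5 : ((Ideal.absNorm p : ℕ) : ℤ) ∣ h0 ^ 2 - D := by
        apply dvd_of_mem rfl hp
        have : (((h0 ^ 2 - D : ℤ)) : 𝓞 K) = -(S.δ + h0) * (S.δ - h0) := by
          push_cast; linear_combination S.sq
        rw [this]; exact p.mul_mem_left _ hh
      have := dvd_sub h4 (h5.mul_left (3 * B ^ 2))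
      rwa [show A ^ 2 + 3 * (B * h0) ^ 2 - 3 * B ^ 2 * (h0 ^ 2 - D) = A ^ 2 + 3 * B ^ 2 * D by ring]
        at this
  · have H' : ¬ ((Ideal.absNorm (p.map (S.conj : 𝓞 K →+* 𝓞 K))).Prime ∧
        ∃ h : ℤ, S.δ - h ∈ p.map (S.conj : 𝓞 K →+* 𝓞 K)) := by
      rintro ⟨h1, h0, h2⟩
      exact H ⟨by rwa [S.absNorm_map_conj] at h1, -h0, key h0 h2⟩
    rw [le, dif_neg H', le, dif_neg H, neg_zero]

lemma normalizedFactors_map_conj {I : Ideal (𝓞 K)} (hI : I ≠ 0) :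
    normalizedFactors (I.map (S.conj : 𝓞 K →+* 𝓞 K)) =
      (normalizedFactors I).map (Ideal.map (S.conj : 𝓞 K →+* 𝓞 K)) := by
  have h1 : I.map (S.conj : 𝓞 K →+* 𝓞 K) =
      ((normalizedFactors I).map (Ideal.map (S.conj : 𝓞 K →+* 𝓞 K))).prod := by
    conv_lhs => rw [← Ideal.prod_normalizedFactors_eq_self hI]
    exact map_multiset_prod (Ideal.mapHom (S.conj : 𝓞 K →+* 𝓞 K)) _
  rw [h1]
  apply normalizedFactors_prod_of_prime
  intro p hp
  obtain ⟨p', hp', rfl⟩ := Multiset.mem_map.1 hp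
  have := isPrime_of_mem hp'
  have h0 : p' ≠ ⊥ := (prime_of_normalized_factor _ hp').ne_zero
  refine Ideal.prime_of_isPrime ?_ (Ideal.map_isPrime_of_equiv S.conj)
  intro h
  exact h0 ((Ideal.map_eq_bot_iff_of_injective
    (f := (S.conj : 𝓞 K →+* 𝓞 K)) S.conj.injective).1 h)

lemma Lam_conj {A B : ℤ} {I : Ideal (𝓞 K)} (hI : I ≠ 0)
    (h : ∀ q : ℕ, q.Prime → q ≠ 2 → q ∣ Ideal.absNorm I → ¬ (q : ℤ) ∣ A ^ 2 + 3 * B ^ 2 * D) :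
    S.Lam A B (I.map (S.conj : 𝓞 K →+* 𝓞 K)) = - S.Lam A B I := by
  rw [Lam, Lam, S.normalizedFactors_map_conj hI, Multiset.map_map, ← Multiset.sum_map_neg']
  congr 1
  rw [Multiset.map_map]
  refine Multiset.map_congr rfl fun p hp => ?_
  have hpp := isPrime_of_mem hp
  refine S.le_conj fun q hq h2 hqp => h q hq h2 ?_
  have h1 : Ideal.absNorm p ∣ Ideal.absNorm I := Ideal.absNorm_dvd_absNorm_of_le (le_of_mem hp)
  refine dvd_trans ?_ h1
  by_contra hn
  have hc : IsCoprime (q : ℤ) (Ideal.absNorm p : ℤ) :=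
    Nat.isCoprime_iff_coprime.2 ((Nat.Prime.coprime_iff_not_dvd hq).2 hn)
  exact one_mem_of_coprime (P := p) hc (by exact_mod_cast hqp)
    (by exact_mod_cast Ideal.absNorm_mem p)

lemma Lam_int {A B n : ℤ} (hn : n ≠ 0)
    (h : ∀ q : ℕ, q.Prime → q ≠ 2 → (q : ℤ) ∣ n → ¬ (q : ℤ) ∣ A ^ 2 + 3 * B ^ 2 * D) :
    S.Lam A B (Ideal.span {(n : 𝓞 K)}) = 0 := by
  have h1 := S.Lam_conj (A := A) (B := B) (I := Ideal.span {(n : 𝓞 K)})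
    (by simpa using hn) (fun q hq h2 hqn => h q hq h2 (by
      rw [S.absNorm_int] at hqn
      exact Int.natCast_dvd.2 (hq.dvd_of_dvd_pow hqn)))
  rw [Ideal.map_span, Set.image_singleton] at h1
  simp only [map_intCast] at h1
  generalize S.Lam A B (Ideal.span {(n : 𝓞 K)}) = y at h1
  revert h1; revert y; decide

lemma E_absNorm (z : Eis) {I : Ideal (𝓞 K)} (hI : I ≠ 0) :
    E z (Ideal.absNorm I) = ((normalizedFactors I).map fun p => E z (Ideal.absNorm p)).sum := by
  rw [absNorm_eq_prod hI, E_multiset, Multiset.map_map]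
  · rfl
  · intro n hn
    obtain ⟨p, hp, rfl⟩ := Multiset.mem_map.1 hn
    rw [Ne, Ideal.absNorm_eq_zero_iff]
    exact (prime_of_normalized_factor p hp).ne_zero

lemma E_two_pow (A B : ℤ) {n : ℕ} (h : n ∣ 4) : E (rt A B) n = 0 := by
  refine E_eq_zero fun q hq hqn => ?_
  have : q ∣ 2 ^ 2 := hqn.trans h
  rw [(Nat.prime_dvd_prime_iff_eq hq Nat.prime_two).1 (hq.dvd_of_dvd_pow this), e_two_rt]

lemma prim_ne_zero {s t : ℤ} (hst : IsCoprime s t) : (s : 𝓞 K) + t * S.δ ≠ 0 := by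
  intro h
  have := S.indep h
  rw [this.1, this.2] at hst
  exact not_isUnit_zero (isCoprime_zero_left.1 hst)

/-- The value of the character at a primitive element is a rational cubic symbol. -/
lemma Lam_prim {s t : ℤ} (hst : IsCoprime s t) (A B : ℤ) :
    S.Lam A B (Ideal.span {(s : 𝓞 K) + t * S.δ}) =
      E (rt (A * t) (-(B * s))) (Ideal.absNorm (Ideal.span {(s : 𝓞 K) + t * S.δ})) := by
  have hI : Ideal.span {(s : 𝓞 K) + t * S.δ} ≠ 0 := by
    simpa using S.prim_ne_zero hst
  rw [E_absNorm _ hI, Lam]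
  congr 1
  refine Multiset.map_congr rfl fun p hp => ?_
  have hpp := isPrime_of_mem hp
  have hp0 : p ≠ ⊥ := (prime_of_normalized_factor p hp).ne_zero
  have hmem : (s : 𝓞 K) + t * S.δ ∈ p := le_of_mem hp (Ideal.mem_span_singleton_self _)
  by_cases h2 : (2 : 𝓞 K) ∈ p
  · rw [S.le_two A B h2, E_two_pow]
    have h4 := Ideal.absNorm_dvd_absNorm_of_le ((Ideal.span_singleton_le_iff_mem p).2 h2)
    have h5 := S.absNorm_int 2
    rw [Int.cast_ofNat] at h5
    rwa [h5] at h4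
  have ht : (t : 𝓞 K) ∉ p := by
    intro ht
    have hs : (s : 𝓞 K) ∈ p := by
      have := p.sub_mem hmem (p.mul_mem_right S.δ ht)
      rwa [add_sub_cancel_right] at this
    exact one_mem_of_coprime (P := p) hst hs ht
  obtain ⟨h, hh⟩ : ∃ h : ℤ, S.δ - h ∈ p := by
    have hmax : p.IsMaximal := hpp.isMaximal hp0
    obtain ⟨q, k, -, hqp, hq, -⟩ := Ideal.exists_prime_and_absNorm_eq_pow p
    have hqt : ¬ (q : ℤ) ∣ t := by
      rintro ⟨l, rfl⟩
      apply ht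
      push_cast
      exact p.mul_mem_right _ hqp
    obtain ⟨x, y, hxy⟩ := (int_prime_of_nat hq).coprime_iff_not_dvd.2 hqt
    refine ⟨-(y * s), ?_⟩
    have h1 := congrArg (Int.cast : ℤ → 𝓞 K) hxy
    push_cast at h1 ⊢
    have : S.δ - -(y * s) = x * S.δ * q + y * (s + t * S.δ) := by
      linear_combination (-S.δ) * h1
    rw [this]
    exact p.add_mem (p.mul_mem_left _ hqp) (p.mul_mem_left _ hmem)
  have hprime : (Ideal.absNorm p).Prime :=
    absNorm_prime_of_int hp0 (S.exists_int_sub_mem h2 hp0 hh)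
  rw [S.le_eq A B rfl hprime hh, E_prime _ hprime]
  have hqt : ¬ ((Ideal.absNorm p : ℕ) : ℤ) ∣ t := fun h => ht (mem_of_dvd rfl h)
  have hsh : ((Ideal.absNorm p : ℕ) : ℤ) ∣ s + t * h := by
    apply dvd_of_mem rfl hprime
    push_cast
    have : (s : 𝓞 K) + t * h = (s + t * S.δ) - t * (S.δ - h) := by ring
    rw [this]
    exact p.sub_mem hmem (p.mul_mem_left _ hh)
  rw [← e_int_mul hqt]
  have : (t : Eis) * rt A (B * h) = rt (A * t) (B * (t * h)) := by ext <;> simp [rt] <;> ring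
  rw [this]
  apply e_rt_congr
  · simp
  · rw [sub_neg_eq_add, ← mul_add, add_comm]
    exact hsh.mul_left _

end QF

end

section

open UniqueFactorizationMonoid

/-- The absolute norm of the principal ideal generated by `x`. -/
def nm {K : Type*} [Field K] [NumberField K] (x : 𝓞 K) : ℕ := Ideal.absNorm (Ideal.span {x})

lemma nm_mul {K : Type*} [Field K] [NumberField K] (x y : 𝓞 K) : nm (x * y) = nm x * nm y := by
  rw [nm, ← Ideal.span_singleton_mul_span_singleton, map_mul]; rfl

lemma nm_one {K : Type*} [Field K] [NumberField K] : nm (1 : 𝓞 K) = 1 := by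
  rw [nm, Ideal.span_singleton_one, Ideal.absNorm_top]

lemma nm_pow {K : Type*} [Field K] [NumberField K] (x : 𝓞 K) (n : ℕ) : nm (x ^ n) = nm x ^ n := by
  induction n with
  | zero => rw [pow_zero, pow_zero, nm_one]
  | succ n ih => rw [pow_succ, nm_mul, ih, pow_succ]

lemma nm_eq_zero {K : Type*} [Field K] [NumberField K] {x : 𝓞 K} : nm x = 0 ↔ x = 0 := by
  rw [nm, Ideal.absNorm_eq_zero_iff, Ideal.span_singleton_eq_bot]

lemma span_ne {K : Type*} [Field K] [NumberField K] {x : 𝓞 K} (h : x ≠ 0) :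
    Ideal.span {x} ≠ 0 := by simpa using h

namespace QF

variable {K : Type*} [Field K] [NumberField K] {D : ℤ} (S : QF K D)

lemma four_nm (x : 𝓞 K) : (4 * nm x : ℤ) = |S.U x ^ 2 - D * S.V x ^ 2| := by
  rw [Int.abs_eq_natAbs, ← S.absNorm_eq]
  push_cast; rfl

lemma exists_primitive {x : 𝓞 K} (hx : x ≠ 0) :
    ∃ g u v : ℤ, S.U x = g * u ∧ S.V x = g * v ∧ IsCoprime u v ∧ g ≠ 0 ∧
      g ^ 2 * (u ^ 2 - D * v ^ 2).natAbs = 4 * nm x := by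
  have h0 : 0 < Int.gcd (S.U x) (S.V x) := by
    rw [Int.gcd_pos_iff]
    by_contra! h
    have := S.two_mul_eq x
    rw [h.1, h.2] at this
    apply hx
    simpa using this
  obtain ⟨u, v, hc, hu, hv⟩ := Int.exists_gcd_one h0
  refine ⟨Int.gcd (S.U x) (S.V x), u, v, by rw [mul_comm]; exact hu, by rw [mul_comm]; exact hv,
    Int.isCoprime_iff_gcd_eq_one.2 hc, by exact_mod_cast h0.ne', ?_⟩
  rw [S.four_nm, ← Int.abs_eq_natAbs]
  generalize (Int.gcd (S.U x) (S.V x) : ℤ) = g at hu hv ⊢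
  rw [hu, hv]
  rw [show (u * g) ^ 2 - D * (v * g) ^ 2 = g ^ 2 * (u ^ 2 - D * v ^ 2) by ring, abs_mul,
    abs_of_nonneg (sq_nonneg g)]

lemma Lam_eval {x : 𝓞 K} (hx : x ≠ 0) {A B g u v : ℤ} (hU : S.U x = g * u) (hV : S.V x = g * v)
    (hc : IsCoprime u v) (hg : g ≠ 0)
    (h : ∀ q : ℕ, q.Prime → q ≠ 2 → (q : ℤ) ∣ g → ¬ (q : ℤ) ∣ A ^ 2 + 3 * B ^ 2 * D) :
    S.Lam A B (Ideal.span {x}) = E (rt (A * v) (-(B * u))) (u ^ 2 - D * v ^ 2).natAbs := by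
  have h1 : (2 : 𝓞 K) * x = (g : 𝓞 K) * ((u : 𝓞 K) + v * S.δ) := by
    rw [S.two_mul_eq, hU, hV]; push_cast; ring
  have h2 := congrArg (fun y => S.Lam A B (Ideal.span {y})) h1
  simp only [← Ideal.span_singleton_mul_span_singleton] at h2
  rw [Lam_mul _ _ _ (span_ne two_ne_zero) (span_ne hx), Lam_mul _ _ _ (by simpa using hg)
    (span_ne (S.prim_ne_zero hc)), S.Lam_two, S.Lam_int hg h, zero_add, zero_add, S.Lam_prim hc,
    S.absNorm_prim] at h2
  exact h2

end QF

lemma dvd_of_dvd_four_mul {q : ℕ} (hq : q.Prime) (hq2 : q ≠ 2) {n : ℤ} (h : (q : ℤ) ∣ 4 * n) :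
    (q : ℤ) ∣ n := by
  refine ((int_prime_of_nat hq).dvd_or_dvd h).resolve_left fun h => hq2 ?_
  have : q ∣ 2 ^ 2 := by exact_mod_cast h
  exact (Nat.prime_dvd_prime_iff_eq hq Nat.prime_two).1 (hq.dvd_of_dvd_pow this)

lemma mod_eight {D u v g n : ℤ} (hD : Odd D) (huv : IsCoprime u v) (hn : Odd n)
    (h : g ^ 2 * |u ^ 2 - D * v ^ 2| = 4 * n) (h2 : 2 ∣ u ^ 2 - D * v ^ 2) : D % 8 = 5 := by
  have hpar : ¬ (2 ∣ u ∧ 2 ∣ v) := fun h => by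
    have := huv.isUnit_of_dvd' h.1 h.2
    rw [Int.isUnit_iff] at this
    omega
  have hDo := Int.odd_iff.1 hD
  have hno := Int.odd_iff.1 hn
  have huv' : u % 2 = 1 ∧ v % 2 = 1 := by
    have h3 : (u ^ 2 - D * v ^ 2) % 2 = 0 := by omega
    rcases Int.emod_two_eq_zero_or_one u with hu | hu <;>
    rcases Int.emod_two_eq_zero_or_one v with hv | hv
    · exact absurd ⟨Int.dvd_of_emod_eq_zero hu, Int.dvd_of_emod_eq_zero hv⟩ hpar
    · simp [Int.sub_emod, pow_two, Int.mul_emod, hu, hv, hDo] at h3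
    · simp [Int.sub_emod, pow_two, Int.mul_emod, hu, hv, hDo] at h3
    · exact ⟨hu, hv⟩
  have hu8 : u ^ 2 % 8 = 1 := by
    have : u % 8 = 1 ∨ u % 8 = 3 ∨ u % 8 = 5 ∨ u % 8 = 7 := by omega
    rcases this with h | h | h | h <;> simp [pow_two, Int.mul_emod, h]
  have hv8 : v ^ 2 % 8 = 1 := by
    have : v % 8 = 1 ∨ v % 8 = 3 ∨ v % 8 = 5 ∨ v % 8 = 7 := by omega
    rcases this with h | h | h | h <;> simp [pow_two, Int.mul_emod, h]
  have hDv : (D * v ^ 2) % 8 = D % 8 := by rw [Int.mul_emod, hv8]; omega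
  obtain ⟨m, hm⟩ : ∃ m, u ^ 2 - D * v ^ 2 = 2 * m := h2
  have key : g ^ 2 * |m| = 2 * n := by
    rw [hm, abs_mul, abs_two] at h
    linarith
  have hg : g % 2 = 1 := by
    by_contra hg
    obtain ⟨g', rfl⟩ : ∃ g', g = 2 * g' := ⟨g / 2, by omega⟩
    have : 2 * (g' ^ 2 * |m|) = n := by linarith
    omega
  have hg4 : g ^ 2 % 4 = 1 := by
    have : g % 4 = 1 ∨ g % 4 = 3 := by omega
    rcases this with h | h <;> simp [pow_two, Int.mul_emod, h]
  have hm4 : |m| % 4 = 2 := by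
    have h4 : (g ^ 2 * |m|) % 4 = 2 := by omega
    rw [Int.mul_emod, hg4] at h4
    omega
  have : m % 4 = 2 := by
    rcases abs_choice m with h | h <;> omega
  omega

section Core

variable {K K' : Type*} [Field K] [NumberField K] [Field K'] [NumberField K'] {d : ℤ}
  (S : QF K d) (S' : QF K' (-3 * d))

omit S S' in
lemma coprime_forms (hd : Odd d) {x : 𝓞 K} {y : 𝓞 K'} (hx2 : Odd (nm x)) (hy2 : Odd (nm y))
    (hc : Nat.Coprime (nm x) (nm y)) {g u v g' s t : ℤ} (huv : IsCoprime u v) (hst : IsCoprime s t)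
    (h : g ^ 2 * (u ^ 2 - d * v ^ 2).natAbs = 4 * nm x)
    (h' : g' ^ 2 * (s ^ 2 - -3 * d * t ^ 2).natAbs = 4 * nm y) :
    IsCoprime (u ^ 2 - d * v ^ 2) (s ^ 2 - -3 * d * t ^ 2) := by
  refine isCoprime_of_forall fun q hq h1 h2 => ?_
  by_cases hq2 : q = 2
  · subst hq2
    rw [← Int.abs_eq_natAbs] at h h'
    have e1 := mod_eight hd huv (by exact_mod_cast hx2) h h1
    have e2 := mod_eight (Odd.mul (by decide) hd) hst (by exact_mod_cast hy2) h' h2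
    omega
  · have e1 : (q : ℤ) ∣ nm x :=
      dvd_of_dvd_four_mul hq hq2 (h ▸ Dvd.dvd.mul_left (by simpa using h1) _)
    have e2 : (q : ℤ) ∣ nm y :=
      dvd_of_dvd_four_mul hq hq2 (h' ▸ Dvd.dvd.mul_left (by simpa using h2) _)
    exact coprime_false (Nat.isCoprime_iff_coprime.2 hc) hq e1 e2

lemma nondeg_left {x : 𝓞 K} {n : ℕ} (hn3 : ¬ 3 ∣ n) (hc : Nat.Coprime (nm x) n) {q : ℕ}
    (hq : q.Prime) (hq2 : q ≠ 2) (h1 : (q : ℤ) ∣ n) :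
    ¬ (q : ℤ) ∣ (3 * S.U x) ^ 2 + 3 * (-S.V x) ^ 2 * (-3 * d) := by
  intro hdvd
  have h2 : (q : ℤ) ∣ 36 * nm x := by
    have h3 : (36 * nm x : ℤ) = 9 * |S.U x ^ 2 - d * S.V x ^ 2| := by rw [← S.four_nm]; ring
    rw [h3, ← abs_of_pos (show (0 : ℤ) < 9 by norm_num), ← abs_mul, dvd_abs]
    exact hdvd.trans (dvd_of_eq (by ring))
  have h3 : ¬ (q : ℤ) ∣ 36 := by
    intro h
    have : q ∣ 6 ^ 2 := by exact_mod_cast h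
    have : q ∣ 2 * 3 := hq.dvd_of_dvd_pow this
    rcases (Nat.Prime.dvd_mul hq).1 this with h | h
    · exact hq2 ((Nat.prime_dvd_prime_iff_eq hq Nat.prime_two).1 h)
    · rw [(Nat.prime_dvd_prime_iff_eq hq Nat.prime_three).1 h] at h1
      exact hn3 (by exact_mod_cast h1)
  exact coprime_false (Nat.isCoprime_iff_coprime.2 hc) hq
    (((int_prime_of_nat hq).dvd_or_dvd h2).resolve_left h3) h1

lemma core_exact (hd : Odd d) {x : 𝓞 K} {y : 𝓞 K'} (hx2 : Odd (nm x)) (hy2 : Odd (nm y))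
    (hx3 : ¬ 3 ∣ nm x) (hy3 : ¬ 3 ∣ nm y) (hc : Nat.Coprime (nm x) (nm y)) {k : ℕ} {v' t' : ℤ}
    (hv : S.V x = 3 ^ (k + 2) * v') (ht : S'.V y = 3 ^ k * t') (hv' : ¬ 3 ∣ v') (ht' : ¬ 3 ∣ t') :
    S'.Lam (3 * S.U x) (-S.V x) (Ideal.span {y}) = S.Lam (S'.U y) (S'.V y) (Ideal.span {x}) := by
  have hx0 : x ≠ 0 := fun h => hx3 (by rw [nm_eq_zero.2 h]; exact dvd_zero _)
  have hy0 : y ≠ 0 := fun h => hy3 (by rw [nm_eq_zero.2 h]; exact dvd_zero _)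
  obtain ⟨g, u, v, hU, hV, huv, hg, hn⟩ := S.exists_primitive hx0
  obtain ⟨g', s, t, hU', hV', hst, hg', hn'⟩ := S'.exists_primitive hy0
  have hcop := coprime_forms hd hx2 hy2 hc huv hst hn hn'
  have hnx3 : ¬ (3 : ℤ) ∣ nm x := by exact_mod_cast hx3
  have hny3 : ¬ (3 : ℤ) ∣ nm y := by exact_mod_cast hy3
  have hcc : IsCoprime (nm x : ℤ) (nm y) := Nat.isCoprime_iff_coprime.2 hc
  have p3 : Prime (3 : ℤ) := Int.prime_three
  have hg3 : ¬ (3 : ℤ) ∣ g := fun h => by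
    have : (3 : ℤ) ∣ 4 * nm x := by
      rw [← hn]; exact (h.trans (dvd_pow_self g two_ne_zero)).mul_right _
    omega
  have hg3' : ¬ (3 : ℤ) ∣ g' := fun h => by
    have : (3 : ℤ) ∣ 4 * nm y := by
      rw [← hn']; exact (h.trans (dvd_pow_self g' two_ne_zero)).mul_right _
    omega
  have hX3 : ¬ (3 : ℤ) ∣ u ^ 2 - d * v ^ 2 := fun h => by
    have : (3 : ℤ) ∣ 4 * nm x := by
      rw [← hn]; exact Dvd.dvd.mul_left (by simpa [← Int.abs_eq_natAbs] using h) _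
    omega
  have hY3 : ¬ (3 : ℤ) ∣ s ^ 2 - -3 * d * t ^ 2 := fun h => by
    have : (3 : ℤ) ∣ 4 * nm y := by
      rw [← hn']; exact Dvd.dvd.mul_left (by simpa only [← Int.abs_eq_natAbs, dvd_abs] using h) _
    omega
  have aux : ∀ {g v w : ℤ} {m : ℕ}, ¬ (3 : ℤ) ∣ g → g * v = 3 ^ m * w → ¬ (3 : ℤ) ∣ w →
      ∃ w', v = 3 ^ m * w' ∧ ¬ (3 : ℤ) ∣ w' := by
    intro g v w m hg h hw
    have hcp : IsCoprime ((3 : ℤ) ^ m) g := (p3.coprime_iff_not_dvd.2 hg).pow_left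
    obtain ⟨w', rfl⟩ := hcp.dvd_of_dvd_mul_left (Dvd.intro _ h.symm)
    refine ⟨w', rfl, fun h3 => hw ?_⟩
    have : (3 : ℤ) ^ m * (g * w') = 3 ^ m * w := by rw [← h]; ring
    rw [← mul_left_cancel₀ (pow_ne_zero m three_ne_zero) this]
    exact h3.mul_left _
  obtain ⟨v'', hv1, hv2⟩ := aux hg3 (hV.symm.trans hv) hv'
  obtain ⟨t'', ht1, ht2⟩ := aux hg3' (hV'.symm.trans ht) ht'
  have hqg : ∀ q : ℕ, q.Prime → (q : ℤ) ∣ g → q ≠ 2 → (q : ℤ) ∣ nm x := by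
    intro q hq hqg hq2
    have : (q : ℤ) ∣ 4 * nm x := by
      rw [← hn]; exact (hqg.trans (dvd_pow_self g two_ne_zero)).mul_right _
    exact dvd_of_dvd_four_mul hq hq2 this
  have hqg' : ∀ q : ℕ, q.Prime → (q : ℤ) ∣ g' → q ≠ 2 → (q : ℤ) ∣ nm y := by
    intro q hq hqg hq2
    have : (q : ℤ) ∣ 4 * nm y := by
      rw [← hn']; exact (hqg.trans (dvd_pow_self g' two_ne_zero)).mul_right _
    exact dvd_of_dvd_four_mul hq hq2 this
  have hqx : ∀ q : ℕ, q.Prime → q ≠ 2 → (q : ℤ) ∣ u ^ 2 - d * v ^ 2 → (q : ℤ) ∣ nm x := by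
    intro q hq hq2 h
    have : (q : ℤ) ∣ 4 * nm x := by
      rw [← hn]; exact Dvd.dvd.mul_left (by simpa [← Int.abs_eq_natAbs] using h) _
    exact dvd_of_dvd_four_mul hq hq2 this
  have hqy : ∀ q : ℕ, q.Prime → q ≠ 2 → (q : ℤ) ∣ s ^ 2 - -3 * d * t ^ 2 → (q : ℤ) ∣ nm y := by
    intro q hq hq2 h
    have : (q : ℤ) ∣ 4 * nm y := by
      rw [← hn']; exact Dvd.dvd.mul_left (by simpa only [← Int.abs_eq_natAbs, dvd_abs] using h) _
    exact dvd_of_dvd_four_mul hq hq2 this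
  have E1 : S'.Lam (3 * S.U x) (-S.V x) (Ideal.span {y}) =
      E (rt (v * s) (-(u * t))) (s ^ 2 - -3 * d * t ^ 2).natAbs := by
    rw [S'.Lam_eval hy0 hU' hV' hst hg']
    · refine E_congr_fun fun q hq hqn => ?_
      by_cases hq2 : q = 2
      · rw [hq2, e_two_rt, e_two_rt]
      have hqy' := hqy q hq hq2 (Int.natCast_dvd.2 hqn)
      have hqg0 : ¬ (q : ℤ) ∣ g := fun h => coprime_false hcc hq (hqg q hq h hq2) hqy'
      rw [← e_rt_zero_mul (z := rt (v * s) (-(u * t))), ← e_int_mul hqg0 (rt 0 1 * rt (v * s) (-(u * t))),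
          rt_mul, hU, hV]
      congr 1
      ext <;> simp [rt] <;> ring
    · intro q hq hq2 hqg0 hdvd
      have h1 : (q : ℤ) ∣ nm y := hqg' q hq hqg0 hq2
      exact nondeg_left S hy3 hc hq hq2 h1 hdvd
  have E2 : S.Lam (S'.U y) (S'.V y) (Ideal.span {x}) =
      E (rt (v * s) (-(u * t))) (u ^ 2 - d * v ^ 2).natAbs := by
    rw [S.Lam_eval hx0 hU hV huv hg]
    · refine E_congr_fun fun q hq hqn => ?_
      by_cases hq2 : q = 2
      · rw [hq2, e_two_rt, e_two_rt]
      have hqx' := hqx q hq hq2 (Int.natCast_dvd.2 hqn)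
      have hqg0 : ¬ (q : ℤ) ∣ g' := fun h => coprime_false hcc hq hqx' (hqg' q hq h hq2)
      rw [← e_int_mul hqg0 (rt (v * s) (-(u * t))), hU', hV']
      congr 1
      ext <;> simp [rt] <;> ring
    · intro q hq hq2 hqg0 hdvd
      have h1 : (q : ℤ) ∣ nm x := hqg q hq hqg0 hq2
      have h2 : (q : ℤ) ∣ 4 * nm y := by
        rw [S'.four_nm, dvd_abs]
        exact hdvd.trans (dvd_of_eq (by ring))
      exact coprime_false hcc hq h1 (dvd_of_dvd_four_mul hq hq2 h2)
  rw [E1, E2]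
  have hS : s ^ 2 - -3 * d * t ^ 2 = s ^ 2 + 3 * d * t ^ 2 := by ring
  rw [hS] at hcop hY3 ⊢
  exact (recip huv hst hcop hX3 hY3 hv1 ht1 hv2 ht2).symm

end Core

end

section

open UniqueFactorizationMonoid

lemma prime_dvd_nm {K : Type*} [Field K] [NumberField K] {x : 𝓞 K} {q : ℕ} (hq : q.Prime)
    (h : q ∣ nm x) : ∃ P : Ideal (𝓞 K), P.IsPrime ∧ x ∈ P ∧ (q : 𝓞 K) ∈ P := by
  obtain ⟨P, h1, h2, h3⟩ := exists_prime_ideal_of_dvd_absNorm hq h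
  exact ⟨P, h1, h2 (Ideal.mem_span_singleton_self x), h3⟩

/-- An element congruent to `1` modulo `m` has norm coprime to `m`. -/
lemma nm_coprime_of_one {K : Type*} [Field K] [NumberField K] {x z : 𝓞 K} {m : ℕ}
    (h : x = 1 + m * z) : Nat.Coprime (nm x) m := by
  refine Nat.coprime_of_dvd fun q hq h1 h2 => ?_
  obtain ⟨P, hP, hx, hqP⟩ := prime_dvd_nm hq h1
  obtain ⟨l, rfl⟩ := h2
  apply hP.ne_top
  rw [Ideal.eq_top_iff_one]
  have : (1 : 𝓞 K) = x - q * (l * z) := by rw [h]; push_cast; ring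
  rw [this]
  exact P.sub_mem hx (P.mul_mem_right _ hqP)

namespace QF

variable {K : Type*} [Field K] [NumberField K] {D : ℤ} (S : QF K D)

lemma UV_add (x y : 𝓞 K) : S.U (x + y) = S.U x + S.U y ∧ S.V (x + y) = S.V x + S.V y := by
  apply S.UV_unique
  push_cast
  linear_combination S.two_mul_eq x + S.two_mul_eq y

lemma UV_int_mul (n : ℤ) (x : 𝓞 K) : S.U (n * x) = n * S.U x ∧ S.V (n * x) = n * S.V x := by
  apply S.UV_unique
  push_cast
  linear_combination (n : 𝓞 K) * S.two_mul_eq x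

lemma UV_int (n : ℤ) : S.U (n : 𝓞 K) = 2 * n ∧ S.V (n : 𝓞 K) = 0 := by
  apply S.UV_unique
  push_cast; ring

lemma UV_δ : S.U S.δ = 0 ∧ S.V S.δ = 2 := by
  apply S.UV_unique
  push_cast; ring

lemma UV_mul (x y : 𝓞 K) : 2 * S.U (x * y) = S.U x * S.U y + D * (S.V x * S.V y) ∧
    2 * S.V (x * y) = S.U x * S.V y + S.V x * S.U y := by
  have h := S.coords_unique (u := 2 * S.U (x * y)) (v := 2 * S.V (x * y))
    (u' := S.U x * S.U y + D * (S.V x * S.V y)) (v' := S.U x * S.V y + S.V x * S.U y) (by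
      push_cast
      linear_combination (-2 : 𝓞 K) * S.two_mul_eq (x * y) + 2 * y * S.two_mul_eq x +
        (S.U x + S.V x * S.δ) * S.two_mul_eq y + (S.V x * S.V y : 𝓞 K) * S.sq)
  exact h

lemma Lam_congr_mod {A B A' B' : ℤ} {y : 𝓞 K} {m : ℤ} (hm : (nm y : ℤ) ∣ m) (hA : m ∣ A - A')
    (hB : m ∣ B - B') : S.Lam A B (Ideal.span {y}) = S.Lam A' B' (Ideal.span {y}) := by
  refine S.Lam_congr fun p hp hy => ?_
  by_cases H : (Ideal.absNorm p).Prime ∧ ∃ h : ℤ, S.δ - h ∈ p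
  · obtain ⟨hq, h, hh⟩ := H
    have hd : ((Ideal.absNorm p : ℕ) : ℤ) ∣ m := by
      refine dvd_trans ?_ hm
      exact_mod_cast Ideal.absNorm_dvd_absNorm_of_le hy
    rw [S.le_eq A B rfl hq hh, S.le_eq A' B' rfl hq hh]
    apply e_rt_congr (hd.trans hA)
    rw [← sub_mul]
    exact (hd.trans hB).mul_right _
  · rw [le, le, dif_neg H, dif_neg H]

lemma lift_cube {x : 𝓞 K} (h9 : 9 ∣ S.V x) (h3 : ¬ 3 ∣ nm x) {N : ℕ} (hN : 2 ≤ N) :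
    ∃ n : ℤ, ¬ 3 ∣ n ∧ ∀ M, 2 ≤ M → ∃ c w : 𝓞 K, x * c ^ 3 = n + 3 ^ N * S.δ + 3 ^ M * w := by
  have hU : ¬ 3 ∣ S.U x := by
    intro h
    have h4 := S.four_nm x
    have : (3 : ℤ) ∣ 4 * nm x := by
      rw [h4, dvd_abs]
      exact dvd_sub (h.trans (dvd_pow_self _ two_ne_zero))
        ((((show (3 : ℤ) ∣ 9 by norm_num).trans h9).trans (dvd_pow_self _ two_ne_zero)).mul_left _)
    apply h3
    have : (3 : ℤ) ∣ nm x := by omega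
    exact_mod_cast this
  refine ⟨5 * S.U x, by omega, fun M hM => ?_⟩
  induction M, hM using Nat.le_induction with
  | base =>
    obtain ⟨k, hk⟩ := h9
    obtain ⟨N', rfl⟩ := Nat.exists_eq_add_of_le hN
    refine ⟨1, -x + 5 * k * S.δ - 3 ^ N' * S.δ, ?_⟩
    have h := S.two_mul_eq x
    rw [hk] at h
    push_cast at h ⊢
    rw [pow_add]
    linear_combination 5 * h
  | succ M hM ih =>
    obtain ⟨c, w, h⟩ := ih
    have hn : ¬ 3 ∣ 5 * S.U x := by omega
    generalize 5 * S.U x = n at h hn ⊢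
    obtain ⟨l, hl⟩ : ∃ l : ℤ, n ^ 2 = 1 + 3 * l := by
      have : n % 3 = 1 ∨ n % 3 = 2 := by omega
      refine ⟨n ^ 2 / 3, ?_⟩
      have : n ^ 2 % 3 = 1 := by
        rcases this with h | h <;> simp [pow_two, Int.mul_emod, h]
      omega
    obtain ⟨m, rfl⟩ := Nat.exists_eq_add_of_le hM
    obtain ⟨N', rfl⟩ := Nat.exists_eq_add_of_le hN
    have hl' := congrArg (Int.cast : ℤ → 𝓞 K) hl
    push_cast at hl'
    have e1 : ∀ y : 𝓞 K, (c * (1 - 3 * 3 ^ m * y)) ^ 3 =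
        c ^ 3 * (1 - 9 * 3 ^ m * y + 27 * (3 ^ m * 3 ^ m * y ^ 2) - 27 * (3 ^ m * 3 ^ m * 3 ^ m * y ^ 3)) := by
      intro y; ring
    refine ⟨c * (1 - 3 * 3 ^ m * (n * w)),
      -l * w - n * w * 3 * 3 ^ N' * S.δ - 3 ^ m * 3 * w * (n * w) + x * c ^ 3 *
        (3 ^ m * (n * w) ^ 2 - 3 ^ m * 3 ^ m * (n * w) ^ 3), ?_⟩
    rw [e1]
    have e2 : (3 : 𝓞 K) ^ (2 + m + 1) = 27 * 3 ^ m := by ring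
    have e3 : (3 : 𝓞 K) ^ (2 + m) = 9 * 3 ^ m := by ring
    have e4 : (3 : 𝓞 K) ^ (2 + N') = 9 * 3 ^ N' := by ring
    rw [e3, e4] at h
    rw [e2, e4]
    linear_combination (1 - 9 * 3 ^ m * (n * w)) * h - 9 * 3 ^ m * w * hl'

end QF

section Core

variable {K K' : Type*} [Field K] [NumberField K] [Field K'] [NumberField K'] {d : ℤ}
  (S : QF K d) (S' : QF K' (-3 * d))

/-- The reciprocity law between the two quadratic fields. -/
lemma core (hd : Odd d) {x : 𝓞 K} {y : 𝓞 K'} (hx2 : Odd (nm x)) (hy2 : Odd (nm y))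
    (hx3 : ¬ 3 ∣ nm x) (hy3 : ¬ 3 ∣ nm y) (hc : Nat.Coprime (nm x) (nm y)) (h9 : 9 ∣ S.V x) :
    S'.Lam (3 * S.U x) (-S.V x) (Ideal.span {y}) = S.Lam (S'.U y) (S'.V y) (Ideal.span {x}) := by
  have hx0 : x ≠ 0 := fun h => hx3 (by rw [nm_eq_zero.2 h]; exact dvd_zero _)
  have hy0 : y ≠ 0 := fun h => hy3 (by rw [nm_eq_zero.2 h]; exact dvd_zero _)
  by_cases hV : S'.V y = 0
  · have hU : S'.U y ≠ 0 := by
      intro hU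
      have := S'.two_mul_eq y
      rw [hU, hV] at this
      apply hy0
      simpa using this
    rw [S'.Lam_eval hy0 (g := S'.U y) (u := 1) (v := 0) (by ring) (by rw [hV]; ring)
      isCoprime_one_left hU]
    · norm_num [E_one]
      rw [S.Lam_eq_zero]
      intro p hp hxp
      by_cases H : (Ideal.absNorm p).Prime ∧ ∃ h : ℤ, S.δ - h ∈ p
      · obtain ⟨hq, h, hh⟩ := H
        rw [S.le_eq _ _ rfl hq hh, hV, zero_mul]
        by_cases h2 : Ideal.absNorm p = 2
        · rw [h2, e_two_rt]
        have : rt (S'.U y) 0 = (S'.U y : ℤ) * (1 : Eis) := by ext <;> simp [rt]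
        rw [this, e_int_mul, e_one_right]
        intro hdvd
        have h1 : ((Ideal.absNorm p : ℕ) : ℤ) ∣ nm y := by
          apply dvd_of_dvd_four_mul hq h2
          rw [S'.four_nm, dvd_abs, hV]
          exact (hdvd.trans (dvd_pow_self _ two_ne_zero)).trans (dvd_of_eq (by ring))
        have h3 : Ideal.absNorm p ∣ nm x := Ideal.absNorm_dvd_absNorm_of_le hxp
        exact coprime_false (Nat.isCoprime_iff_coprime.2 hc) hq (by exact_mod_cast h3) h1
      · exact dif_neg H
    · intro q hq hq2 hdvd
      refine nondeg_left S hy3 hc hq hq2 ?_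
      apply dvd_of_dvd_four_mul hq hq2
      rw [S'.four_nm, dvd_abs, hV]
      exact (hdvd.trans (dvd_pow_self _ two_ne_zero)).trans (dvd_of_eq (by ring))
  obtain ⟨k, t', ht', ht⟩ : ∃ (k : ℕ) (t' : ℤ), ¬ 3 ∣ t' ∧ S'.V y = 3 ^ k * t' := by
    obtain ⟨t', h1, h2⟩ := (Int.finiteMultiplicity_iff.2
      ⟨by decide, hV⟩ : FiniteMultiplicity 3 (S'.V y)).exists_eq_pow_mul_and_not_dvd
    exact ⟨_, t', h2, h1⟩
  obtain ⟨n, hn3, hn⟩ := S.lift_cube h9 hx3 (N := k + 2) (by omega)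
  obtain ⟨c, w, hcw⟩ := hn (k + 3) (by omega)
  have hm3 : IsCoprime ((2 * nm y : ℕ) : ℤ) (3 ^ (k + 3)) := by
    apply IsCoprime.pow_right
    refine ((Int.prime_three.coprime_iff_not_dvd).2 ?_).symm
    intro h
    have : 3 ∣ 2 * nm y := by exact_mod_cast h
    omega
  obtain ⟨a, b, hab⟩ := hm3
  have hab' := congrArg (Int.cast : ℤ → 𝓞 K) hab
  push_cast at hab'
  set m : ℕ := 2 * nm y with hm
  set c' : 𝓞 K := 1 + m * (a * (c - 1)) with hc'
  have hnc : Nat.Coprime (nm c') m := nm_coprime_of_one hc'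
  have hcc : c' = c + 3 ^ (k + 3) * (-b * (c - 1)) := by
    rw [hc', hm]; push_cast
    linear_combination (c - 1) * hab'
  obtain ⟨w', hw'⟩ : ∃ w', x * c' ^ 3 = n + 3 ^ (k + 2) * S.δ + 3 ^ (k + 3) * w' := by
    have : (3 : 𝓞 K) ^ (k + 3) ∣ c' ^ 3 - c ^ 3 :=
      dvd_trans ⟨-b * (c - 1), by rw [hcc]; ring⟩ (sub_dvd_pow_sub_pow c' c 3)
    obtain ⟨z, hz⟩ := this
    exact ⟨w + x * z, by linear_combination hcw + x * hz⟩
  have hV' : S.V (x * c' ^ 3) = 3 ^ (k + 2) * (2 + 3 * S.V w') := by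
    rw [hw', show (n : 𝓞 K) + 3 ^ (k + 2) * S.δ + 3 ^ (k + 3) * w' =
      (n : 𝓞 K) + ((3 ^ (k + 2) : ℤ) : 𝓞 K) * S.δ + ((3 ^ (k + 3) : ℤ) : 𝓞 K) * w' by push_cast; ring,
      (S.UV_add _ _).2, (S.UV_add _ _).2, (S.UV_int_mul _ _).2, (S.UV_int_mul _ _).2, S.UV_δ.2,
      (S.UV_int _).2]
    ring
  have hU' : S.U (x * c' ^ 3) = 2 * n + 3 ^ (k + 3) * S.U w' := by
    rw [hw', show (n : 𝓞 K) + 3 ^ (k + 2) * S.δ + 3 ^ (k + 3) * w' =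
      (n : 𝓞 K) + ((3 ^ (k + 2) : ℤ) : 𝓞 K) * S.δ + ((3 ^ (k + 3) : ℤ) : 𝓞 K) * w' by push_cast; ring,
      (S.UV_add _ _).1, (S.UV_add _ _).1, (S.UV_int_mul _ _).1, (S.UV_int_mul _ _).1, S.UV_δ.1,
      (S.UV_int _).1]
    ring
  obtain ⟨z, hz⟩ : ∃ z, x * c' ^ 3 = x + ((m : ℤ) : 𝓞 K) * z := by
    obtain ⟨z, hz⟩ : (m : 𝓞 K) ∣ c' ^ 3 - 1 ^ 3 :=
      dvd_trans ⟨a * (c - 1), by rw [hc']; ring⟩ (sub_dvd_pow_sub_pow c' 1 3)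
    exact ⟨x * z, by push_cast; linear_combination x * hz⟩
  have hnc2 : Nat.Coprime (nm c') 2 := Nat.Coprime.coprime_dvd_right (dvd_mul_right 2 _) hnc
  have hncy : Nat.Coprime (nm c') (nm y) := Nat.Coprime.coprime_dvd_right (dvd_mul_left _ 2) hnc
  have hc0 : c' ≠ 0 := by
    intro h
    rw [h, nm_eq_zero.2 rfl] at hnc2
    norm_num at hnc2
  have hnx' : nm (x * c' ^ 3) = nm x * nm c' ^ 3 := by rw [nm_mul, nm_pow]
  have hx3' : ¬ 3 ∣ nm (x * c' ^ 3) := by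
    intro h
    have h0 : (3 : ℤ) ∣ 4 * nm (x * c' ^ 3) := by
      have : (3 : ℤ) ∣ nm (x * c' ^ 3) := by exact_mod_cast h
      exact this.mul_left _
    have hVm : (3 : ℤ) ∣ S.V (x * c' ^ 3) := by
      rw [hV', pow_succ]; exact ((dvd_refl _).mul_left _).mul_right _
    rw [S.four_nm, dvd_abs] at h0
    have hUm : (3 : ℤ) ∣ S.U (x * c' ^ 3) ^ 2 := by
      have := dvd_add h0 ((hVm.trans (dvd_pow_self _ two_ne_zero)).mul_left d)
      rwa [sub_add_cancel] at this
    have hUm' := Int.prime_three.dvd_of_dvd_pow hUm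
    rw [hU'] at hUm'
    have : (3 : ℤ) ∣ 3 ^ (k + 3) * S.U w' := (dvd_pow_self _ (by omega)).mul_right _
    omega
  have hmain := core_exact S S' hd (x := x * c' ^ 3) (y := y)
    (by rw [hnx']; exact hx2.mul (Odd.pow (Nat.coprime_two_right.1 hnc2))) hy2 hx3' hy3
    (by rw [hnx']; exact Nat.Coprime.mul_left hc (hncy.pow_left 3)) hV' ht (by omega) ht'
  have hR : S.Lam (S'.U y) (S'.V y) (Ideal.span {x * c' ^ 3}) =
      S.Lam (S'.U y) (S'.V y) (Ideal.span {x}) := by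
    rw [← Ideal.span_singleton_mul_span_singleton, ← Ideal.span_singleton_pow,
      S.Lam_mul _ _ (span_ne hx0) (pow_ne_zero _ (span_ne hc0)), S.Lam_cube _ _ (span_ne hc0),
      add_zero]
  rw [← hR, ← hmain, hz, (S.UV_add _ _).1, (S.UV_add _ _).2, (S.UV_int_mul _ _).1,
    (S.UV_int_mul _ _).2]
  apply S'.Lam_congr_mod (m := m) (by rw [hm]; push_cast; exact dvd_mul_left _ _)
  · exact ⟨-3 * S.U z, by ring⟩
  · exact ⟨S.V z, by ring⟩

end Core

end

section

open UniqueFactorizationMonoid Filter Topology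

section Density

variable (F : Type*) [Field F] [NumberField F]

/-- The nonzero ideals lying in none of the primes of `T`. -/
def goodIdeals (T : Finset (Ideal (𝓞 F))) : Set (Ideal (𝓞 F)) :=
  {I | I ≠ ⊥ ∧ ∀ P ∈ T, ¬ I ≤ P}

/-- The number of ideals of norm at most `s` in a set of ideals. -/
def countNorm {F : Type*} [Field F] [NumberField F] (G : Set (Ideal (𝓞 F))) (s : ℝ) : ℝ :=
  (({I | I ∈ G ∧ (Ideal.absNorm I : ℝ) ≤ s} : Set (Ideal (𝓞 F))).ncard : ℝ)

variable {F}

lemma finite_norm_le (s : ℝ) : {I : Ideal (𝓞 F) | (Ideal.absNorm I : ℝ) ≤ s}.Finite := by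
  by_cases hs : 0 ≤ s
  · have := Ideal.finite_setOfPred_absNorm_le (S := 𝓞 F) ⌊s⌋₊
    refine this.subset fun I hI => ?_
    exact (Nat.le_floor_iff hs).2 hI
  · convert Set.finite_empty
    ext I
    simp only [Set.mem_ofPred_eq, Set.mem_empty_iff_false, iff_false, not_le]
    push Not at hs
    exact hs.trans_le (Nat.cast_nonneg _)

lemma tendsto_goodIdeals_empty :
    ∃ κ : ℝ, 0 < κ ∧ Tendsto (fun s => countNorm (goodIdeals F ∅) s / s) atTop (𝓝 κ) := by
  refine ⟨_, dedekindZeta_residue_pos F, ?_⟩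
  have := Ideal.tendsto_norm_le_div_atTop₀ F
  rw [dedekindZeta_residue]
  refine this.congr fun s => ?_
  congr 2
  rw [← Nat.card_coe_set_eq]
  apply Nat.card_congr
  exact
    { toFun := fun I => ⟨I.1.1, ⟨nonZeroDivisors.ne_zero I.1.2, by simp⟩, I.2⟩
      invFun := fun I => ⟨⟨I.1, mem_nonZeroDivisors_of_ne_zero I.2.1.1⟩, I.2.2⟩
      left_inv := fun I => rfl
      right_inv := fun I => rfl }

lemma tendsto_goodIdeals (T : Finset (Ideal (𝓞 F))) (hT : ∀ P ∈ T, P.IsPrime ∧ P ≠ ⊥) :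
    ∃ κ : ℝ, 0 < κ ∧ Tendsto (fun s => countNorm (goodIdeals F T) s / s) atTop (𝓝 κ) := by
  classical
  induction T using Finset.induction_on with
  | empty => exact tendsto_goodIdeals_empty
  | insert P T hPT ih =>
    obtain ⟨κ, hκ, h⟩ := ih fun P hP => hT P (Finset.mem_insert_of_mem hP)
    obtain ⟨hP, hP0⟩ := hT P (Finset.mem_insert_self _ _)
    set N : ℝ := ((Ideal.absNorm P : ℕ) : ℝ) with hN
    have hN1 : 1 < N := by
      have h0 : Ideal.absNorm P ≠ 0 := by rwa [Ne, Ideal.absNorm_eq_zero_iff]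
      have h1 : Ideal.absNorm P ≠ 1 := by
        rw [Ne, Ideal.absNorm_eq_one_iff]; exact hP.ne_top
      rw [hN]
      exact_mod_cast (show 1 < Ideal.absNorm P by omega)
    have key : ∀ s, countNorm (goodIdeals F (insert P T)) s =
        countNorm (goodIdeals F T) s - countNorm (goodIdeals F T) (s / N) := by
      intro s
      have hfin : ∀ s, {I | I ∈ goodIdeals F T ∧ (Ideal.absNorm I : ℝ) ≤ s}.Finite := fun s =>
        (finite_norm_le s).subset fun I hI => hI.2
      rw [eq_sub_iff_add_eq, countNorm, countNorm, countNorm, ← Nat.cast_add]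
      congr 1
      have himg : {I | I ∈ goodIdeals F T ∧ (Ideal.absNorm I : ℝ) ≤ s / N}.ncard =
          (Set.image (fun J => P * J)
            {I | I ∈ goodIdeals F T ∧ (Ideal.absNorm I : ℝ) ≤ s / N}).ncard :=
        (Set.ncard_image_of_injective _ (mul_right_injective₀ hP0)).symm
      rw [himg, ← Set.ncard_union_eq (hs := (finite_norm_le s).subset fun I hI => hI.2)
        (ht := (hfin _).image _)]
      · congr 1
        ext I
        simp only [Set.mem_union, Set.mem_ofPred_eq, Set.mem_image, goodIdeals]
        constructor
        · rintro (⟨⟨h1, h2⟩, h3⟩ | ⟨J, ⟨⟨h1, h2⟩, h3⟩, rfl⟩)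
          · exact ⟨⟨h1, fun Q hQ => h2 Q (Finset.mem_insert_of_mem hQ)⟩, h3⟩
          · refine ⟨⟨mul_ne_zero hP0 h1, fun Q hQ hle => ?_⟩, ?_⟩
            · have hQ' := hT Q (Finset.mem_insert_of_mem hQ)
              rcases hQ'.1.mul_le.1 hle with h | h
              · have : P = Q := (hP.isMaximal hP0).eq_of_le hQ'.1.ne_top h
                exact hPT (this ▸ hQ)
              · exact h2 Q hQ h
            · rw [map_mul]; push_cast
              rw [le_div_iff₀ (by linarith)] at h3
              linarith
        · rintro ⟨⟨h1, h2⟩, h3⟩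
          by_cases hI : I ≤ P
          · right
            obtain ⟨J, rfl⟩ := Ideal.dvd_iff_le.2 hI
            refine ⟨J, ⟨⟨fun h => h1 (by rw [h]; exact mul_zero P), fun Q hQ hle =>
              h2 Q hQ (Ideal.mul_le_right.trans hle)⟩, ?_⟩, rfl⟩
            rw [map_mul] at h3; push_cast at h3
            rw [le_div_iff₀ (by linarith)]
            linarith
          · left
            refine ⟨⟨h1, fun Q hQ => ?_⟩, h3⟩
            rcases Finset.mem_insert.1 hQ with rfl | hQ
            · exact hI
            · exact h2 Q hQ
      · rw [Set.disjoint_left]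
        rintro I ⟨⟨-, h2⟩, -⟩ ⟨J, -, rfl⟩
        exact h2 P (Finset.mem_insert_self _ _) Ideal.mul_le_left
    refine ⟨κ - κ / N, ?_, ?_⟩
    · rw [sub_pos, div_lt_iff₀ (by linarith)]
      nlinarith
    · have h2 : Tendsto (fun s => countNorm (goodIdeals F T) (s / N) / (s / N) / N) atTop
          (𝓝 (κ / N)) :=
        (h.comp (tendsto_id.atTop_div_const (by linarith))).div_const N
      refine (h.sub h2).congr fun s => ?_
      rw [key, div_div, div_mul_cancel₀ _ (by linarith), sub_div]

/-- A counting contradiction: the ideals of a number field cannot contain the products of pairs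
from a set of ideals of positive density. -/
lemma no_pair_embedding {M : Type*} [Field M] [NumberField M] {G : Set (Ideal (𝓞 F))} {κ : ℝ}
    (hκ : 0 < κ) (hG : Tendsto (fun s => countNorm G s / s) atTop (𝓝 κ))
    (hG0 : ∀ I ∈ G, I ≠ ⊥) (f : Ideal (𝓞 F) → Ideal (𝓞 F) → Ideal (𝓞 M))
    (hinj : ∀ I ∈ G, ∀ J ∈ G, ∀ I' ∈ G, ∀ J' ∈ G, f I J = f I' J' → I = I' ∧ J = J')
    (hf : ∀ I ∈ G, ∀ J ∈ G, Ideal.absNorm (f I J) = Ideal.absNorm I * Ideal.absNorm J) : False := by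
  classical
  obtain ⟨C, hC, hM⟩ := tendsto_goodIdeals_empty (F := M)
  have hpos : ∀ I ∈ G, (0 : ℝ) < Ideal.absNorm I := fun I hI => by
    have : Ideal.absNorm I ≠ 0 := by rw [Ne, Ideal.absNorm_eq_zero_iff]; exact hG0 I hI
    positivity
  have hbound : ∀ T : Finset G, ∑ I ∈ T, ((Ideal.absNorm (I : Ideal (𝓞 F)) : ℝ))⁻¹ ≤ C / κ := by
    intro T
    rw [le_div_iff₀ hκ]
    have hlim : Tendsto (fun s => ∑ I ∈ T, countNorm G (s / Ideal.absNorm (I : Ideal (𝓞 F))) / s) atTop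
        (𝓝 (∑ I ∈ T, (((Ideal.absNorm (I : Ideal (𝓞 F))) : ℝ))⁻¹ * κ)) := by
      apply tendsto_finsetSum
      intro I _
      have h1 := (hG.comp (tendsto_id.atTop_div_const (hpos I I.2))).const_mul
        ((Ideal.absNorm (I : Ideal (𝓞 F)) : ℝ))⁻¹
      refine h1.congr' ?_
      filter_upwards with s
      have := (hpos I I.2).ne'
      simp only [Function.comp, id]
      by_cases hs : s = 0
      · simp [hs]
      field_simp
    rw [Finset.sum_mul]
    refine le_of_tendsto_of_tendsto hlim hM ?_
    filter_upwards [eventually_gt_atTop 0] with s hs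
    rw [← Finset.sum_div]
    refine div_le_div_of_nonneg_right ?_ hs.le
    have hfin : ∀ s, {I | I ∈ G ∧ (Ideal.absNorm I : ℝ) ≤ s}.Finite := fun s =>
        (finite_norm_le s).subset fun I hI => hI.2
    have hfinM : {I | I ∈ goodIdeals M ∅ ∧ (Ideal.absNorm I : ℝ) ≤ s}.Finite :=
        (finite_norm_le s).subset fun I hI => hI.2
    let A : G → Finset (Ideal (𝓞 F)) := fun I => (hfin (s / Ideal.absNorm (I : Ideal (𝓞 F)))).toFinset
    have e1 : ∑ I ∈ T, countNorm G (s / Ideal.absNorm (I : Ideal (𝓞 F))) = ((T.sigma A).card : ℝ) := by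
      rw [Finset.card_sigma, Nat.cast_sum]
      refine Finset.sum_congr rfl fun I _ => ?_
      rw [countNorm, Set.ncard_eq_toFinset_card _ (hfin _)]
    rw [e1, countNorm, Set.ncard_eq_toFinset_card _ hfinM]
    norm_cast
    have hA : ∀ I J, J ∈ A I → J ∈ G ∧ (Ideal.absNorm J : ℝ) ≤ s / Ideal.absNorm (I : Ideal (𝓞 F)) := by
      intro I J hJ
      simpa [A] using hJ
    refine Finset.card_le_card_of_injOn (fun p => f p.1 p.2) ?_ ?_
    · rintro ⟨I, J⟩ hp
      obtain ⟨hJ, hle⟩ := hA I J (Finset.mem_sigma.1 (Finset.mem_coe.1 hp)).2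
      have hn := hf I I.2 J hJ
      simp only [Finset.mem_coe, Set.Finite.mem_toFinset, Set.mem_ofPred_eq, goodIdeals]
      refine ⟨⟨?_, by simp⟩, ?_⟩
      · rw [Ne, ← Ideal.absNorm_eq_zero_iff, hn]
        have h1 := hpos I I.2
        have h2 := hpos J hJ
        norm_cast at h1 h2
        positivity
      · rw [hn]; push_cast
        rw [le_div_iff₀ (hpos I I.2)] at hle
        linarith
    · rintro ⟨I, J⟩ hp ⟨I', J'⟩ hp' h
      obtain ⟨hJ, -⟩ := hA I J (Finset.mem_sigma.1 (Finset.mem_coe.1 hp)).2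
      obtain ⟨hJ', -⟩ := hA I' J' (Finset.mem_sigma.1 (Finset.mem_coe.1 hp')).2
      obtain ⟨h1, rfl⟩ := hinj I I.2 J hJ I' I'.2 J' hJ' h
      obtain rfl := Subtype.ext h1
      rfl
  have hsum : Summable fun I : G => ((Ideal.absNorm (I : Ideal (𝓞 F)) : ℝ))⁻¹ :=
    summable_of_sum_le (fun I => by positivity) hbound
  obtain ⟨T, hT⟩ := (summable_iff_vanishing_norm.1 hsum) (κ / 2) (by linarith)
  have hlim2 : Tendsto (fun s : ℝ => countNorm G s / s - T.card / s) atTop (𝓝 (κ - 0)) :=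
    hG.sub (tendsto_const_nhds.div_atTop tendsto_id)
  have hle : κ - 0 ≤ κ / 2 := by
    refine le_of_tendsto hlim2 ?_
    filter_upwards [eventually_gt_atTop 0] with s hs
    have hfin : {I : G | (Ideal.absNorm (I : Ideal (𝓞 F)) : ℝ) ≤ s}.Finite :=
      Set.Finite.preimage Subtype.val_injective.injOn (finite_norm_le s)
    have hcount : countNorm G s = (hfin.toFinset.card : ℝ) := by
      rw [countNorm, ← Set.ncard_eq_toFinset_card _ hfin,
        ← Set.ncard_image_of_injective _ Subtype.val_injective]
      congr 2
      ext I; simp [and_comm]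
    have h1 := hT (hfin.toFinset \ T) Finset.sdiff_disjoint
    rw [Real.norm_of_nonneg (Finset.sum_nonneg fun I _ => by positivity)] at h1
    refine le_trans ?_ h1.le
    have h2 : ((hfin.toFinset \ T).card : ℝ) * s⁻¹ ≤
        ∑ I ∈ hfin.toFinset \ T, ((Ideal.absNorm (I : Ideal (𝓞 F)) : ℝ))⁻¹ := by
      rw [← nsmul_eq_mul]
      refine Finset.card_nsmul_le_sum _ _ _ fun I hI => ?_
      have : (Ideal.absNorm (I : Ideal (𝓞 F)) : ℝ) ≤ s := by
        have := (Finset.mem_sdiff.1 hI).1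
        simpa using this
      exact inv_anti₀ (hpos I I.2) this
    refine le_trans ?_ h2
    rw [← sub_div, div_eq_mul_inv, hcount]
    refine mul_le_mul_of_nonneg_right ?_ (by positivity)
    have := Finset.le_card_sdiff T hfin.toFinset
    rw [sub_le_iff_le_add]
    norm_cast
    omega
  linarith

end Density

end

section

open UniqueFactorizationMonoid Filter Topology Polynomial

lemma prod_primes {M : Type*} [Field M] [NumberField M] {s : Multiset (Ideal (𝓞 M))}
    (hs : ∀ p ∈ s, p.IsPrime ∧ p ≠ ⊥) : normalizedFactors s.prod = s :=
  normalizedFactors_prod_of_prime fun p hp => Ideal.prime_of_isPrime (hs p hp).2 (hs p hp).1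

lemma absNorm_prod {M : Type*} [Field M] [NumberField M] (s : Multiset (Ideal (𝓞 M))) :
    Ideal.absNorm s.prod = (s.map Ideal.absNorm).prod := map_multiset_prod _ _

/-- It is impossible that two distinct primes of the same norm lie over almost all primes. -/
lemma no_two_primes {F M : Type*} [Field F] [NumberField F] [Field M] [NumberField M]
    (i : 𝓞 F →+* 𝓞 M) {b : 𝓞 F} (hb : b ≠ 0) (Q₀ Q₁ : Ideal (𝓞 F) → Ideal (𝓞 M))
    (hQ : ∀ P : Ideal (𝓞 F), P.IsPrime → P ≠ ⊥ → b ∉ P →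
      ((Q₀ P).IsPrime ∧ (Q₀ P).comap i = P ∧ Ideal.absNorm (Q₀ P) = Ideal.absNorm P) ∧
      ((Q₁ P).IsPrime ∧ (Q₁ P).comap i = P ∧ Ideal.absNorm (Q₁ P) = Ideal.absNorm P) ∧
      Q₀ P ≠ Q₁ P) : False := by
  classical
  set T : Finset (Ideal (𝓞 F)) := (normalizedFactors (Ideal.span {b})).toFinset with hT
  obtain ⟨κ, hκ, hlim⟩ := tendsto_goodIdeals T (fun P hP => by
    rw [hT, Multiset.mem_toFinset] at hP
    exact ⟨Ideal.isPrime_of_prime (prime_of_normalized_factor P hP),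
      (prime_of_normalized_factor P hP).ne_zero⟩)
  have isPrime_of_mem' : ∀ {I p : Ideal (𝓞 F)}, p ∈ normalizedFactors I → p.IsPrime := fun h =>
    Ideal.isPrime_of_prime (prime_of_normalized_factor _ h)
  have hgood : ∀ I ∈ goodIdeals F T, ∀ P ∈ normalizedFactors I, P.IsPrime ∧ P ≠ ⊥ ∧ b ∉ P := by
    intro I hI P hP
    refine ⟨isPrime_of_mem' hP, (prime_of_normalized_factor P hP).ne_zero, fun hbP => ?_⟩
    refine hI.2 P ?_ (Ideal.le_of_dvd (dvd_of_mem_normalizedFactors hP))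
    rw [hT, Multiset.mem_toFinset, Ideal.mem_normalizedFactors_iff (span_ne hb)]
    exact ⟨isPrime_of_mem' hP, (Ideal.span_singleton_le_iff_mem P).2 hbP⟩
  let f : Ideal (𝓞 F) → Ideal (𝓞 F) → Ideal (𝓞 M) := fun I J =>
    ((normalizedFactors I).map Q₀ + (normalizedFactors J).map Q₁).prod
  have hne : ∀ P : Ideal (𝓞 F), P ≠ ⊥ → ∀ Q : Ideal (𝓞 M), Ideal.absNorm Q = Ideal.absNorm P →
      Q ≠ ⊥ := by
    intro P hP Q h hQ
    rw [hQ, Ideal.absNorm_bot, eq_comm, Ideal.absNorm_eq_zero_iff] at h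
    exact hP h
  have hnf : ∀ I ∈ goodIdeals F T, ∀ J ∈ goodIdeals F T, normalizedFactors (f I J) =
      (normalizedFactors I).map Q₀ + (normalizedFactors J).map Q₁ := by
    intro I hI J hJ
    apply prod_primes
    intro Q hQm
    rcases Multiset.mem_add.1 hQm with h | h
    · obtain ⟨P, hP, rfl⟩ := Multiset.mem_map.1 h
      obtain ⟨h1, h2, h3⟩ := hgood I hI P hP
      obtain ⟨h4, -, -⟩ := hQ P h1 h2 h3
      exact ⟨h4.1, hne P h2 _ h4.2.2⟩
    · obtain ⟨P, hP, rfl⟩ := Multiset.mem_map.1 h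
      obtain ⟨h1, h2, h3⟩ := hgood J hJ P hP
      obtain ⟨-, h4, -⟩ := hQ P h1 h2 h3
      exact ⟨h4.1, hne P h2 _ h4.2.2⟩
  have hrec : ∀ I ∈ goodIdeals F T, ∀ J ∈ goodIdeals F T,
      ((normalizedFactors (f I J)).filter fun Q => Q = Q₀ (Q.comap i)).map (Ideal.comap i) =
        normalizedFactors I ∧
      ((normalizedFactors (f I J)).filter fun Q => ¬ Q = Q₀ (Q.comap i)).map (Ideal.comap i) =
        normalizedFactors J := by
    intro I hI J hJ
    have e0 : ∀ P ∈ normalizedFactors I, Q₀ P = Q₀ ((Q₀ P).comap i) := by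
      intro P hP
      obtain ⟨h1, h2, h3⟩ := hgood I hI P hP
      rw [(hQ P h1 h2 h3).1.2.1]
    have e1 : ∀ P ∈ normalizedFactors J, ¬ Q₁ P = Q₀ ((Q₁ P).comap i) := by
      intro P hP
      obtain ⟨h1, h2, h3⟩ := hgood J hJ P hP
      rw [(hQ P h1 h2 h3).2.1.2.1]
      exact (hQ P h1 h2 h3).2.2.symm
    rw [hnf I hI J hJ]
    simp only [Multiset.filter_add]
    have f1 : ((normalizedFactors I).map Q₀).filter (fun Q => Q = Q₀ (Q.comap i)) =
        (normalizedFactors I).map Q₀ := by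
      rw [Multiset.filter_eq_self]
      intro Q hQm
      obtain ⟨P, hP, rfl⟩ := Multiset.mem_map.1 hQm
      exact e0 P hP
    have f2 : ((normalizedFactors I).map Q₀).filter (fun Q => ¬ Q = Q₀ (Q.comap i)) = 0 := by
      rw [Multiset.filter_eq_nil]
      intro Q hQm
      obtain ⟨P, hP, rfl⟩ := Multiset.mem_map.1 hQm
      exact not_not.2 (e0 P hP)
    have f3 : ((normalizedFactors J).map Q₁).filter (fun Q => Q = Q₀ (Q.comap i)) = 0 := by
      rw [Multiset.filter_eq_nil]
      intro Q hQm
      obtain ⟨P, hP, rfl⟩ := Multiset.mem_map.1 hQm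
      exact e1 P hP
    have f4 : ((normalizedFactors J).map Q₁).filter (fun Q => ¬ Q = Q₀ (Q.comap i)) =
        (normalizedFactors J).map Q₁ := by
      rw [Multiset.filter_eq_self]
      intro Q hQm
      obtain ⟨P, hP, rfl⟩ := Multiset.mem_map.1 hQm
      exact e1 P hP
    rw [f1, f2, f3, f4, add_zero, zero_add, Multiset.map_map, Multiset.map_map]
    refine ⟨?_, ?_⟩
    · conv_rhs => rw [← Multiset.map_id (normalizedFactors I)]
      refine Multiset.map_congr rfl fun P hP => ?_
      obtain ⟨h1, h2, h3⟩ := hgood I hI P hP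
      exact (hQ P h1 h2 h3).1.2.1
    · conv_rhs => rw [← Multiset.map_id (normalizedFactors J)]
      refine Multiset.map_congr rfl fun P hP => ?_
      obtain ⟨h1, h2, h3⟩ := hgood J hJ P hP
      exact (hQ P h1 h2 h3).2.1.2.1
  refine no_pair_embedding hκ hlim (fun I hI => hI.1) f ?_ ?_
  · intro I hI J hJ I' hI' J' hJ' h
    obtain ⟨h1, h2⟩ := hrec I hI J hJ
    obtain ⟨h3, h4⟩ := hrec I' hI' J' hJ'
    rw [h] at h1 h2
    refine ⟨?_, ?_⟩
    · rw [← Ideal.prod_normalizedFactors_eq_self hI.1, ← Ideal.prod_normalizedFactors_eq_self hI'.1,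
        ← h1, ← h3]
    · rw [← Ideal.prod_normalizedFactors_eq_self hJ.1, ← Ideal.prod_normalizedFactors_eq_self hJ'.1,
        ← h2, ← h4]
  · intro I hI J hJ
    conv_rhs => rw [← Ideal.prod_normalizedFactors_eq_self hI.1,
      ← Ideal.prod_normalizedFactors_eq_self hJ.1]
    rw [absNorm_prod, absNorm_prod, absNorm_prod, Multiset.map_add, Multiset.prod_add,
      Multiset.map_map, Multiset.map_map]
    congr 2
    · refine Multiset.map_congr rfl fun P hP => ?_
      obtain ⟨h1, h2, h3⟩ := hgood I hI P hP
      exact (hQ P h1 h2 h3).1.2.2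
    · refine Multiset.map_congr rfl fun P hP => ?_
      obtain ⟨h1, h2, h3⟩ := hgood J hJ P hP
      exact (hQ P h1 h2 h3).2.1.2.2

end

section

open UniqueFactorizationMonoid Filter Topology Polynomial

section Kummer

variable {F M : Type*} [Field F] [NumberField F] [Field M] [NumberField M] [Algebra F M]

/-- The integers of `M` have a common denominator with respect to `𝓞 F[θ]`. -/
lemma exists_denominator {θ : 𝓞 M} (htop : Algebra.adjoin F {(θ : M)} = ⊤) :
    ∃ n : ℕ, n ≠ 0 ∧ ∀ z : 𝓞 M, ∃ p : (𝓞 F)[X], (n : 𝓞 M) * z = aeval θ p := by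
  have h1 : ∀ z : M, ∃ n : ℕ, n ≠ 0 ∧ ∃ p : (𝓞 F)[X],
      (n : M) * z = algebraMap (𝓞 M) M (aeval θ p) := by
    intro z
    have hz : z ∈ Algebra.adjoin F {(θ : M)} := by rw [htop]; trivial
    induction hz using Algebra.adjoin_induction with
    | mem x hx =>
      obtain rfl := hx
      exact ⟨1, one_ne_zero, X, by simp⟩
    | algebraMap r =>
      obtain ⟨k, hk, hi⟩ := ((IsFractionRing.isAlgebraic_iff ℤ ℚ F).2
        (Algebra.IsAlgebraic.isAlgebraic r)).exists_integral_multiple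
      have hi' : IsIntegral ℤ (k.natAbs • r) := by
        rcases Int.natAbs_eq k with h | h
        · rw [h] at hi; simpa using hi
        · rw [h, neg_smul] at hi; simpa using hi.neg
      obtain ⟨w, hw⟩ := IsIntegralClosure.isIntegral_iff (A := 𝓞 F) |>.1 hi'
      refine ⟨k.natAbs, Int.natAbs_ne_zero.2 hk, C w, ?_⟩
      rw [aeval_C, ← IsScalarTower.algebraMap_apply, IsScalarTower.algebraMap_apply (𝓞 F) F M, hw]
      simp
    | add x y _ _ hx hy =>
      obtain ⟨n, hn, p, hp⟩ := hx
      obtain ⟨n', hn', p', hp'⟩ := hy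
      refine ⟨n * n', mul_ne_zero hn hn', (n' : (𝓞 F)[X]) * p + (n : (𝓞 F)[X]) * p', ?_⟩
      simp only [map_add, map_mul, map_natCast, Nat.cast_mul]
      rw [← hp, ← hp']; ring
    | mul x y _ _ hx hy =>
      obtain ⟨n, hn, p, hp⟩ := hx
      obtain ⟨n', hn', p', hp'⟩ := hy
      refine ⟨n * n', mul_ne_zero hn hn', p * p', ?_⟩
      simp only [map_mul, Nat.cast_mul]
      rw [← hp, ← hp']; ring
  choose N hN p hp using fun j => h1 (algebraMap (𝓞 M) M (RingOfIntegers.basis M j))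
  have hp' : ∀ j, (N j : 𝓞 M) * RingOfIntegers.basis M j = aeval θ (p j) := by
    intro j
    apply RingOfIntegers.coe_injective
    rw [map_mul, map_natCast]
    exact hp j
  classical
  refine ⟨∏ j, N j, Finset.prod_ne_zero_iff.2 fun j _ => hN j, fun z => ?_⟩
  refine ⟨∑ j, (((∏ l ∈ Finset.univ.erase j, N l : ℕ) : ℤ) *
    (RingOfIntegers.basis M).repr z j : ℤ) * p j, ?_⟩
  conv_lhs => rw [← (RingOfIntegers.basis M).sum_repr z]
  rw [Finset.mul_sum, map_sum]
  refine Finset.sum_congr rfl fun j hj => ?_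
  rw [map_mul, ← hp', ← Finset.mul_prod_erase _ _ hj, map_intCast, zsmul_eq_mul]
  push_cast
  ring

/-- At a prime `Q` containing `θ - c`, not dividing the denominator, the residue degree is one. -/
lemma absNorm_eq_of_root {θ : 𝓞 M} {n : ℕ}
    (hn : ∀ z : 𝓞 M, ∃ p : (𝓞 F)[X], (n : 𝓞 M) * z = aeval θ p)
    {Q : Ideal (𝓞 M)} [hQ : Q.IsPrime] {P : Ideal (𝓞 F)}
    (hP : Q.comap (algebraMap (𝓞 F) (𝓞 M)) = P) (hnP : (n : 𝓞 F) ∉ P) {c : 𝓞 F}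
    (hc : θ - algebraMap _ _ c ∈ Q) (hP0 : P ≠ ⊥) :
    Ideal.absNorm Q = Ideal.absNorm P := by
  have hPp : P.IsPrime := by rw [← hP]; infer_instance
  have hPm : P.IsMaximal := hPp.isMaximal hP0
  let φ : 𝓞 F ⧸ P →+* 𝓞 M ⧸ Q := Ideal.quotientMap Q (algebraMap (𝓞 F) (𝓞 M)) hP.ge
  have hinj : Function.Injective φ := Ideal.quotientMap_injective' hP.le
  obtain ⟨u, hu⟩ : ∃ u : 𝓞 F, 1 - u * n ∈ P := by
    let _ := Ideal.Quotient.field P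
    have h0 : Ideal.Quotient.mk P (n : 𝓞 F) ≠ 0 := by
      rwa [Ne, Ideal.Quotient.eq_zero_iff_mem]
    obtain ⟨u, hu⟩ := Ideal.Quotient.mk_surjective (Ideal.Quotient.mk P (n : 𝓞 F))⁻¹
    refine ⟨u, ?_⟩
    rw [← Ideal.Quotient.eq_zero_iff_mem, map_sub, map_one, map_mul, hu, inv_mul_cancel₀ h0,
      sub_self]
  have hsurj : Function.Surjective φ := by
    intro w
    obtain ⟨z, rfl⟩ := Ideal.Quotient.mk_surjective w
    obtain ⟨p, hp⟩ := hn z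
    refine ⟨Ideal.Quotient.mk P (u * p.eval c), ?_⟩
    show Ideal.Quotient.mk Q (algebraMap _ _ (u * p.eval c)) = _
    rw [Ideal.Quotient.eq]
    have h1 : algebraMap (𝓞 F) (𝓞 M) (1 - u * n) ∈ Q := by
      rw [← hP] at hu; exact hu
    have h2 : aeval θ p - algebraMap (𝓞 F) (𝓞 M) (p.eval c) ∈ Q := by
      rw [← Ideal.Quotient.eq_zero_iff_mem, map_sub, sub_eq_zero]
      rw [← Ideal.Quotient.eq_zero_iff_mem, map_sub, sub_eq_zero] at hc
      rw [aeval_def, hom_eval₂, hc, ← hom_eval₂ _ _ _ _, eval₂_at_apply]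
    rw [← hp] at h2
    rw [map_sub, map_one, map_mul, map_natCast] at h1
    have : algebraMap (𝓞 F) (𝓞 M) (u * p.eval c) - z =
      -(z * (1 - algebraMap (𝓞 F) (𝓞 M) u * (n : 𝓞 M))) - algebraMap (𝓞 F) (𝓞 M) u *
        ((n : 𝓞 M) * z - algebraMap (𝓞 F) (𝓞 M) (p.eval c)) := by
      rw [map_mul]; ring
    rw [this]
    exact Q.sub_mem (Q.neg_mem (Q.mul_mem_left _ h1)) (Q.mul_mem_left _ h2)
  rw [Ideal.absNorm_apply, Ideal.absNorm_apply, Submodule.cardQuot_apply, Submodule.cardQuot_apply]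
  exact (Nat.card_congr (Equiv.ofBijective φ ⟨hinj, hsurj⟩)).symm

end Kummer

end

section

open UniqueFactorizationMonoid Filter Topology Polynomial

/-- In a Kummer extension of degree three, almost all primes cannot all split. -/
lemma kummer_not_split {F M : Type*} [Field F] [NumberField F] [Field M] [NumberField M]
    [Algebra F M] {ζ α m : 𝓞 F} (hζ : ζ ^ 2 + ζ + 1 = 0) (hα : α ≠ 0) (hm : m ≠ 0) {θ : 𝓞 M}
    (htop : Algebra.adjoin F {(θ : M)} = ⊤) (hθ : θ ^ 3 = algebraMap _ _ α) (σ : 𝓞 M →+* 𝓞 M)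
    (hσ : σ θ = algebraMap _ _ ζ * θ) (hσF : ∀ x, σ (algebraMap (𝓞 F) _ x) = algebraMap _ _ x)
    (H : ∀ P : Ideal (𝓞 F), P.IsPrime → P ≠ ⊥ → m ∉ P → ∃ c, α - c ^ 3 ∈ P) : False := by
  obtain ⟨n, hn0, hn⟩ := exists_denominator htop
  have hζ' : (algebraMap (𝓞 F) (𝓞 M) ζ) ^ 2 + algebraMap _ _ ζ + 1 = 0 := by
    rw [← map_pow, ← map_add, ← map_one (algebraMap (𝓞 F) (𝓞 M)), ← map_add, hζ, map_zero]
  have key : ∀ P : Ideal (𝓞 F), P.IsPrime → P ≠ ⊥ → m ∉ P → ∃ Q : Ideal (𝓞 M), ∃ c : 𝓞 F,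
      Q.IsPrime ∧ Q.comap (algebraMap (𝓞 F) (𝓞 M)) = P ∧ θ - algebraMap _ _ c ∈ Q := by
    intro P hP hP0 hmP
    obtain ⟨c, hc⟩ := H P hP hP0 hmP
    obtain ⟨Q, -, hQ, hQP⟩ := Ideal.exists_ideal_over_prime_of_isIntegral P (⊥ : Ideal (𝓞 M))
      (by
        rw [← RingHom.ker_eq_comap_bot, (RingHom.injective_iff_ker_eq_bot _).1
          (FaithfulSMul.algebraMap_injective (𝓞 F) (𝓞 M))]
        exact bot_le)
    have h1 : (θ - algebraMap _ _ c) * ((θ - algebraMap _ _ (ζ * c)) *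
        (θ - algebraMap _ _ (ζ ^ 2 * c))) ∈ Q := by
      have : (θ - algebraMap _ _ c) * ((θ - algebraMap _ _ (ζ * c)) *
          (θ - algebraMap _ _ (ζ ^ 2 * c))) = algebraMap (𝓞 F) (𝓞 M) (α - c ^ 3) := by
        simp only [map_sub, map_mul, map_pow]
        rw [← hθ]
        generalize algebraMap (𝓞 F) (𝓞 M) ζ = z at hζ'
        generalize algebraMap (𝓞 F) (𝓞 M) c = c'
        linear_combination (c' * z * θ * c' + z * c' ^ 2 * θ * (z - 1) - z * c' ^ 2 * θ * z
          - c' ^ 3 * (z - 1) - θ ^ 2 * c' + c' ^ 2 * θ * z) * hζ'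
      rw [this]
      rw [← hQP] at hc
      exact hc
    rcases hQ.mem_or_mem h1 with h | h
    · exact ⟨Q, _, hQ, hQP, h⟩
    rcases hQ.mem_or_mem h with h | h
    · exact ⟨Q, _, hQ, hQP, h⟩
    · exact ⟨Q, _, hQ, hQP, h⟩
  choose! Q c hQ1 hQ2 hQ3 using key
  have h3 : (3 : 𝓞 F) ≠ 0 := by
    exact_mod_cast (Nat.cast_ne_zero (R := 𝓞 F)).2 (by norm_num : (3 : ℕ) ≠ 0)
  refine no_two_primes (algebraMap (𝓞 F) (𝓞 M)) (b := m * (3 * (α * n)))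
    (mul_ne_zero hm (mul_ne_zero h3 (mul_ne_zero hα (Nat.cast_ne_zero.2 hn0)))) Q
    (fun P => (Q P).comap σ) fun P hP hP0 hb => ?_
  have hmP : m ∉ P := fun h => hb (P.mul_mem_right _ h)
  have h3P : 3 ∉ P := fun h => hb (P.mul_mem_left _ (P.mul_mem_right _ h))
  have hαP : α ∉ P := fun h => hb (P.mul_mem_left _ (P.mul_mem_left _ (P.mul_mem_right _ h)))
  have hnP : (n : 𝓞 F) ∉ P := fun h => hb (P.mul_mem_left _ (P.mul_mem_left _ (P.mul_mem_left _ h)))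
  have g1 := hQ1 P hP hP0 hmP
  have g2 := hQ2 P hP hP0 hmP
  have g3 := hQ3 P hP hP0 hmP
  have hmem : ∀ x, x ∈ P ↔ algebraMap (𝓞 F) (𝓞 M) x ∈ Q P := fun x => by
    conv_lhs => rw [← g2]
    rfl
  have c1 : ((Q P).comap σ).comap (algebraMap (𝓞 F) (𝓞 M)) = P := by
    rw [Ideal.comap_comap, show σ.comp (algebraMap (𝓞 F) (𝓞 M)) = algebraMap (𝓞 F) (𝓞 M) from
      RingHom.ext hσF, g2]
  have c2 : θ - algebraMap _ _ (ζ * c P) ∈ (Q P).comap σ := by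
    rw [Ideal.mem_comap, map_sub, hσ, hσF, map_mul, ← mul_sub]
    exact (Q P).mul_mem_left _ g3
  have hQ' : ((Q P).comap σ).IsPrime := inferInstance
  refine ⟨⟨g1, g2, absNorm_eq_of_root hn g2 hnP g3 hP0⟩,
    ⟨hQ', c1, absNorm_eq_of_root hn c1 hnP c2 hP0⟩, fun h => ?_⟩
  rw [← h] at c2
  have h4 := (Q P).sub_mem c2 g3
  rw [sub_sub_sub_cancel_left, ← map_sub] at h4
  have h5 : c P - ζ * c P ∈ P := by
    exact (hmem _).2 h4
  have h6 : 3 * c P ∈ P := by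
    have : 3 * c P = (1 - ζ ^ 2) * (c P - ζ * c P) := by
      linear_combination (c P * (2 - ζ)) * hζ
    rw [this]; exact P.mul_mem_left _ h5
  rcases hP.mem_or_mem h6 with h6 | h6
  · exact h3P h6
  apply hαP
  rw [hmem] at h6 ⊢
  have h7 : θ ∈ Q P := by
    have := (Q P).add_mem g3 h6
    rwa [sub_add_cancel] at this
  rw [← hθ]
  exact (Q P).pow_mem_of_mem h7 3 (by norm_num)

/-- An integer which is not a cube is a noncube modulo infinitely many primes. -/
theorem exists_prime_noncube {F : Type*} [Field F] [NumberField F] {ζ α m : 𝓞 F}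
    (hζ : ζ ^ 2 + ζ + 1 = 0) (hα : ∀ γ : F, γ ^ 3 ≠ α) (hm : m ≠ 0) :
    ∃ P : Ideal (𝓞 F), P.IsPrime ∧ P ≠ ⊥ ∧ m ∉ P ∧ ∀ c, α - c ^ 3 ∉ P := by
  by_contra! H
  let f : F[X] := X ^ 3 - C (α : F)
  have hirr : Irreducible f := X_pow_sub_C_irreducible_of_prime Nat.prime_three hα
  have : Fact (Irreducible f) := ⟨hirr⟩
  have hf : f ≠ 0 := hirr.ne_zero
  let M := AdjoinRoot f
  have : CharZero M := charZero_of_injective_algebraMap (algebraMap F M).injective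
  have : FiniteDimensional F M := (AdjoinRoot.powerBasis hf).finite
  have : FiniteDimensional ℚ M := Module.Finite.trans F M
  have : NumberField M := ⟨⟩
  have hroot : (AdjoinRoot.root f) ^ 3 = algebraMap F M α := by
    have := AdjoinRoot.eval₂_root f
    rw [show f = X ^ 3 - C (α : F) from rfl] at this
    simp only [eval₂_sub, eval₂_X_pow, eval₂_C] at this
    exact sub_eq_zero.1 this
  have hInt : IsIntegral ℤ (AdjoinRoot.root f : M) := by
    refine IsIntegral.of_pow (n := 3) (by norm_num) ?_
    rw [hroot]
    exact α.isIntegral_coe.algebraMap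
  obtain ⟨θ, hθ⟩ := IsIntegralClosure.isIntegral_iff (A := 𝓞 M) |>.1 hInt
  let σ : M →ₐ[F] M := AdjoinRoot.liftAlgHom f (Algebra.ofId F M)
    (algebraMap F M ζ * AdjoinRoot.root f) (by
      have h1 : (ζ : F) ^ 3 = 1 := by
        have : ζ ^ 3 = 1 := by linear_combination (ζ - 1) * hζ
        rw [← map_pow, this, map_one]
      show eval₂ _ _ (X ^ 3 - C (α : F)) = 0
      rw [eval₂_sub, eval₂_X_pow, eval₂_C, mul_pow, hroot, ← map_pow, h1, map_one, one_mul]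
      exact sub_self _)
  have htop : Algebra.adjoin F {(θ : M)} = ⊤ := by
    have h : (θ : M) = AdjoinRoot.root f := hθ
    rw [h]; exact AdjoinRoot.adjoinRoot_eq_top
  have hα0 : α ≠ 0 := by
    rintro rfl
    exact hα 0 (by simp)
  refine kummer_not_split hζ hα0 hm htop (θ := θ) ?_ (RingOfIntegers.mapRingHom (σ : M →+* M))
    ?_ ?_ H
  · apply RingOfIntegers.coe_injective
    rw [map_pow, hθ, hroot]; rfl
  · apply RingOfIntegers.coe_injective
    rw [map_mul, hθ]
    change σ (θ : M) = _
    rw [show (θ : M) = AdjoinRoot.root f from hθ]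
    exact AdjoinRoot.liftAlgHom_root _ _ _ _
  · intro x
    apply RingOfIntegers.coe_injective
    exact σ.commutes (x : F)

end

section

variable {q : ℕ} [Fact q.Prime]

lemma exists_int_of_pow_eq {b : Kap q} (hb : b ^ q = b) : ∃ u : ℤ, b = u := by
  have := (Subfield.mem_bot_iff_pow_eq_self (Kap q) q).2 hb
  obtain ⟨u, hu⟩ := (mem_bot_iff_intCast q (Kap q)).1 this
  exact ⟨u, hu.symm⟩

/-- The field with `q²` elements is generated by any of its elements outside the prime field. -/
lemma exists_int_add_int_mul {b s : Kap q} (hs : s ^ q ≠ s) (hs2 : (s ^ q) ^ q = s)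
    (hb2 : (b ^ q) ^ q = b) : ∃ u v : ℤ, b = u + v * s := by
  have h0 : s - s ^ q ≠ 0 := sub_ne_zero.2 hs.symm
  have hv : ((b - b ^ q) / (s - s ^ q)) ^ q = (b - b ^ q) / (s - s ^ q) := by
    rw [div_pow, sub_pow_char, sub_pow_char, hs2, hb2, ← neg_sub b, ← neg_sub s, neg_div_neg_eq]
  obtain ⟨v, hv'⟩ := exists_int_of_pow_eq hv
  rw [div_eq_iff h0] at hv'
  have hu : (b - v * s) ^ q = b - v * s := by
    rw [sub_pow_char, mul_pow, intCast_pow_q]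
    linear_combination -hv'
  obtain ⟨u, hu'⟩ := exists_int_of_pow_eq hu
  exact ⟨u, v, by rw [← hu']; ring⟩

/-- The square root of `-3` in characteristic `q`. -/
lemma sqrt_neg_three : (2 * om q + 1) ^ 2 = (-3 : Kap q) := by
  linear_combination 4 * om_sq q

lemma rho_rt (A B : ℤ) : rho q (rt A B) = A + B * (2 * om q + 1) := by
  rw [rho_apply]; simp only [rt]; push_cast; ring

lemma rho_star_rt (A B : ℤ) : rho q (star (rt A B)) = A - B * (2 * om q + 1) := by
  rw [star_rt, rho_rt]; push_cast; ring

lemma pow_q_cases {s : Kap q} {D : ℤ} (hs : s ^ 2 = D) : s ^ q = s ∨ s ^ q = -s := by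
  rw [← sq_eq_sq_iff_eq_or_eq_neg, ← pow_mul, mul_comm, pow_mul, hs, intCast_pow_q]

end

/-- A noncube stays a noncube in the residue fields of infinitely many primes. -/
lemma exists_hom_noncube {F : Type*} [Field F] [NumberField F] {ζ α : 𝓞 F}
    (hζ : ζ ^ 2 + ζ + 1 = 0) (hα : ∀ γ : F, γ ^ 3 ≠ α) {m : ℤ} (hm : m ≠ 0) :
    ∃ (q : ℕ) (_ : Fact q.Prime) (ψ : 𝓞 F →+* Kap q), ¬ (q : ℤ) ∣ m ∧ ∀ c, ψ c ^ 3 ≠ ψ α := by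
  obtain ⟨P, hP, hP0, hmP, hc⟩ := exists_prime_noncube hζ hα (m := (m : 𝓞 F)) (by exact_mod_cast hm)
  have hmax : P.IsMaximal := hP.isMaximal hP0
  let _ := Ideal.Quotient.field P
  have _ := P.finiteQuotientOfFreeOfNeBot hP0
  obtain ⟨q, _⟩ := CharP.exists (𝓞 F ⧸ P)
  have hqp : q.Prime := (CharP.char_is_prime_or_zero (𝓞 F ⧸ P) q).resolve_right
    (CharP.char_ne_zero_of_finite (𝓞 F ⧸ P) q)
  have hF : Fact q.Prime := ⟨hqp⟩
  let _ : Algebra (ZMod q) (𝓞 F ⧸ P) := ZMod.algebra _ q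
  let j : (𝓞 F ⧸ P) →ₐ[ZMod q] Kap q := IsAlgClosed.lift
  refine ⟨q, hF, (j : (𝓞 F ⧸ P) →+* Kap q).comp (Ideal.Quotient.mk P),
    fun h => hmP ?_, fun c h => ?_⟩
  · rw [← Ideal.Quotient.eq_zero_iff_mem, map_intCast]
    exact (CharP.intCast_eq_zero_iff _ q m).2 h
  · apply hc c
    have h1 : j (Ideal.Quotient.mk P (c ^ 3)) = j (Ideal.Quotient.mk P α) := by
      rw [map_pow, map_pow]; exact h
    have h2 := (RingHom.injective (j : (𝓞 F ⧸ P) →+* Kap q)) h1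
    rw [← Ideal.Quotient.eq_zero_iff_mem, map_sub, h2, sub_self]

/-- Adjoining a cube root of unity does not create new cubes. -/
lemma exists_adjoin_omega (K : Type*) [Field K] [NumberField K] {x : 𝓞 K}
    (hx : ∀ γ : K, γ ^ 3 ≠ x) {m : ℤ} (hm : m ≠ 0) :
    ∃ (q : ℕ) (_ : Fact q.Prime) (ψ : 𝓞 K →+* Kap q) (R : Subring (Kap q)), ¬ (q : ℤ) ∣ m ∧
      om q ∈ R ∧ (∀ z, ψ z ∈ R) ∧ ∀ b ∈ R, b ^ 3 ≠ ψ x := by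
  let F := CyclotomicField 3 K
  have hζ := IsCyclotomicExtension.zeta_spec 3 K F
  set z := IsCyclotomicExtension.zeta 3 K F
  have hz0 : z ^ 2 + z + 1 = 0 := by
    have h1 : z ≠ 1 := hζ.ne_one (by norm_num)
    have h2 := hζ.pow_eq_one
    have h3 : (z - 1) * (z ^ 2 + z + 1) = 0 := by linear_combination h2
    exact (mul_eq_zero.1 h3).resolve_left (sub_ne_zero.2 h1)
  have hdim : finrank K F ≤ 2 := by
    rw [(hζ.powerBasis K).finrank, IsPrimitiveRoot.powerBasis_dim]
    have hd : minpoly K z ∣ Polynomial.X ^ 2 + Polynomial.X + 1 := minpoly.dvd _ _ (by simpa using hz0)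
    have hdeg : (Polynomial.X ^ 2 + Polynomial.X + 1 : Polynomial K).natDegree = 2 := by
      compute_degree!
    rw [← hdeg]
    exact Polynomial.natDegree_le_of_dvd hd (fun h => by rw [h] at hdeg; simp at hdeg)
  have hdim0 : 0 < finrank K F := finrank_pos
  have hxF : ∀ γ : F, γ ^ 3 ≠ algebraMap K F x := by
    intro γ hγ
    have h1 := congrArg (Algebra.norm K) hγ
    rw [map_pow, Algebra.norm_algebraMap] at h1
    obtain h | h : finrank K F = 1 ∨ finrank K F = 2 := by omega
    · rw [h, pow_one] at h1
      exact hx _ h1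
    · rw [h] at h1
      rcases eq_or_ne (x : K) 0 with h0 | h0
      · exact hx 0 (by rw [h0]; simp)
      have hg : (Algebra.norm K) γ ≠ 0 := by
        intro hg; rw [hg] at h1
        exact h0 (pow_eq_zero_iff two_ne_zero |>.1 (by rw [← h1]; simp))
      apply hx (x / (Algebra.norm K) γ)
      rw [div_pow, h1]
      field_simp
  obtain ⟨ζ, hζ'⟩ := IsIntegralClosure.isIntegral_iff (A := 𝓞 F) |>.1
    (hζ.isIntegral (by norm_num))
  have hζ0 : ζ ^ 2 + ζ + 1 = 0 := by
    apply RingOfIntegers.coe_injective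
    simp only [map_add, map_pow, map_one, map_zero, hζ']
    exact hz0
  obtain ⟨q, hq, ψ, hqm, hψ⟩ := exists_hom_noncube (α := algebraMap (𝓞 K) (𝓞 F) x) hζ0
    (fun γ h => hxF γ h) hm
  refine ⟨q, hq, ψ.comp (algebraMap (𝓞 K) (𝓞 F)), ψ.range, hqm, ?_, fun z => ⟨_, rfl⟩, ?_⟩
  · have h1 : ψ ζ ^ 2 + ψ ζ + 1 = 0 := by
      rw [← map_pow, ← map_add, ← map_one ψ, ← map_add, hζ0, map_zero]
    have h2 : (ψ ζ - om q) * (ψ ζ - om q ^ 2) = 0 := by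
      linear_combination h1 + (- ψ ζ + om q - 1) * om_sq q
    rcases mul_eq_zero.1 h2 with h | h
    · exact ⟨ζ, sub_eq_zero.1 h⟩
    · refine ⟨ζ ^ 2, ?_⟩
      rw [map_pow, sub_eq_zero.1 h]
      linear_combination om q * om_cube q
  · rintro b ⟨c, rfl⟩
    exact hψ c

section

open UniqueFactorizationMonoid

namespace QF

variable {K : Type*} [Field K] [NumberField K] {D : ℤ} (S : QF K D)

/-- A square root of `D` modulo `q` gives a prime ideal of norm `q`. -/
lemma exists_prime_of_sqrt {q : ℕ} (hq : q.Prime) (hq2 : q ≠ 2) {h : ℤ} (hh : (q : ℤ) ∣ h ^ 2 - D) :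
    ∃ p : Ideal (𝓞 K), p.IsPrime ∧ p ≠ ⊥ ∧ Ideal.absNorm p = q ∧ S.δ - h ∈ p := by
  have h1 : q ∣ Ideal.absNorm (Ideal.span {((-h : ℤ) : 𝓞 K) + (1 : ℤ) * S.δ}) := by
    rw [S.absNorm_prim, ← Int.natCast_dvd]
    convert hh using 1; ring
  obtain ⟨p, hp, hle, hqp⟩ := exists_prime_ideal_of_dvd_absNorm hq h1
  have hδ : S.δ - h ∈ p := by
    have := hle (Ideal.mem_span_singleton_self _)
    convert this using 1; push_cast; ring
  have hq0 : (q : 𝓞 K) ≠ 0 := by exact_mod_cast hq.ne_zero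
  have hp0 : p ≠ ⊥ := by
    rintro rfl; exact hq0 (by simpa using hqp)
  have h2 : (2 : 𝓞 K) ∉ p := by
    intro h2
    exact one_mem_of_coprime (Nat.isCoprime_iff_coprime.2 ((Nat.coprime_primes hq Nat.prime_two).2 hq2))
      (by exact_mod_cast hqp) (by exact_mod_cast h2)
  have hprime := absNorm_prime_of_int hp0 (S.exists_int_sub_mem h2 hp0 hδ)
  refine ⟨p, hp, hp0, ?_, hδ⟩
  have := dvd_of_mem rfl hprime (n := q) (by exact_mod_cast hqp)
  exact (Nat.prime_dvd_prime_iff_eq hprime hq).1 (by exact_mod_cast this)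

end QF

/-- The computation in residue fields behind the nondegeneracy of the symbols: here `X`, `Y` are
conjugate elements of a quadratic field, with product a cube. -/
lemma residue_core {q : ℕ} [hF : Fact q.Prime] (h3 : q ≠ 3) {s X Y η c c' : Kap q} {U V n D' D : ℤ}
    (h2 : (2 : Kap q) ≠ 0) (hX : 2 * X = U + V * s) (hY : 2 * Y = U - V * s) (hn : X * Y = n ^ 3)
    (hX0 : X ≠ 0) (hY0 : Y ≠ 0) (hs : s ^ 2 = D') (hs0 : s ≠ 0) (hη : η ^ 2 = D)
    (hc0 : c ≠ 0) (hc : c ^ q = c) (hc' : c' ^ q = c')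
    (hcs : c * s = c' * (2 * om q + 1) * η) {R : Subring (Kap q)} (hR : om q ∈ R) (hsR : s ∈ R)
    (hXR : X ∈ R) (hcube : ∀ b ∈ R, b ^ 3 ≠ X) :
    (∃ h : ℤ, η = h) ∧ (q % 3 = 1 → (X / Y) ^ ((q - 1) / 3) ≠ 1) ∧
      (q % 3 = 2 → (Y / X) ^ ((q + 1) / 3) ≠ 1) := by
  have hq2 : 2 ≤ q := hF.out.two_le
  have hn0 : (n : Kap q) ≠ 0 := by
    intro h; rw [h] at hn; simp [hX0, hY0] at hn
  have hnq : (n : Kap q) ^ (q - 1) = 1 := by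
    apply mul_right_cancel₀ hn0
    rw [← pow_succ, Nat.sub_add_cancel (by omega), intCast_pow_q, one_mul]
  have h2q : (2 : Kap q) ^ q = 2 := by exact_mod_cast intCast_pow_q q 2
  have hXq : 2 * X ^ q = U + V * s ^ q := by
    have := congrArg (· ^ q) hX
    simp only [mul_pow, add_pow_char, intCast_pow_q, h2q] at this
    exact this
  have hXq_same : s ^ q = s → X ^ q = X := fun h => by
    apply mul_left_cancel₀ h2; rw [hXq, h, hX]
  have hXq_opp : s ^ q = -s → X ^ q = Y := fun h => by
    apply mul_left_cancel₀ h2; rw [hXq, h, hY]; ring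
  have hs2 : (s ^ q) ^ q = s := by
    rcases pow_q_cases hs with h | h
    · rw [h, h]
    · have h5 : (0 - s) ^ q = 0 ^ q - s ^ q := sub_pow_char ..
      rw [zero_pow (by omega), zero_sub, zero_sub] at h5
      rw [h, h5, h, neg_neg]
  have hInt : ∀ b : Kap q, b ^ q = b → b ∈ R := fun b hb => by
    obtain ⟨u, rfl⟩ := exists_int_of_pow_eq hb
    exact intCast_mem R u
  obtain ⟨b, hb⟩ : ∃ b : Kap q, b ^ 3 = X := IsAlgClosed.exists_pow_nat_eq X (by norm_num)
  have hb0 : b ≠ 0 := by rintro rfl; apply hX0; rw [← hb]; simp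
  have key : (c * s ^ q) = c' * (2 * om q ^ q + 1) * η ^ q := by
    have := congrArg (· ^ q) hcs
    simp only [mul_pow, add_pow_char, h2q, one_pow, hc, hc'] at this
    exact this
  rcases prime_mod_three q h3 with hm | hm
  · rw [om_pow_one q hm] at key
    rcases pow_q_cases hη with h | h
    · have hss : s ^ q = s := by
        apply mul_left_cancel₀ hc0; rw [key, h, hcs]
      refine ⟨exists_int_of_pow_eq h, fun _ hw => ?_, fun h => by omega⟩
      obtain ⟨k, hk⟩ : ∃ k, q = 3 * k + 1 := ⟨q / 3, by omega⟩
      rw [show (q - 1) / 3 = k by omega] at hw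
      have hnk : (n : Kap q) ^ (3 * k) = 1 := by rw [← hnq]; congr 1; omega
      have hXk : X ^ (3 * k) = 1 := by
        apply mul_right_cancel₀ hX0
        rw [← pow_succ, ← hk, hXq_same hss, one_mul]
      have h4 : X / Y = X ^ 2 / n ^ 3 := by
        rw [← hn]; field_simp
      rw [h4, div_pow, ← pow_mul, ← pow_mul, hnk, div_one] at hw
      have hXk1 : X ^ k = 1 := by
        have : X ^ (2 * k) * X ^ k = 1 := by rw [← pow_add, ← hXk]; congr 1; ring
        rwa [hw, one_mul] at this
      refine hcube b (hInt b ?_) hb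
      have h6 : b ^ q = (b ^ 3) ^ k * b := by
        rw [← pow_mul, ← pow_succ]; exact congrArg (b ^ ·) hk
      rw [h6, hb, hXk1, one_mul]
    · exfalso
      have hss : s ^ q = -s := by
        apply mul_left_cancel₀ hc0; rw [key, h, mul_neg, mul_neg, hcs]
      have hXX : X ^ (q + 1) = n ^ 3 := by rw [pow_succ, hXq_opp hss, mul_comm, hn]
      have hb3 : (b ^ (q + 1) / n) ^ 3 = 1 := by
        rw [div_pow, ← pow_mul, mul_comm, pow_mul, hb, hXX, div_self (pow_ne_zero _ hn0)]
      have hbq : (b ^ (q + 1)) ^ q = b ^ (q + 1) := by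
        have h5 : (b ^ (q + 1) / n) ^ q = b ^ (q + 1) / n := by
          rcases cube_root_cases q hb3 with h | h | h
          · rw [h, one_pow]
          · rw [h, om_pow_one q hm]
          · rw [h, ← pow_mul, mul_comm, pow_mul, om_pow_one q hm]
        rw [div_pow, intCast_pow_q] at h5
        exact (div_left_inj' hn0).1 h5
      have hbb : (b ^ q) ^ q = b := by
        have h6 : (b ^ q) ^ q * b ^ q = b * b ^ q := by
          rw [← pow_succ', ← hbq]; ring
        exact mul_right_cancel₀ (pow_ne_zero _ hb0) h6
      have hne : s ^ q ≠ s := by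
        rw [hss]; intro h
        have : 2 * s = 0 := by linear_combination -h
        exact (mul_ne_zero h2 hs0) this
      obtain ⟨u, v, huv⟩ := exists_int_add_int_mul hne hs2 hbb
      refine hcube b ?_ hb
      rw [huv]
      exact R.add_mem (intCast_mem R u) (R.mul_mem (intCast_mem R v) hsR)
  · have hom : 2 * om q ^ q + 1 = -(2 * om q + 1) := by
      rw [om_pow_two q hm]; linear_combination 2 * om_sq q
    rw [hom] at key
    rcases pow_q_cases hη with h | h
    · have hss : s ^ q = -s := by
        apply mul_left_cancel₀ hc0; rw [key, h]; linear_combination hcs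
      refine ⟨exists_int_of_pow_eq h, fun h => by omega, fun _ hw => ?_⟩
      obtain ⟨k, hk⟩ : ∃ k, q + 1 = 3 * k := ⟨(q + 1) / 3, by omega⟩
      rw [show (q + 1) / 3 = k by omega, div_pow, div_eq_one_iff_eq (pow_ne_zero _ hX0),
        ← hXq_opp hss] at hw
      have hbb : (b ^ q) ^ q = b := by
        have h6 : ((b ^ q) ^ q) * b ^ q = b * b ^ q := by
          rw [← pow_succ, ← pow_succ', hk, ← pow_mul, pow_mul', pow_mul, hb]
          rw [← pow_mul, mul_comm, pow_mul, hw]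
        exact mul_right_cancel₀ (pow_ne_zero _ hb0) h6
      have hne : om q ^ q ≠ om q := by
        rw [om_pow_two q hm]; exact om_sq_ne_om q h3
      have hom2 : (om q ^ q) ^ q = om q := by
        rw [om_pow_two q hm, ← pow_mul, mul_comm, pow_mul, om_pow_two q hm]
        linear_combination om q * om_cube q
      obtain ⟨u, v, huv⟩ := exists_int_add_int_mul hne hom2 hbb
      refine hcube b ?_ hb
      rw [huv]
      exact R.add_mem (intCast_mem R u) (R.mul_mem (intCast_mem R v) hR)
    · exfalso
      have hss : s ^ q = s := by
        apply mul_left_cancel₀ hc0; rw [key, h, hcs]; ring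
      have hXX := hXq_same hss
      have hX1 : X ^ (q - 1) = 1 := by
        apply mul_right_cancel₀ hX0
        rw [← pow_succ, Nat.sub_add_cancel (by omega), hXX, one_mul]
      obtain ⟨k, hk⟩ : ∃ k, q - 1 + q = 3 * k := ⟨(2 * q - 1) / 3, by omega⟩
      refine hcube (X ^ k) (R.pow_mem hXR k) ?_
      rw [← pow_mul, mul_comm, ← hk, pow_add, hX1, hXX, one_mul]

end

namespace QF

lemma UV_conj {K : Type*} [Field K] [NumberField K] {D : ℤ} (S : QF K D) (x : 𝓞 K) :
    2 * S.conj x = (S.U x : 𝓞 K) - S.V x * S.δ := by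
  have := congrArg S.conj (S.two_mul_eq x)
  simp only [map_add, map_mul, map_intCast, S.conj_δ, map_ofNat] at this
  rw [this]; ring

/-- A noncube whose norm is a cube has a nontrivial cubic symbol. -/
theorem exists_le_ne_zero {K K' : Type*} [Field K] [NumberField K] [Field K'] [NumberField K']
    {D D' : ℤ} (S : QF K D) (S' : QF K' D') {c c' : ℤ} (hcc : -3 * c' ^ 2 * D = c ^ 2 * D')
    (hc : c ≠ 0) {x : 𝓞 K'} (hx : ∀ γ : K', γ ^ 3 ≠ x) {n : ℤ} (hn : x * S'.conj x = n ^ 3)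
    {m : ℤ} (hm : m ≠ 0) :
    ∃ (q : ℕ) (p : Ideal (𝓞 K)), q.Prime ∧ p.IsPrime ∧ p ≠ ⊥ ∧ Ideal.absNorm p = q ∧
      ¬ (q : ℤ) ∣ m ∧ S.le (c * S'.U x) (c' * S'.V x) p ≠ 0 := by
  have hc' : c' ≠ 0 := by
    rintro rfl
    have : c ^ 2 * D' = 0 := by rw [← hcc]; ring
    exact mul_ne_zero (pow_ne_zero 2 hc) S'.D_ne this
  have hx0 : x ≠ 0 := by rintro rfl; exact hx 0 (by simp)
  have hcx0 : S'.conj x ≠ 0 := by simpa using hx0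
  have hn0 : n ≠ 0 := by
    rintro rfl; simp [hx0] at hn
  obtain ⟨q, hF, ψ, R, hqm, hR, hψR, hcube⟩ := exists_adjoin_omega K' hx
    (m := m * (6 * n * D * D' * c * c'))
    (mul_ne_zero hm (by simp [hn0, S.D_ne, S'.D_ne, hc, hc']))
  have hcast : ∀ k : ℤ, k ∣ 6 * n * D * D' * c * c' → (k : Kap q) ≠ 0 := by
    intro k hk h
    rw [CharP.intCast_eq_zero_iff (Kap q) q] at h
    exact hqm ((h.trans hk).mul_left m)
  have h2 : (2 : Kap q) ≠ 0 := by
    exact_mod_cast hcast 2 ⟨3 * n * D * D' * c * c', by ring⟩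
  have h3 : (3 : Kap q) ≠ 0 := by
    exact_mod_cast hcast 3 ⟨2 * n * D * D' * c * c', by ring⟩
  have hnK := hcast n ⟨6 * D * D' * c * c', by ring⟩
  have hDK := hcast D ⟨6 * n * D' * c * c', by ring⟩
  have hDK' := hcast D' ⟨6 * n * D * c * c', by ring⟩
  have hcK := hcast c ⟨6 * n * D * D' * c', by ring⟩
  have hcK' := hcast c' ⟨6 * n * D * D' * c, by ring⟩
  have hq3 : q ≠ 3 := by
    rintro rfl; exact h3 (by exact_mod_cast CharP.cast_eq_zero (Kap 3) 3)
  have hq2 : q ≠ 2 := by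
    rintro rfl; exact h2 (by exact_mod_cast CharP.cast_eq_zero (Kap 2) 2)
  set s := ψ S'.δ with hs
  have hs2 : s ^ 2 = D' := by rw [hs, ← map_pow, S'.sq, map_intCast]
  have hs0 : s ≠ 0 := by
    intro h; rw [h] at hs2; exact hDK' (by rw [← hs2]; simp)
  have hX : 2 * ψ x = S'.U x + S'.V x * s := by
    have := congrArg ψ (S'.two_mul_eq x)
    simpa only [map_mul, map_add, map_intCast, map_ofNat] using this
  have hY : 2 * ψ (S'.conj x) = S'.U x - S'.V x * s := by
    have := congrArg ψ (S'.UV_conj x)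
    simpa only [map_mul, map_sub, map_intCast, map_ofNat] using this
  have hXY : ψ x * ψ (S'.conj x) = n ^ 3 := by
    rw [← map_mul, hn, map_pow, map_intCast]
  have hX0 : ψ x ≠ 0 := by
    intro h; rw [h, zero_mul] at hXY; exact pow_ne_zero 3 hnK hXY.symm
  have hY0 : ψ (S'.conj x) ≠ 0 := by
    intro h; rw [h, mul_zero] at hXY; exact pow_ne_zero 3 hnK hXY.symm
  set θ : Kap q := 2 * om q + 1 with hθ
  have hθ2 : θ ^ 2 = -3 := sqrt_neg_three
  have hθ0 : θ ≠ 0 := by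
    intro h; rw [h] at hθ2; apply h3; linear_combination hθ2
  have hccK : (-3 : Kap q) * c' ^ 2 * D = c ^ 2 * D' := by
    exact_mod_cast congrArg (Int.cast (R := Kap q)) hcc
  set η : Kap q := c * s / (c' * θ) with hη
  have hcs : c * s = c' * θ * η := by rw [hη]; field_simp
  have hη2 : η ^ 2 = D := by
    rw [hη, div_pow, mul_pow, mul_pow, hs2, hθ2, div_eq_iff
      (mul_ne_zero (pow_ne_zero 2 hcK') (neg_ne_zero.2 h3)), ← hccK]
    ring
  obtain ⟨⟨h, hh⟩, h5, h6⟩ := residue_core hq3 h2 hX hY hXY hX0 hY0 hs2 hs0 hη2 hcK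
    (intCast_pow_q q c) (intCast_pow_q q c') hcs hR (hψR _) (hψR _) hcube
  obtain ⟨p, hp, hp0, hpq, hph⟩ := S.exists_prime_of_sqrt (q := q) hF.out hq2 (h := h) (by
    rw [← CharP.intCast_eq_zero_iff (Kap q) q]
    push_cast
    rw [← hh, hη2, sub_self])
  refine ⟨q, p, hF.out, hp, hp0, hpq, fun hd => hqm (hd.mul_right _), ?_⟩
  rw [S.le_eq _ _ hpq hF.out hph, e_prime q hq3]
  set z := rt (c * S'.U x) (c' * S'.V x * h) with hz
  have r1 : rho q z = 2 * c * ψ x := by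
    rw [hz, rho_rt]; push_cast; rw [← hh]
    linear_combination (- (c : Kap q)) * hX - S'.V x * hcs
  have r2 : rho q (star z) = 2 * c * ψ (S'.conj x) := by
    rw [hz, rho_star_rt]; push_cast; rw [← hh]
    linear_combination (- (c : Kap q)) * hY + S'.V x * hcs
  have h2c : (2 * c : Kap q) ≠ 0 := mul_ne_zero h2 hcK
  have hznorm : ¬ (q : ℤ) ∣ z.norm := by
    rw [← CharP.intCast_eq_zero_iff (Kap q) q, ← map_intCast (rho q), ← Eis.mul_star_eq, map_mul,
      r1, r2]
    exact mul_ne_zero (mul_ne_zero h2c hX0) (mul_ne_zero h2c hY0)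
  rw [Ne, lg_eq_zero q hq3 (cu_pow_three q hznorm)]
  rcases prime_mod_three q hq3 with hm | hm
  · rw [cu_one q hm, r1, r2, mul_div_mul_left _ _ h2c]
    exact h5 hm
  · rw [cu_two q hm, r1, r2, mul_div_mul_left _ _ h2c]
    exact h6 hm

end QF

/-- Every nonzero ideal has an integral inverse, up to principal ideals, coprime to `M`. -/
lemma exists_mul_eq_span_coprime {K : Type*} [Field K] [NumberField K] {J : Ideal (𝓞 K)}
    (hJ : J ≠ 0) {M : ℕ} (hM : M ≠ 0) :
    ∃ (x : 𝓞 K) (C : Ideal (𝓞 K)), x ≠ 0 ∧ C ≠ 0 ∧ J * C = Ideal.span {x} ∧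
      (Ideal.absNorm C).Coprime M := by
  have h2M : ((2 * M : ℕ) : 𝓞 K) ≠ 0 := by exact_mod_cast (by lia : 2 * M ≠ 0)
  have hI : J * Ideal.span {((2 * M : ℕ) : 𝓞 K)} ≠ 0 := mul_ne_zero hJ (span_ne h2M)
  obtain ⟨x, hx⟩ := IsDedekindDomain.exists_sup_span_eq
    (Ideal.mul_le_left : J * Ideal.span {((2 * M : ℕ) : 𝓞 K)} ≤ J) hI
  have hxJ : Ideal.span {x} ≤ J := by rw [← hx]; exact le_sup_right
  obtain ⟨C, hC⟩ := Ideal.dvd_iff_le.2 hxJ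
  have htop : Ideal.span {((2 * M : ℕ) : 𝓞 K)} ⊔ C = ⊤ := by
    rw [hC, ← Ideal.mul_sup] at hx
    exact mul_left_cancel₀ hJ (hx.trans (Ideal.mul_top J).symm)
  have hcop : (Ideal.absNorm C).Coprime (2 * M) := by
    refine Nat.coprime_of_dvd fun q hq h1 h2 => ?_
    obtain ⟨P, hP, hCP, hqP⟩ := exists_prime_ideal_of_dvd_absNorm hq h1
    obtain ⟨l, hl⟩ := h2
    refine hP.ne_top (top_le_iff.1 (htop ▸ sup_le ?_ hCP))
    rw [Ideal.span_singleton_le_iff_mem, hl]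
    push_cast
    exact P.mul_mem_right _ hqP
  have hC0 : C ≠ 0 := by
    rintro rfl
    simp only [Ideal.zero_eq_bot, Ideal.absNorm_bot, Nat.coprime_zero_left] at hcop
    lia
  refine ⟨x, C, ?_, hC0, hC.symm, hcop.coprime_dvd_right (dvd_mul_left _ _)⟩
  rintro rfl
  refine mul_ne_zero hJ hC0 (hC.symm.trans (by simp))

lemma exists_class_rep_coprime {K : Type*} [Field K] [NumberField K] (g : ClassGroup (𝓞 K)) {M : ℕ}
    (hM : M ≠ 0) :
    ∃ I : (Ideal (𝓞 K))⁰, ClassGroup.mk0 I = g ∧ (Ideal.absNorm (I : Ideal (𝓞 K))).Coprime M := by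
  obtain ⟨J, hJ⟩ := ClassGroup.mk0_surjective g⁻¹
  obtain ⟨x, C, hx, hC0, hC, hcop⟩ := exists_mul_eq_span_coprime (nonZeroDivisors.ne_zero J.2) hM
  refine ⟨⟨C, mem_nonZeroDivisors_of_ne_zero hC0⟩, ?_, hcop⟩
  rw [← inv_inv g, ← hJ, eq_comm, inv_eq_iff_mul_eq_one, ← map_mul, ClassGroup.mk0_eq_one_iff]
  exact ⟨⟨x, by simpa using hC⟩⟩

lemma card_hom_le (G : Type*) [CommGroup G] [Finite G] :
    Nat.card (G →* Multiplicative (ZMod 3)) ≤ Nat.card {g : G // g ^ 3 = 1} := by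
  have : NeZero (Monoid.exponent G) := ⟨Monoid.exponent_ne_zero_of_finite⟩
  obtain ⟨φ⟩ := CommGroup.monoidHom_mulEquiv_of_hasEnoughRootsOfUnity G ℂ
  let j : Multiplicative (ZMod 3) →* ℂˣ := (ZMod.stdAddChar (N := 3)).toMonoidHom.toHomUnits
  have hj : Function.Injective j := by
    intro a b h
    have := congrArg (Units.val) h
    exact ZMod.injective_stdAddChar this
  refine Nat.card_le_card_of_injective (fun χ => ⟨φ (j.comp χ), ?_⟩) ?_
  · rw [← map_pow, ← map_one φ]
    congr 1
    ext g
    simp only [MonoidHom.pow_apply, MonoidHom.comp_apply, ← map_pow, MonoidHom.one_apply]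
    have : χ g ^ 3 = 1 := by
      generalize χ g = z
      revert z; decide
    rw [map_pow χ, this, map_one]
  · intro χ χ' h
    have := φ.injective (Subtype.ext_iff.1 h)
    ext g
    exact hj (DFunLike.congr_fun this g)

/-- Characters of the ideal group of order three that are trivial on principal ideals coprime to
`M` are bounded by the three-torsion of the class group. -/
theorem card_le_of_separated {K : Type*} [Field K] [NumberField K] {ι : Type*} {M : ℕ} (hM : M ≠ 0)
    (F : ι → Ideal (𝓞 K) → ZMod 3)
    (hmul : ∀ i I J, I ≠ 0 → J ≠ 0 → F i (I * J) = F i I + F i J)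
    (hprin : ∀ i y, (nm y).Coprime M → y ≠ 0 → F i (Ideal.span {y}) = 0)
    (hsep : ∀ i j, i ≠ j → ∃ I, I ≠ 0 ∧ (Ideal.absNorm I).Coprime M ∧ F i I ≠ F j I) :
    Nat.card ι ≤ Nat.card {g : ClassGroup (𝓞 K) // g ^ 3 = 1} := by
  choose r hr hrc using fun g : ClassGroup (𝓞 K) => exists_class_rep_coprime g hM
  have key : ∀ i (I J : (Ideal (𝓞 K))⁰), (Ideal.absNorm (I : Ideal (𝓞 K))).Coprime M →
      (Ideal.absNorm (J : Ideal (𝓞 K))).Coprime M → ClassGroup.mk0 I * ClassGroup.mk0 J = 1 →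
      F i I + F i J = 0 := by
    intro i I J hI hJ h
    rw [← map_mul, ClassGroup.mk0_eq_one_iff] at h
    obtain ⟨⟨y, hy⟩⟩ := h
    have hy : (I : Ideal (𝓞 K)) * J = Ideal.span {y} := by simpa using hy
    have h0 : (I : Ideal (𝓞 K)) * J ≠ 0 :=
      mul_ne_zero (nonZeroDivisors.ne_zero I.2) (nonZeroDivisors.ne_zero J.2)
    rw [← hmul i _ _ (nonZeroDivisors.ne_zero I.2) (nonZeroDivisors.ne_zero J.2), hy]
    apply hprin
    · rw [nm, ← hy, map_mul]; exact hI.mul_left hJ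
    · rintro rfl
      exact h0 (by simpa using hy)
  have hrep : ∀ i (I : (Ideal (𝓞 K))⁰), (Ideal.absNorm (I : Ideal (𝓞 K))).Coprime M →
      F i I = F i (r (ClassGroup.mk0 I)) := by
    intro i I hI
    have h1 := key i I (r (ClassGroup.mk0 I)⁻¹) hI (hrc _) (by rw [hr]; simp)
    have h2 := key i (r (ClassGroup.mk0 I)) (r (ClassGroup.mk0 I)⁻¹) (hrc _) (hrc _)
      (by rw [hr, hr]; simp)
    linear_combination h1 - h2
  have hhom : ∀ i g h, F i (r (g * h)) = F i (r g) + F i (r h) := by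
    intro i g h
    rw [← hmul i _ _ (nonZeroDivisors.ne_zero (r g).2) (nonZeroDivisors.ne_zero (r h).2)]
    have := hrep i (r g * r h) (by
      rw [Submonoid.coe_mul, map_mul]; exact (hrc g).mul_left (hrc h))
    rw [map_mul, hr, hr] at this
    exact this.symm
  let χ : ι → ClassGroup (𝓞 K) →* Multiplicative (ZMod 3) := fun i =>
    MonoidHom.mk' (fun g => Multiplicative.ofAdd (F i (r g))) (fun g h => by
      rw [hhom, ofAdd_add])
  have hχ : Function.Injective χ := by
    intro i j hij
    by_contra hne
    obtain ⟨I, hI0, hI, hne⟩ := hsep i j hne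
    apply hne
    have h1 := hrep i ⟨I, mem_nonZeroDivisors_of_ne_zero hI0⟩ hI
    have h2 := hrep j ⟨I, mem_nonZeroDivisors_of_ne_zero hI0⟩ hI
    simp only at h1 h2
    rw [h1, h2]
    exact Multiplicative.ofAdd.injective
      (DFunLike.congr_fun hij (ClassGroup.mk0 ⟨I, mem_nonZeroDivisors_of_ne_zero hI0⟩))
  have : Finite (ClassGroup (𝓞 K) →* Multiplicative (ZMod 3)) :=
    Finite.of_injective _ DFunLike.coe_injective
  exact (Nat.card_le_card_of_injective χ hχ).trans (card_hom_le _)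

namespace QF

variable {K K' : Type*} [Field K] [NumberField K] [Field K'] [NumberField K'] {D D' : ℤ}

lemma four_mul_conj (S : QF K D) {x : 𝓞 K} {n : ℤ} (h : x * S.conj x = n) :
    S.U x ^ 2 - D * S.V x ^ 2 = 4 * n := by
  have : ((S.U x ^ 2 - D * S.V x ^ 2 : ℤ) : 𝓞 K) = (4 * n : ℤ) := by
    push_cast
    rw [← h, ← S.sq]
    linear_combination (-S.U x + S.V x * S.δ) * S.two_mul_eq x - 2 * x * S.UV_conj x
  exact_mod_cast this

lemma le_mul (S : QF K D) (S' : QF K' D') {c c' : ℤ} (hcc : -3 * c' ^ 2 * D = c ^ 2 * D')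
    {p : Ideal (𝓞 K)} {q : ℕ} (hq : q.Prime) (hpq : Ideal.absNorm p = q)
    (h2c : ¬ (q : ℤ) ∣ 2 * c) {x y : 𝓞 K'} (hx : ¬ (q : ℤ) ∣ S'.U x ^ 2 - D' * S'.V x ^ 2)
    (hy : ¬ (q : ℤ) ∣ S'.U y ^ 2 - D' * S'.V y ^ 2) :
    S.le (c * S'.U (x * y)) (c' * S'.V (x * y)) p =
      S.le (c * S'.U x) (c' * S'.V x) p + S.le (c * S'.U y) (c' * S'.V y) p := by
  by_cases H : ∃ h : ℤ, S.δ - h ∈ p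
  swap
  · have : ¬ ((Ideal.absNorm p).Prime ∧ ∃ h : ℤ, S.δ - h ∈ p) := fun h => H h.2
    simp [le, dif_neg this]
  obtain ⟨h, hh⟩ := H
  have hD : (q : ℤ) ∣ h ^ 2 - D := by
    apply dvd_of_mem hpq hq
    have : ((h ^ 2 - D : ℤ) : 𝓞 K) = (-(S.δ + h)) * (S.δ - h) := by
      push_cast; rw [← S.sq]; ring
    rw [this]
    exact p.mul_mem_left _ hh
  have hq' := Nat.prime_iff_prime_int.1 hq
  have hc : ¬ (q : ℤ) ∣ c := fun h => h2c (h.mul_left 2)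
  have hnd : ∀ z : 𝓞 K', ¬ (q : ℤ) ∣ S'.U z ^ 2 - D' * S'.V z ^ 2 →
      ¬ (q : ℤ) ∣ (rt (c * S'.U z) (c' * S'.V z * h)).norm := by
    intro z hz hd
    rw [rt_norm] at hd
    have h1 : (c * S'.U z) ^ 2 + 3 * (c' * S'.V z * h) ^ 2 =
        c ^ 2 * (S'.U z ^ 2 - D' * S'.V z ^ 2) + (h ^ 2 - D) * (3 * (c' * S'.V z) ^ 2) := by
      linear_combination (-S'.V z ^ 2) * hcc
    rw [h1] at hd
    have := (dvd_add_left (hD.mul_right _)).1 hd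
    rcases hq'.dvd_or_dvd this with h | h
    · exact hc (hq'.dvd_of_dvd_pow h)
    · exact hz h
  obtain ⟨hU, hV⟩ := S'.UV_mul x y
  rw [S.le_eq _ _ hpq hq hh, S.le_eq _ _ hpq hq hh, S.le_eq _ _ hpq hq hh,
    ← e_mul (hnd x hx) (hnd y hy), rt_mul, ← e_int_mul h2c]
  have hmul : ((2 * c : ℤ) : Eis) * rt (c * S'.U (x * y)) (c' * S'.V (x * y) * h) =
      rt (2 * c * (c * S'.U (x * y))) (2 * c * (c' * S'.V (x * y) * h)) := by
    have (k : ℤ) : (k : Eis) = rt k 0 := by ext <;> simp [rt]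
    rw [this, rt_mul]; congr 1 <;> ring
  rw [hmul]
  apply e_rt_congr
  · have : 2 * c * (c * S'.U (x * y)) -
        (c * S'.U x * (c * S'.U y) - 3 * (c' * S'.V x * h) * (c' * S'.V y * h)) =
        (h ^ 2 - D) * (3 * c' ^ 2 * (S'.V x * S'.V y)) := by
      linear_combination c ^ 2 * hU - S'.V x * S'.V y * hcc
    rw [this]; exact hD.mul_right _
  · have : 2 * c * (c' * S'.V (x * y) * h) -
        (c * S'.U x * (c' * S'.V y * h) + c' * S'.V x * h * (c * S'.U y)) = 0 := by
      linear_combination c * c' * h * hV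
    rw [this]; exact dvd_zero _

theorem family_bound (S : QF K D) (S' : QF K' D') {c c' : ℤ} (hcc : -3 * c' ^ 2 * D = c ^ 2 * D')
    (hc : c ≠ 0) {ι : Type*} (x : ι → 𝓞 K') (n : ι → ℤ) (hn : ∀ i, x i * S'.conj (x i) = n i ^ 3)
    (hx : ∀ i, x i ≠ 0)
    (hsep : ∀ i j, i ≠ j → ∀ γ : K', γ ^ 3 ≠ (x i * x j ^ 2 : 𝓞 K')) {M : ℕ} (hM : M ≠ 0)
    (hprin : ∀ i y, (nm y).Coprime M → y ≠ 0 →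
      S.Lam (c * S'.U (x i)) (c' * S'.V (x i)) (Ideal.span {y}) = 0) :
    Nat.card ι ≤ Nat.card {g : ClassGroup (𝓞 K) // g ^ 3 = 1} := by
  refine card_le_of_separated hM (fun i I => S.Lam (c * S'.U (x i)) (c' * S'.V (x i)) I)
    (fun i I J hI hJ => S.Lam_mul _ _ hI hJ) hprin fun i j hij => ?_
  have hn0 : ∀ i, n i ≠ 0 := by
    intro i h
    have := hn i
    rw [h] at this
    simp [hx i] at this
  have hnij : (x i * x j ^ 2) * S'.conj (x i * x j ^ 2) = ((n i * n j ^ 2 : ℤ) : 𝓞 K') ^ 3 := by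
    rw [map_mul, map_pow]; push_cast
    linear_combination (x j * S'.conj (x j)) ^ 2 * hn i +
      n i ^ 3 * (x j * S'.conj (x j) + n j ^ 3) * hn j
  obtain ⟨q, p, hq, hp, hp0, hpq, hqm, hle⟩ := S.exists_le_ne_zero S' hcc hc (hsep i j hij) hnij
    (m := M * (2 * c * n i * n j))
    (mul_ne_zero (by exact_mod_cast hM) (by simp [hc, hn0]))
  have hq' := Nat.prime_iff_prime_int.1 hq
  have hqM : ¬ q ∣ M := fun h => hqm ((Int.natCast_dvd_natCast.2 h).mul_right _)
  have h2c : ¬ (q : ℤ) ∣ 2 * c := fun h => hqm (by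
    rw [show (M : ℤ) * (2 * c * n i * n j) = 2 * c * (M * n i * n j) by ring]
    exact h.mul_right _)
  have h2 : ¬ (q : ℤ) ∣ 2 := fun h => h2c (h.mul_right _)
  have hnd : ∀ k, ¬ (q : ℤ) ∣ n k → ¬ (q : ℤ) ∣ S'.U (x k) ^ 2 - D' * S'.V (x k) ^ 2 := by
    intro k hk h
    rw [S'.four_mul_conj (n := n k ^ 3) (by rw [hn]; push_cast; rfl),
      show (4 : ℤ) = 2 ^ 2 by norm_num] at h
    rcases hq'.dvd_or_dvd h with h | h
    · exact h2 (hq'.dvd_of_dvd_pow h)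
    · exact hk (hq'.dvd_of_dvd_pow h)
  have hi := hnd i fun h => hqm (by
    rw [show (M : ℤ) * (2 * c * n i * n j) = n i * (2 * c * M * n j) by ring]
    exact h.mul_right _)
  have hj := hnd j fun h => hqm (by
    rw [show (M : ℤ) * (2 * c * n i * n j) = n j * (2 * c * M * n i) by ring]
    exact h.mul_right _)
  have hjj : ¬ (q : ℤ) ∣ S'.U (x j * x j) ^ 2 - D' * S'.V (x j * x j) ^ 2 := by
    intro h
    have h4 : 4 * (S'.U (x j * x j) ^ 2 - D' * S'.V (x j * x j) ^ 2) =
        (S'.U (x j) ^ 2 - D' * S'.V (x j) ^ 2) ^ 2 := by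
      obtain ⟨hU, hV⟩ := S'.UV_mul (x j) (x j)
      linear_combination (2 * S'.U (x j * x j) + S'.U (x j) * S'.U (x j) +
          D' * (S'.V (x j) * S'.V (x j))) * hU
        - D' * (2 * S'.V (x j * x j) + S'.U (x j) * S'.V (x j) + S'.V (x j) * S'.U (x j)) * hV
    exact hj (hq'.dvd_of_dvd_pow (h4 ▸ h.mul_left 4))
  refine ⟨p, hp0, ?_, ?_⟩
  · rw [hpq]; exact (Nat.Prime.coprime_iff_not_dvd hq).2 hqM
  · simp only [S.Lam_prime _ _ (p := p) hp0]
    intro heq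
    apply hle
    rw [pow_two, S.le_mul S' hcc hq hpq h2c hi hjj, S.le_mul S' hcc hq hpq h2c hj hj, heq]
    generalize S.le (c * S'.U (x j)) (c' * S'.V (x j)) p = t
    revert t; decide

end QF

namespace QF

variable {K : Type*} [Field K] [NumberField K] {D : ℤ} (S : QF K D)

lemma UV_sq (x : 𝓞 K) : 2 * S.U (x ^ 2) = S.U x ^ 2 + D * S.V x ^ 2 ∧
    S.V (x ^ 2) = S.U x * S.V x := by
  obtain ⟨hU, hV⟩ := S.UV_mul x x
  rw [← pow_two] at hU hV
  exact ⟨by linear_combination hU, by linarith⟩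

/-- Congruent to a unit of `ℤ` times `1` modulo three, with a fixed normalization. -/
def Good (x : 𝓞 K) : Prop := (S.U x : ZMod 3) = 2 ∧ (S.V x : ZMod 3) = 0

variable {S}

lemma Good.V_dvd {x : 𝓞 K} (h : S.Good x) : (3 : ℤ) ∣ S.V x :=
  (ZMod.intCast_zmod_eq_zero_iff_dvd _ 3).1 h.2

lemma Good.mul {x y : 𝓞 K} (hx : S.Good x) (hy : S.Good y) : S.Good (x * y) := by
  obtain ⟨hU, hV⟩ := S.UV_mul x y
  have hU := congrArg (Int.cast (R := ZMod 3)) hU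
  have hV := congrArg (Int.cast (R := ZMod 3)) hV
  push_cast at hU hV
  rw [hx.1, hy.1, hx.2, hy.2] at hU hV
  simp only [Good]
  constructor
  · generalize (S.U (x * y) : ZMod 3) = t at *
    simp only [mul_zero, add_zero] at hU
    revert hU; revert t; decide
  · generalize (S.V (x * y) : ZMod 3) = t at *
    simp only [mul_zero, zero_mul, add_zero] at hV
    revert hV; revert t; decide

lemma Good.V_mul {x y : 𝓞 K} (hx : S.Good x) (hy : S.Good y) :
    (S.V (x * y) : ZMod 9) = S.V x + S.V y := by
  obtain ⟨k, hk⟩ := hx.V_dvd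
  obtain ⟨l, hl⟩ := hy.V_dvd
  obtain ⟨m, hm⟩ : (3 : ℤ) ∣ S.U x - 2 := by
    refine (ZMod.intCast_zmod_eq_zero_iff_dvd _ 3).1 ?_; push_cast; rw [hx.1, sub_self]
  obtain ⟨n, hn⟩ : (3 : ℤ) ∣ S.U y - 2 := by
    refine (ZMod.intCast_zmod_eq_zero_iff_dvd _ 3).1 ?_; push_cast; rw [hy.1, sub_self]
  have hV := (S.UV_mul x y).2
  have h9 : (9 : ℤ) ∣ S.V (x * y) - (S.V x + S.V y) := by
    have : 2 * (S.V (x * y) - (S.V x + S.V y)) = 9 * (m * l + k * n) := by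
      linear_combination hV + S.V y * hm + S.V x * hn + 3 * m * hl + 3 * n * hk
    lia
  rw [← sub_eq_zero]
  have := (ZMod.intCast_zmod_eq_zero_iff_dvd _ 9).2 h9
  push_cast at this
  exact this

lemma Good.pow {x : 𝓞 K} (hx : S.Good x) (n : ℕ) :
    S.Good (x ^ n) ∧ (S.V (x ^ n) : ZMod 9) = n * S.V x := by
  induction n with
  | zero =>
    have h := S.UV_int 1
    push_cast at h
    rw [pow_zero, Good, h.1, h.2]
    simp
  | succ n ih =>
    rw [pow_succ]
    refine ⟨ih.1.mul hx, ?_⟩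
    rw [ih.1.V_mul hx, ih.2]; push_cast; ring

lemma good_pow_eight (hD : ¬ (3 : ℤ) ∣ D) {x : 𝓞 K} (hx : ¬ 3 ∣ nm x) : S.Good (x ^ 8) := by
  have h0 : (S.U x : ZMod 3) ^ 2 - D * (S.V x : ZMod 3) ^ 2 ≠ 0 := by
    intro h
    have h3 : (3 : ℤ) ∣ S.U x ^ 2 - D * S.V x ^ 2 := by
      refine (ZMod.intCast_zmod_eq_zero_iff_dvd _ 3).1 ?_; push_cast; exact h
    rw [← dvd_abs, ← S.four_nm] at h3
    apply hx
    lia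
  have hD0 : (D : ZMod 3) ≠ 0 := fun h =>
    hD ((ZMod.intCast_zmod_eq_zero_iff_dvd _ 3).1 h)
  have half : ∀ s t : ZMod 3, 2 * s = t → s = 2 * t := by decide
  have step : ∀ z : 𝓞 K, (S.U (z ^ 2) : ZMod 3) = 2 * (S.U z ^ 2 + D * S.V z ^ 2) ∧
      (S.V (z ^ 2) : ZMod 3) = S.U z * S.V z := by
    intro z
    obtain ⟨hU, hV⟩ := S.UV_sq z
    have hU := congrArg (Int.cast (R := ZMod 3)) hU
    push_cast at hU
    refine ⟨half _ _ hU, by rw [hV]; push_cast; rfl⟩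
  have h1 := step x
  have h2 := step (x ^ 2)
  have h3 := step ((x ^ 2) ^ 2)
  rw [h1.1, h1.2] at h2
  rw [h2.1, h2.2] at h3
  rw [show x ^ 8 = ((x ^ 2) ^ 2) ^ 2 by ring, Good, h3.1, h3.2]
  generalize (S.U x : ZMod 3) = u at *
  generalize (S.V x : ZMod 3) = v at *
  generalize (D : ZMod 3) = e at *
  clear h1 h2 h3 step half
  revert u v e
  decide

lemma exists_norm_eq_cube (S : QF K D) {x : 𝓞 K} {J : Ideal (𝓞 K)} (hJ : Ideal.span {x} = J ^ 3) :
    ∃ n : ℤ, x * S.conj x = n ^ 3 := by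
  have h1 := S.four_nm x
  rw [nm, hJ, map_pow] at h1
  have h2 : (4 * (x * S.conj x)) = ((S.U x ^ 2 - D * S.V x ^ 2 : ℤ) : 𝓞 K) := by
    push_cast
    rw [← S.sq]
    linear_combination (S.U x - S.V x * S.δ) * S.two_mul_eq x + 2 * x * S.UV_conj x
  have h4 : (4 : 𝓞 K) ≠ 0 := by norm_num
  rcases abs_choice (S.U x ^ 2 - D * S.V x ^ 2) with h | h
  · refine ⟨Ideal.absNorm J, mul_left_cancel₀ h4 ?_⟩
    rw [h] at h1
    rw [h2, ← h1]; push_cast; ring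
  · refine ⟨-Ideal.absNorm J, mul_left_cancel₀ h4 ?_⟩
    rw [h] at h1
    rw [h2, ← neg_neg (S.U x ^ 2 - D * S.V x ^ 2), ← h1]; push_cast; ring

end QF

namespace QF

variable {K : Type*} [Field K] [NumberField K] {d : ℤ} (S : QF K d)

lemma exists_alpha {a b : ℤ} (hd : d = -4 * a ^ 3 + 9 * b ^ 2) :
    ∃ α : 𝓞 K, 2 * α = (3 * b : ℤ) + S.δ ∧ α * S.conj α = (a : 𝓞 K) ^ 3 := by
  have hδ : (S.δ : K) ^ 2 = d := by
    have := congrArg (algebraMap (𝓞 K) K) S.sq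
    simpa using this
  have hInt : IsIntegral ℤ (((3 * b : ℤ) + (S.δ : K)) / 2) := by
    refine ⟨Polynomial.X ^ 2 - Polynomial.C (3 * b) * Polynomial.X + Polynomial.C (a ^ 3),
      by monicity!, ?_⟩
    simp only [Polynomial.eval₂_add, Polynomial.eval₂_sub, Polynomial.eval₂_mul,
      Polynomial.eval₂_pow, Polynomial.eval₂_X, Polynomial.eval₂_C]
    simp only [algebraMap_int_eq, eq_intCast]
    have hdK : (d : K) = -4 * a ^ 3 + 9 * b ^ 2 := by exact_mod_cast congrArg (Int.cast (R := K)) hd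
    push_cast
    linear_combination (1 / 4 : K) * hδ + (1 / 4 : K) * hdK
  obtain ⟨α, hα⟩ := IsIntegralClosure.isIntegral_iff (A := 𝓞 K) |>.1 hInt
  have h1 : 2 * α = (3 * b : ℤ) + S.δ := by
    apply RingOfIntegers.coe_injective
    simp only [map_mul, map_add, map_ofNat, map_intCast]
    rw [hα]; ring
  refine ⟨α, h1, ?_⟩
  have h2 : 2 * S.conj α = (3 * b : ℤ) - S.δ := by
    have := congrArg S.conj h1
    simp only [map_mul, map_add, map_ofNat, map_intCast, S.conj_δ] at this
    rw [this]; ring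
  have h4 : (4 : 𝓞 K) ≠ 0 := by norm_num
  apply mul_left_cancel₀ h4
  have hdK : (d : 𝓞 K) = -4 * a ^ 3 + 9 * b ^ 2 := by
    exact_mod_cast congrArg (Int.cast (R := 𝓞 K)) hd
  have hs := S.sq
  push_cast at h1 h2
  linear_combination (2 * S.conj α) * h1 + (3 * b + S.δ) * h2 - hs - hdK

lemma isCoprime_of_squarefree {a b d : ℤ} (hd : d = -4 * a ^ 3 + 9 * b ^ 2) (hsf : Squarefree d) :
    IsCoprime (a ^ 3) (3 * b) := by
  apply IsCoprime.pow_left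
  have h3 : ¬ (3 : ℤ) ∣ a := by
    rintro ⟨k, rfl⟩
    have := hsf 3 ⟨-12 * k ^ 3 + b ^ 2, by rw [hd]; ring⟩
    exact absurd this (by decide)
  refine IsCoprime.mul_right ?_ ?_
  · exact ((Int.prime_three.coprime_iff_not_dvd).2 h3).symm
  · rw [Int.isCoprime_iff_gcd_eq_one]
    refine Nat.coprime_of_dvd fun p hp h1 h2 => ?_
    obtain ⟨k, hk⟩ := Int.natCast_dvd.2 h1
    obtain ⟨l, hl⟩ := Int.natCast_dvd.2 h2
    have := hsf p ⟨-4 * p * k ^ 3 + 9 * l ^ 2, by rw [hd, hk, hl]; ring⟩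
    exact (Nat.prime_iff_prime_int.1 hp).not_isUnit this

lemma span_alpha_eq_cube {a b : ℤ} (hd : d = -4 * a ^ 3 + 9 * b ^ 2) (hsf : Squarefree d)
    {α : 𝓞 K} (h1 : 2 * α = (3 * b : ℤ) + S.δ) (h2 : α * S.conj α = (a : 𝓞 K) ^ 3) :
    ∃ J : Ideal (𝓞 K), Ideal.span {α} = J ^ 3 := by
  let _ : GCDMonoid (Ideal (𝓞 K)) := UniqueFactorizationMonoid.toGCDMonoid _
  refine exists_eq_pow_of_mul_eq_pow_of_coprime (b := Ideal.span {S.conj α})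
    (c := Ideal.span {(a : 𝓞 K)}) ?_ ?_
  · obtain ⟨u, v, huv⟩ := isCoprime_of_squarefree hd hsf
    rw [Ideal.isCoprime_span_singleton_iff]
    have h3 : α + S.conj α = (3 * b : ℤ) := by
      have h4 : 2 * S.conj α = (3 * b : ℤ) - S.δ := by
        have := congrArg S.conj h1
        simp only [map_mul, map_add, map_ofNat, map_intCast, S.conj_δ] at this
        rw [this]; ring
      have h2 : (2 : 𝓞 K) ≠ 0 := by norm_num
      apply mul_left_cancel₀ h2
      linear_combination h1 + h4
    refine ⟨u * S.conj α + v, v, ?_⟩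
    have := congrArg (Int.cast (R := 𝓞 K)) huv
    push_cast at this h3
    linear_combination (u : 𝓞 K) * h2 + v * h3 + this
  · rw [Ideal.span_singleton_mul_span_singleton, h2, Ideal.span_singleton_pow]

variable {S}

/-- An auxiliary cube ideal generator whose irrational part is nontrivial modulo nine. -/
lemma exists_adjust {a b : ℤ} (hb : ¬ (3 : ℤ) ∣ b) (hd : d = -4 * a ^ 3 + 9 * b ^ 2)
    (hsf : Squarefree d) {M : ℕ} (hM : M ≠ 0) :
    ∃ (β : 𝓞 K) (C : Ideal (𝓞 K)), β ≠ 0 ∧ Ideal.span {β} = C ^ 3 ∧ (nm β).Coprime (6 * M) ∧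
      ∀ x : 𝓞 K, ¬ 3 ∣ nm x → ∃ i : ℕ, 9 ∣ S.V (x ^ 8 * (β ^ 8) ^ i) := by
  have h3a : ¬ (3 : ℤ) ∣ a := by
    rintro ⟨k, rfl⟩
    have := hsf 3 ⟨-12 * k ^ 3 + b ^ 2, by rw [hd]; ring⟩
    exact absurd this (by decide)
  have h3d : ¬ (3 : ℤ) ∣ d := by
    rintro ⟨k, hk⟩
    apply h3a
    have : (3 : ℤ) ∣ a ^ 3 := by
      have : (3 : ℤ) ∣ 4 * a ^ 3 := ⟨3 * b ^ 2 - k, by linarith⟩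
      lia
    exact Int.prime_three.dvd_of_dvd_pow this
  have ha0 : a ≠ 0 := by rintro rfl; simp at h3a
  obtain ⟨α, h1, h2⟩ := S.exists_alpha hd
  obtain ⟨J, hJ⟩ := S.span_alpha_eq_cube hd hsf h1 h2
  have hα0 : α ≠ 0 := by
    rintro rfl
    rw [zero_mul] at h2
    exact pow_ne_zero 3 (Int.cast_ne_zero.2 ha0) h2.symm
  have hJ0 : J ≠ 0 := by
    rintro rfl
    rw [zero_pow three_ne_zero] at hJ
    exact span_ne hα0 hJ
  obtain ⟨x1, C, hx1, hC0, hC, hcop⟩ := exists_mul_eq_span_coprime hJ0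
    (M := 6 * M) (by lia)
  have hdvd : Ideal.span {α} * C ^ 3 = Ideal.span {x1 ^ 3} := by
    rw [hJ, ← mul_pow, hC, Ideal.span_singleton_pow]
  obtain ⟨β, hβ⟩ : α ∣ x1 ^ 3 := by
    rw [← Ideal.span_singleton_le_span_singleton, ← hdvd]
    exact Ideal.mul_le_left
  have hβC : Ideal.span {β} = C ^ 3 := by
    apply mul_left_cancel₀ (span_ne hα0)
    rw [hdvd, hβ, Ideal.span_singleton_mul_span_singleton]
  have hnβ : (nm β).Coprime (6 * M) := by
    rw [nm, hβC, map_pow]; exact hcop.pow_left 3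
  have hβ0 : β ≠ 0 := by
    rintro rfl
    rw [mul_zero] at hβ
    exact pow_ne_zero 3 hx1 hβ
  obtain ⟨hUα, hVα⟩ := S.UV_unique (x := α) (u := 3 * b) (v := 1) (by rw [h1]; push_cast; ring)
  have hnα : ¬ 3 ∣ nm α := by
    intro h
    have h4 := S.four_nm α
    rw [hUα, hVα] at h4
    have : (3 : ℤ) ∣ |(3 * b) ^ 2 - d * 1 ^ 2| := by rw [← h4]; lia
    rw [dvd_abs] at this
    exact h3d (by
      have h5 := dvd_sub (Dvd.intro (3 * b ^ 2) rfl : (3 : ℤ) ∣ 3 * (3 * b ^ 2)) this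
      rwa [show 3 * (3 * b ^ 2) - ((3 * b) ^ 2 - d * 1 ^ 2) = d by ring] at h5)
  have h3β : ¬ 3 ∣ nm β := fun h => by
    exact absurd (Nat.dvd_gcd h (dvd_mul_of_dvd_left (by norm_num : 3 ∣ 6) M)) (by
      rw [hnβ.gcd_eq_one]; norm_num)
  have h3x1 : ¬ 3 ∣ nm x1 := fun h => by
    have : 3 ∣ nm x1 ^ 3 := h.trans (dvd_pow_self _ three_ne_zero)
    rw [← nm_pow, hβ, nm_mul] at this
    rcases Nat.prime_three.dvd_mul.1 this with h | h
    · exact hnα h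
    · exact h3β h
  have gα : S.Good (α ^ 8) := good_pow_eight h3d hnα
  have gβ : S.Good (β ^ 8) := good_pow_eight h3d h3β
  have gx : S.Good (x1 ^ 8) := good_pow_eight h3d h3x1
  have e1 : (S.V (α ^ 8) : ZMod 9) + S.V (β ^ 8) = 0 := by
    rw [← gα.V_mul gβ, ← mul_pow, ← hβ, ← pow_mul, mul_comm 3 8, pow_mul, (gx.pow 3).2]
    obtain ⟨k, hk⟩ := gx.V_dvd
    rw [hk]
    push_cast
    rw [← mul_assoc]
    have : (3 * 3 : ZMod 9) = 0 := rfl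
    rw [this, zero_mul]
  have e2 : ¬ (9 : ℤ) ∣ S.V (α ^ 8) := by
    intro h9
    obtain ⟨u2, v2⟩ := S.UV_sq α
    obtain ⟨u4, v4⟩ := S.UV_sq (α ^ 2)
    have v8 := (S.UV_sq ((α ^ 2) ^ 2)).2
    rw [show α ^ 8 = ((α ^ 2) ^ 2) ^ 2 by ring, v8, v4, v2, hUα, hVα] at h9
    rw [hUα, hVα] at u2
    rw [v2, hUα, hVα] at u4
    have p3 := Int.prime_three
    have hu2 : ¬ (3 : ℤ) ∣ S.U (α ^ 2) := by
      intro h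
      apply h3d
      have := (h.mul_left 2)
      rw [u2] at this
      lia
    have hu4 : ¬ (3 : ℤ) ∣ S.U ((α ^ 2) ^ 2) := by
      intro h
      apply hu2
      have := (h.mul_left 2)
      rw [u4, show d * (3 * b * 1) ^ 2 = 3 * (3 * d * b ^ 2) by ring] at this
      exact p3.dvd_of_dvd_pow ((dvd_add_left (dvd_mul_right _ _)).1 this)
    have h3 : (3 : ℤ) ∣ S.U ((α ^ 2) ^ 2) * (S.U (α ^ 2) * b) := by
      obtain ⟨k, hk⟩ := h9
      exact ⟨k, by linarith⟩
    rcases p3.dvd_or_dvd h3 with h | h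
    · exact hu4 h
    rcases p3.dvd_or_dvd h with h | h
    · exact hu2 h
    · exact hb h
  refine ⟨β, C, hβ0, hβC, hnβ, fun x hx => ?_⟩
  have gx := good_pow_eight (S := S) h3d hx
  obtain ⟨k, hk⟩ := gx.V_dvd
  obtain ⟨l, hl⟩ := gβ.V_dvd
  have hl3 : ¬ (3 : ℤ) ∣ l := by
    intro h
    apply e2
    have : ((S.V (α ^ 8) + S.V (β ^ 8) : ℤ) : ZMod 9) = 0 := by push_cast; exact e1
    have := (ZMod.intCast_zmod_eq_zero_iff_dvd _ 9).1 this
    lia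
  obtain ⟨i, hi⟩ : ∃ i : ℕ, (3 : ℤ) ∣ k + i * l := by
    by_cases h0 : (3 : ℤ) ∣ k
    · exact ⟨0, by simpa using h0⟩
    by_cases h1 : (3 : ℤ) ∣ k + l
    · exact ⟨1, by simpa using h1⟩
    · exact ⟨2, by push_cast; lia⟩
  refine ⟨i, ?_⟩
  have : (S.V (x ^ 8 * (β ^ 8) ^ i) : ZMod 9) = 0 := by
    rw [gx.V_mul (gβ.pow i).1, (gβ.pow i).2, hk, hl]
    obtain ⟨t, ht⟩ := hi
    have : (3 * k + i * (3 * l) : ℤ) = 9 * t := by linear_combination 3 * ht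
    have := congrArg (Int.cast (R := ZMod 9)) this
    push_cast at this ⊢
    rw [this, show (9 : ZMod 9) = 0 from rfl, zero_mul]
  exact (ZMod.intCast_zmod_eq_zero_iff_dvd _ 9).1 this

end QF

lemma odd_of_squarefree {a b d : ℤ} (hd : d = -4 * a ^ 3 + 9 * b ^ 2) (hsf : Squarefree d) :
    Odd d := by
  rw [← Int.not_even_iff_odd]
  intro he
  have hb : Even b := by
    by_contra hb
    rw [Int.not_even_iff_odd] at hb
    obtain ⟨k, rfl⟩ := hb
    obtain ⟨l, hl⟩ := he
    lia
  obtain ⟨k, rfl⟩ := hb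
  have := hsf 2 ⟨-a ^ 3 + 9 * k ^ 2, by rw [hd]; ring⟩
  exact absurd this (by decide)

lemma not_three_dvd_of_squarefree {a b d : ℤ} (hd : d = -4 * a ^ 3 + 9 * b ^ 2)
    (hsf : Squarefree d) : ¬ (3 : ℤ) ∣ d := by
  rintro ⟨k, hk⟩
  have h3 : (3 : ℤ) ∣ a ^ 3 := by
    have : (3 : ℤ) ∣ 4 * a ^ 3 := ⟨3 * b ^ 2 - k, by linarith⟩
    lia
  obtain ⟨l, rfl⟩ := Int.prime_three.dvd_of_dvd_pow h3
  have := hsf 3 ⟨-12 * l ^ 3 + b ^ 2, by rw [hd]; ring⟩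
  exact absurd this (by decide)

lemma odd_of_coprime {n M : ℕ} (h : n.Coprime (6 * M)) : Odd n ∧ ¬ 3 ∣ n ∧ n.Coprime M := by
  refine ⟨?_, fun h3 => ?_, h.coprime_mul_left_right⟩
  · rw [← Nat.not_even_iff_odd, even_iff_two_dvd]
    intro h2
    have := Nat.dvd_gcd h2 (dvd_mul_of_dvd_left (by norm_num : 2 ∣ 6) M)
    rw [h.gcd_eq_one] at this
    norm_num at this
  · have := Nat.dvd_gcd h3 (dvd_mul_of_dvd_left (by norm_num : 3 ∣ 6) M)
    rw [h.gcd_eq_one] at this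
    norm_num at this

namespace QF

variable {K K' : Type*} [Field K] [NumberField K] [Field K'] [NumberField K'] {d : ℤ}
  {a b : ℤ}

theorem card_le_of_family_right (S : QF K d) (S' : QF K' (-3 * d)) (hb : ¬ (3 : ℤ) ∣ b)
    (hd : d = -4 * a ^ 3 + 9 * b ^ 2)
    (hsf : Squarefree d) {ι : Type*} [Finite ι] (y : ι → 𝓞 K') (J : ι → Ideal (𝓞 K'))
    (hJ : ∀ i, Ideal.span {y i} = J i ^ 3) (h0 : ∀ i, y i ≠ 0) (h6 : ∀ i, (nm (y i)).Coprime 6)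
    (hsep : ∀ i j, i ≠ j → ∀ γ : K', γ ^ 3 ≠ (y i * y j ^ 2 : 𝓞 K')) :
    Nat.card ι ≤ Nat.card {g : ClassGroup (𝓞 K) // g ^ 3 = 1} := by
  have := Fintype.ofFinite ι
  choose n hn using fun i => S'.exists_norm_eq_cube (hJ i)
  have hN : ∀ i, nm (y i) ≠ 0 := fun i => by rw [Ne, nm_eq_zero]; exact h0 i
  refine S.family_bound S' (c := 1) (c' := 1) (by ring) one_ne_zero y n hn h0 hsep
    (M := 6 * ∏ i, nm (y i)) (mul_ne_zero (by norm_num) (Finset.prod_ne_zero_iff.2 fun i _ => hN i))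
    fun i z hz hz0 => ?_
  have hz' : (nm z).Coprime (6 * nm (y i)) :=
    hz.coprime_dvd_right (mul_dvd_mul_left _
        (Finset.dvd_prod_of_mem (fun i => nm (y i)) (Finset.mem_univ i)))
  obtain ⟨hz2, hz3, hzy⟩ := odd_of_coprime hz'
  obtain ⟨β, C, hβ0, hC, hβ, hadj⟩ := exists_adjust (S := S) hb hd hsf (hN i)
  obtain ⟨k, h9⟩ := hadj z hz3
  have hX : (nm (z ^ 8 * (β ^ 8) ^ k)).Coprime (6 * nm (y i)) := by
    rw [nm_mul, nm_pow, nm_pow, nm_pow]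
    exact (hz'.pow_left _).mul_left ((hβ.pow_left _).pow_left _)
  obtain ⟨hX2, hX3, hXy⟩ := odd_of_coprime hX
  obtain ⟨hy2, hy3, -⟩ := odd_of_coprime (M := 1) (by simpa using h6 i)
  have hcore := core S S' (odd_of_squarefree hd hsf) hX2 hy2 hX3 hy3 hXy h9
  have hJ0 : J i ≠ 0 := by
    intro h
    have := hJ i
    rw [h, zero_pow three_ne_zero] at this
    exact span_ne (h0 i) this
  have hC0 : C ≠ 0 := by
    intro h
    rw [h, zero_pow three_ne_zero] at hC
    exact span_ne hβ0 hC
  rw [hJ i, S'.Lam_cube _ _ hJ0, ← Ideal.span_singleton_mul_span_singleton,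
    ← Ideal.span_singleton_pow, ← Ideal.span_singleton_pow, ← Ideal.span_singleton_pow,
    S.Lam_mul _ _ (pow_ne_zero _ (span_ne hz0)) (pow_ne_zero _ (pow_ne_zero _ (span_ne hβ0))),
    S.Lam_pow _ _ (span_ne hz0), S.Lam_pow _ _ (pow_ne_zero _ (span_ne hβ0)),
    S.Lam_pow _ _ (span_ne hβ0), hC, S.Lam_cube _ _ hC0, mul_zero, mul_zero, add_zero] at hcore
  rw [one_mul, one_mul]
  generalize S.Lam (S'.U (y i)) (S'.V (y i)) (Ideal.span {z}) = t at hcore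
  revert t; decide

theorem card_le_of_family_left (S : QF K d) (S' : QF K' (-3 * d)) (hd : d = -4 * a ^ 3 + 9 * b ^ 2)
    (hsf : Squarefree d) {ι : Type*} [Finite ι] (x : ι → 𝓞 K) (J : ι → Ideal (𝓞 K))
    (hJ : ∀ i, Ideal.span {x i} = J i ^ 3) (h0 : ∀ i, x i ≠ 0) (h6 : ∀ i, (nm (x i)).Coprime 6)
    (hsep : ∀ i j, i ≠ j → ∀ γ : K, γ ^ 3 ≠ (x i * x j ^ 2 : 𝓞 K)) :
    Nat.card ι ≤ 3 * Nat.card {g : ClassGroup (𝓞 K') // g ^ 3 = 1} := by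
  have := Fintype.ofFinite ι
  have h3d := not_three_dvd_of_squarefree hd hsf
  have h3x : ∀ i, ¬ 3 ∣ nm (x i) := fun i =>
    (odd_of_coprime (M := 1) (by simpa using h6 i)).2.1
  have hgood : ∀ i, S.Good (x i ^ 8) := fun i => good_pow_eight h3d (h3x i)
  choose k hk using fun i => (hgood i).V_dvd
  have hJ0 : ∀ i, J i ≠ 0 := by
    intro i h
    have := hJ i
    rw [h, zero_pow three_ne_zero] at this
    exact span_ne (h0 i) this
  have fiber : ∀ t : ZMod 3, Nat.card {i // (k i : ZMod 3) = t} ≤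
      Nat.card {g : ClassGroup (𝓞 K') // g ^ 3 = 1} := by
    intro t
    rcases isEmpty_or_nonempty {i // (k i : ZMod 3) = t} with h | ⟨⟨i₀, hi₀⟩⟩
    · simp
    let X : {i // (k i : ZMod 3) = t} → 𝓞 K := fun i => x i ^ 8 * (x i₀ ^ 8) ^ 2
    have hXJ : ∀ i, Ideal.span {X i} = (J i ^ 8 * (J i₀ ^ 8) ^ 2) ^ 3 := by
      intro i
      rw [← Ideal.span_singleton_mul_span_singleton,
        ← Ideal.span_singleton_pow, ← Ideal.span_singleton_pow, ← Ideal.span_singleton_pow, hJ, hJ]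
      ring
    have hX0 : ∀ i, X i ≠ 0 := fun i =>
      mul_ne_zero (pow_ne_zero _ (h0 _)) (pow_ne_zero _ (pow_ne_zero _ (h0 _)))
    have hX6 : ∀ i, (nm (X i)).Coprime 6 := by
      intro i
      rw [nm_mul, nm_pow, nm_pow, nm_pow]
      exact ((h6 _).pow_left _).mul_left (((h6 _).pow_left _).pow_left _)
    have hX9 : ∀ i, 9 ∣ S.V (X i) := by
      rintro ⟨i, hi⟩
      refine (ZMod.intCast_zmod_eq_zero_iff_dvd _ 9).1 ?_
      rw [(hgood i).V_mul ((hgood i₀).pow 2).1, ((hgood i₀).pow 2).2, hk, hk]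
      have h3 : ((k i - k i₀ : ℤ) : ZMod 3) = 0 := by push_cast; rw [hi, hi₀, sub_self]
      obtain ⟨l, hl⟩ := (ZMod.intCast_zmod_eq_zero_iff_dvd _ 3).1 h3
      have : (3 * k i + 2 * (3 * k i₀) : ℤ) = 9 * (l + k i₀) := by linear_combination 3 * hl
      have := congrArg (Int.cast (R := ZMod 9)) this
      push_cast at this ⊢
      rw [this, show (9 : ZMod 9) = 0 from rfl, zero_mul]
    choose n hn using fun i => S.exists_norm_eq_cube (hXJ i)
    have hN : ∀ i, nm (X i) ≠ 0 := fun i => by rw [Ne, nm_eq_zero]; exact hX0 i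
    refine S'.family_bound S (c := 3) (c' := -1) (by ring) (by norm_num) X n hn hX0 ?_
      (M := 6 * ∏ i, nm (X i))
      (mul_ne_zero (by norm_num) (Finset.prod_ne_zero_iff.2 fun i _ => hN i))
      fun i z hz hz0 => ?_
    · intro i j hij γ hγ
      have hne : (i : ι) ≠ j := fun h => hij (Subtype.ext h)
      have hc0 : ∀ i, (x i : K) ≠ 0 := fun i => by simpa using h0 i
      have hγ0 : γ ≠ 0 := by
        rintro rfl
        rw [zero_pow three_ne_zero, eq_comm] at hγ
        exact mul_ne_zero (hX0 i) (pow_ne_zero 2 (hX0 j)) (by simpa using hγ)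
      refine hsep i j hne ((x i * x j ^ 2 : K) ^ 3 * (x i₀ : K) ^ 16 / γ) ?_
      rw [div_pow, div_eq_iff (pow_ne_zero _ hγ0), hγ]
      simp only [X]
      push_cast
      ring
    · have hz' : (nm z).Coprime (6 * nm (X i)) :=
        hz.coprime_dvd_right (mul_dvd_mul_left _
        (Finset.dvd_prod_of_mem (fun i => nm (X i)) (Finset.mem_univ i)))
      obtain ⟨hz2, hz3, hzX⟩ := odd_of_coprime hz'
      obtain ⟨hX2, hX3, -⟩ := odd_of_coprime (M := 1) (by simpa using hX6 i)
      rw [neg_one_mul, core S S' (odd_of_squarefree hd hsf) hX2 hz2 hX3 hz3 hzX.symm (hX9 i),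
        hXJ, S.Lam_cube]
      exact mul_ne_zero (pow_ne_zero _ (hJ0 _)) (pow_ne_zero _ (pow_ne_zero _ (hJ0 _)))
  calc Nat.card ι = Nat.card (Σ t : ZMod 3, {i // (k i : ZMod 3) = t}) :=
        Nat.card_congr (Equiv.sigmaFiberEquiv _).symm
    _ = ∑ t : ZMod 3, Nat.card {i // (k i : ZMod 3) = t} := Nat.card_sigma
    _ ≤ ∑ _t : ZMod 3, Nat.card {g : ClassGroup (𝓞 K') // g ^ 3 = 1} :=
        Finset.sum_le_sum fun t _ => fiber t
    _ = _ := by simp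

end QF

/-- Generators of cubes of ideals, twisted by units, give a family that is independent modulo
cubes. -/
theorem exists_family {K : Type*} [Field K] [NumberField K] {T : Type*} (η : T → (𝓞 K)ˣ)
    (hη : ∀ t t', t ≠ t' → ∀ u : 𝓞 K, u ^ 3 ≠ η t * η t' ^ 2) {M : ℕ} (hM : M ≠ 0) :
    ∃ (x : {g : ClassGroup (𝓞 K) // g ^ 3 = 1} × T → 𝓞 K)
      (J : {g : ClassGroup (𝓞 K) // g ^ 3 = 1} × T → Ideal (𝓞 K)),
      (∀ i, Ideal.span {x i} = J i ^ 3) ∧ (∀ i, x i ≠ 0) ∧ (∀ i, (nm (x i)).Coprime M) ∧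
      ∀ i j, i ≠ j → ∀ γ : K, γ ^ 3 ≠ (x i * x j ^ 2 : 𝓞 K) := by
  choose I hI hIM using fun g : ClassGroup (𝓞 K) => exists_class_rep_coprime g hM
  have hz : ∀ g : {g : ClassGroup (𝓞 K) // g ^ 3 = 1}, ∃ z : 𝓞 K,
      Ideal.span {z} = (I g : Ideal (𝓞 K)) ^ 3 := by
    intro g
    have : ClassGroup.mk0 (I g ^ 3) = 1 := by rw [map_pow, hI, g.2]
    rw [ClassGroup.mk0_eq_one_iff] at this
    obtain ⟨⟨z, hz⟩⟩ := this
    exact ⟨z, by simpa using hz.symm⟩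
  choose z hz using hz
  have hI0 : ∀ g, (I g : Ideal (𝓞 K)) ≠ 0 := fun g => nonZeroDivisors.ne_zero (I g).2
  have hz0 : ∀ g, z g ≠ 0 := by
    intro g h
    have := hz g
    rw [h, Ideal.span_singleton_zero] at this
    exact pow_ne_zero 3 (hI0 g) this.symm
  have hspan : ∀ i : {g : ClassGroup (𝓞 K) // g ^ 3 = 1} × T,
      Ideal.span {(η i.2 : 𝓞 K) * z i.1} = (I i.1 : Ideal (𝓞 K)) ^ 3 := by
    intro i
    rw [← hz, Ideal.span_singleton_eq_span_singleton]
    exact (associated_unit_mul_left _ _ (η i.2).isUnit)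
  refine ⟨fun i => η i.2 * z i.1, fun i => I i.1, hspan,
    fun i => mul_ne_zero (η i.2).ne_zero (hz0 _), fun i => ?_, fun i j hij γ hγ => hij ?_⟩
  · rw [nm, hspan, map_pow]; exact (hIM _).pow_left 3
  obtain ⟨⟨g, hg⟩, t⟩ := i
  obtain ⟨⟨g', hg'⟩, t'⟩ := j
  have hInt : IsIntegral ℤ γ := by
    apply IsIntegral.of_pow (n := 3) (by norm_num)
    rw [hγ]; exact RingOfIntegers.isIntegral_coe _
  obtain ⟨c, rfl⟩ := IsIntegralClosure.isIntegral_iff (A := 𝓞 K) |>.1 hInt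
  have hc : c ^ 3 = η t * z ⟨g, hg⟩ * (η t' * z ⟨g', hg'⟩) ^ 2 := by
    apply RingOfIntegers.coe_injective
    rw [map_pow]; exact hγ
  have hcI : Ideal.span {c} = (I g : Ideal (𝓞 K)) * (I g' : Ideal (𝓞 K)) ^ 2 := by
    have h3 : Ideal.span {c} ^ 3 = ((I g : Ideal (𝓞 K)) * (I g' : Ideal (𝓞 K)) ^ 2) ^ 3 := by
      rw [Ideal.span_singleton_pow, hc, ← Ideal.span_singleton_mul_span_singleton,
        ← Ideal.span_singleton_pow, hspan ⟨⟨g, hg⟩, t⟩, hspan ⟨⟨g', hg'⟩, t'⟩]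
      ring
    let _ : NormalizedGCDMonoid (Ideal (𝓞 K)) := Classical.choice inferInstance
    exact pow_left_injective three_ne_zero h3
  have hc0 : c ≠ 0 := by
    rintro rfl
    rw [Ideal.span_singleton_zero] at hcI
    exact mul_ne_zero (hI0 g) (pow_ne_zero 2 (hI0 g')) hcI.symm
  have hgg : g = g' := by
    have h1 : ClassGroup.mk0 (I g * I g' ^ 2) = 1 := by
      rw [ClassGroup.mk0_eq_one_iff]
      exact ⟨⟨c, by simpa using hcI.symm⟩⟩
    rw [map_mul, map_pow, hI, hI] at h1
    have : g * g' ^ 3 = g' := by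
      rw [pow_succ, ← mul_assoc, h1, one_mul]
    rwa [hg', mul_one] at this
  subst hgg
  have htt : t = t' := by
    by_contra htt
    have hdvd : z ⟨g, hg⟩ ∣ c := by
      rw [← Ideal.span_singleton_le_span_singleton, hcI, hz, pow_succ, mul_comm, ← pow_succ]
      exact le_of_eq (by ring)
    obtain ⟨u, rfl⟩ := hdvd
    refine hη t t' htt u (mul_left_cancel₀ (pow_ne_zero 3 (hz0 ⟨g, hg⟩)) ?_)
    rw [← mul_pow, hc]; ring
  rw [htt]

lemma exists_family_units_one {K : Type*} [Field K] [NumberField K] :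
    ∃ η : Fin 1 → (𝓞 K)ˣ, ∀ t t', t ≠ t' → ∀ u : 𝓞 K, u ^ 3 ≠ η t * η t' ^ 2 :=
  ⟨1, fun t t' h => absurd (Subsingleton.elim t t') h⟩

lemma exists_family_units_three {K : Type*} [Field K] [NumberField K] (h : Units.rank K ≠ 0) :
    ∃ η : Fin 3 → (𝓞 K)ˣ, ∀ t t', t ≠ t' → ∀ u : 𝓞 K, u ^ 3 ≠ η t * η t' ^ 2 := by
  let i : Fin (Units.rank K) := ⟨0, Nat.pos_of_ne_zero h⟩
  let ε := Units.fundSystem K i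
  have key : ∀ (m : ℕ) (u : (𝓞 K)ˣ), u ^ 3 = ε ^ m → 3 ∣ m := by
    intro m u hu
    obtain ⟨⟨ζ, f⟩, hf, -⟩ := Units.exist_unique_eq_mul_prod K u
    have h1 := (Units.exist_unique_eq_mul_prod K (u ^ 3)).unique
      (y₁ := (ζ ^ 3, fun j => f j * 3)) (y₂ := (1, Pi.single i (m : ℤ))) (by
        simp only at hf ⊢
        conv_lhs => rw [hf]
        rw [mul_pow, ← Finset.prod_pow]
        simp only [zpow_mul, Subgroup.coe_pow]
        rfl) (by
        simp only
        rw [hu, Finset.prod_eq_single i (fun j _ hj => by simp [hj]) (by simp)]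
        simp [ε])
    have h2 := congrFun (Prod.ext_iff.1 h1).2 i
    simp only [Pi.single_eq_same] at h2
    have : (3 : ℤ) ∣ m := ⟨f i, by rw [← h2, mul_comm]⟩
    exact_mod_cast this
  refine ⟨fun t => ε ^ (t : ℕ), fun t t' htt u hu => htt ?_⟩
  have hu1 : IsUnit (u ^ 3) := by
    rw [hu]
    exact (ε ^ (t : ℕ)).isUnit.mul ((ε ^ (t' : ℕ)).isUnit.pow 2)
  rw [isUnit_pow_iff three_ne_zero] at hu1
  obtain ⟨v, rfl⟩ := hu1
  have := key (t + 2 * t') v (by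
    apply Units.ext
    push_cast at hu ⊢
    rw [hu]; ring)
  apply Fin.ext
  lia

lemma pow_pRank {G : Type*} [CommGroup G] [Finite G] (p : ℕ) (hp : p.Prime) :
    p ^ pRank G p hp = Nat.card {g : G // g ^ p = 1} := by
  have : Fact p.Prime := ⟨hp⟩
  set P := pPart G p hp with hP
  let f : P →* P := powMonoidHom p
  have hcard : Nat.card (P ⧸ f.range) = Nat.card f.ker := by
    have h1 := f.range.card_eq_card_quotient_mul_card_subgroup
    have h2 := f.ker.card_eq_card_quotient_mul_card_subgroup
    rw [Nat.card_congr (QuotientGroup.quotientKerEquivRange f).toEquiv, mul_comm] at h2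
    exact Nat.eq_of_mul_eq_mul_right Nat.card_pos (h1.symm.trans h2)
  have hker : Nat.card f.ker = Nat.card {g : G // g ^ p = 1} := by
    refine Nat.card_congr ⟨fun x => ⟨x.1.1, ?_⟩, fun g => ⟨⟨g.1, ?_⟩, ?_⟩,
      fun x => rfl, fun g => rfl⟩
    · exact congrArg Subtype.val x.2
    · exact CommGroup.mem_primaryComponent.2 ⟨1, by simpa using g.2⟩
    · exact Subtype.ext g.2
  have hP' : IsPGroup p P := CommGroup.primaryComponent.isPGroup
  obtain ⟨n, hn⟩ := (hP'.to_subgroup f.ker).exists_card_eq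
  rw [pRank, ← hP, hcard, ← hker, hn, hp.factorization_pow, Finsupp.single_eq_same]

open Polynomial in
lemma minpoly_sqrtC {D : ℤ} (hD : Squarefree D) (h1 : D ≠ 1) :
    minpoly ℚ (sqrtC D) = X ^ 2 - C (D : ℚ) := by
  refine (minpoly.eq_of_irreducible_of_monic ?_ ?_ (monic_X_pow_sub_C _ two_ne_zero)).symm
  · refine X_pow_sub_C_irreducible_of_prime Nat.prime_two fun q hq => h1 ?_
    obtain ⟨n, hn⟩ : ∃ n : ℤ, (n : ℚ) = q := by
      have : IsIntegral ℤ q := by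
        refine ⟨X ^ 2 - C D, monic_X_pow_sub_C _ two_ne_zero, ?_⟩
        rw [eval₂_sub, eval₂_X_pow, eval₂_C, hq]
        simp
      exact IsIntegrallyClosed.isIntegral_iff.1 this
    have h : n * n = D := by
      rw [← hn, pow_two] at hq
      exact_mod_cast hq
    have := hD n ⟨1, by rw [mul_one, h]⟩
    rw [Int.isUnit_iff] at this
    rcases this with rfl | rfl <;> simpa using h.symm
  · simp [sqrtC_sq]

lemma finrank_quadField {D : ℤ} (hD : Squarefree D) (h1 : D ≠ 1) :
    finrank ℚ (quadField D) = 2 := by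
  rw [quadField, adjoin.finrank (isIntegral_sqrtC D), minpoly_sqrtC hD h1,
    Polynomial.natDegree_X_pow_sub_C]

/-- The chosen square root, as an element of the quadratic field. -/
def quadGen (D : ℤ) : quadField D := AdjoinSimple.gen ℚ (sqrtC D)

lemma quadGen_sq (D : ℤ) : quadGen D ^ 2 = (D : quadField D) := by
  apply Subtype.ext
  have h : ((quadGen D ^ 2 : quadField D) : ℂ) = sqrtC D ^ 2 := rfl
  rw [h, sqrtC_sq]
  rfl

lemma exists_eq_add_mul_quadGen {D : ℤ} (hD : Squarefree D) (h1 : D ≠ 1) (x : quadField D) :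
    ∃ p q : ℚ, x = algebraMap ℚ _ p + algebraMap ℚ _ q * quadGen D := by
  obtain ⟨f, hf, hx⟩ := (adjoin.powerBasis (isIntegral_sqrtC D)).exists_eq_aeval x
  rw [adjoin.powerBasis_dim, minpoly_sqrtC hD h1, Polynomial.natDegree_X_pow_sub_C] at hf
  obtain ⟨q, p, rfl⟩ := Polynomial.exists_eq_X_add_C_of_natDegree_le_one (Nat.lt_succ_iff.1 hf)
  rw [map_add, map_mul, Polynomial.aeval_C, Polynomial.aeval_C, Polynomial.aeval_X,
    adjoin.powerBasis_gen, add_comm] at hx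
  exact ⟨p, q, hx⟩

lemma exists_conj_quadField {D : ℤ} (hD : Squarefree D) (h1 : D ≠ 1) :
    ∃ σ : quadField D ≃ₐ[ℚ] quadField D, σ (quadGen D) = -quadGen D := by
  let s : ℚ⟮sqrtC D⟯ := AdjoinSimple.gen ℚ (sqrtC D)
  let pb := adjoin.powerBasis (isIntegral_sqrtC D)
  have hgen : pb.gen = s := adjoin.powerBasis_gen _
  have hs : s ^ 2 = (D : ℚ⟮sqrtC D⟯) := quadGen_sq D
  have hroot : Polynomial.aeval (-s) (minpoly ℚ pb.gen) = 0 := by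
    have hm : minpoly ℚ s = minpoly ℚ (sqrtC D) := minpoly_gen ℚ (sqrtC D)
    rw [hgen, hm, minpoly_sqrtC hD h1]
    simp [hs]
  have : FiniteDimensional ℚ ℚ⟮sqrtC D⟯ := adjoin.finiteDimensional (isIntegral_sqrtC D)
  let σ : ℚ⟮sqrtC D⟯ ≃ₐ[ℚ] ℚ⟮sqrtC D⟯ :=
    AlgEquiv.ofBijective (pb.lift (-s) hroot) (AlgHom.bijective _)
  have hσ : σ s = -s := by
    rw [← hgen]; exact pb.lift_gen _ hroot
  exact ⟨σ, hσ⟩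

lemma exists_int_of_sq_mul {D : ℤ} (hD : Squarefree D) {v : ℚ} {n : ℤ}
    (h : v ^ 2 * D = n) : ∃ m : ℤ, (m : ℚ) = v := by
  have h0 : (v.den : ℤ) * v.den ∣ D := by
    have hc : IsCoprime ((v.den : ℤ) * v.den) (v.num ^ 2) := by
      have : IsCoprime (v.den : ℤ) v.num :=
        Int.isCoprime_iff_gcd_eq_one.2 (by simpa [Int.gcd, Nat.Coprime] using v.reduced.symm)
      rw [← pow_two]; exact this.pow
    refine hc.dvd_of_dvd_mul_left ⟨n, ?_⟩
    have hv : (v.den : ℚ) ≠ 0 := by exact_mod_cast v.den_ne_zero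
    rw [← Rat.num_div_den v, div_pow, div_mul_eq_mul_div, div_eq_iff (pow_ne_zero 2 hv)] at h
    have : ((v.num ^ 2 * D : ℤ) : ℚ) = ((v.den * v.den * n : ℤ) : ℚ) := by
      push_cast; rw [h]; ring
    exact_mod_cast this
  have h1 := hD _ h0
  rw [Int.ofNat_isUnit, Nat.isUnit_iff] at h1
  exact ⟨v.num, (Rat.den_eq_one_iff v).1 h1⟩

lemma exists_int_of_isIntegral {K : Type*} [Field K] [NumberField K] {q : ℚ}
    (h : IsIntegral ℤ (algebraMap ℚ K q)) : ∃ m : ℤ, (m : ℚ) = q :=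
  IsIntegrallyClosed.isIntegral_iff.1
    ((isIntegral_algebraMap_iff (FaithfulSMul.algebraMap_injective ℚ K)).1 h)

lemma nonempty_QF {K : Type*} [Field K] [NumberField K] {D : ℤ} (hD : Squarefree D) {s : K}
    (hs : s ^ 2 = D) (hspan : ∀ x : K, ∃ p q : ℚ, x = algebraMap ℚ K p + algebraMap ℚ K q * s)
    (σ : K ≃ₐ[ℚ] K) (hσ : σ s = -s) (hK : finrank ℚ K = 2) : Nonempty (QF K D) := by
  have hInt : IsIntegral ℤ s :=
    ⟨Polynomial.X ^ 2 - Polynomial.C D, Polynomial.monic_X_pow_sub_C _ two_ne_zero, by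
      rw [Polynomial.eval₂_sub, Polynomial.eval₂_X_pow, Polynomial.eval₂_C, hs]
      simp⟩
  let δ : 𝓞 K := ⟨s, hInt⟩
  have hδ : algebraMap (𝓞 K) K δ = s := rfl
  refine ⟨⟨δ, ?_, RingOfIntegers.mapRingEquiv σ.toRingEquiv, ?_, fun x => ?_, ?_, hD.ne_zero⟩⟩
  · apply RingOfIntegers.coe_injective
    rw [map_pow, hδ, hs, map_intCast]
  · apply RingOfIntegers.coe_injective
    exact hσ
  · obtain ⟨p, q, hx⟩ := hspan (algebraMap (𝓞 K) K x)
    have hσx : σ (algebraMap (𝓞 K) K x) = algebraMap ℚ K p - algebraMap ℚ K q * s := by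
      rw [hx, map_add, map_mul, AlgEquiv.commutes, AlgEquiv.commutes, hσ]; ring
    have hi : IsIntegral ℤ (algebraMap (𝓞 K) K x) := x.isIntegral_coe
    have hi' : IsIntegral ℤ (σ (algebraMap (𝓞 K) K x)) := hi.map (σ.toAlgHom.restrictScalars ℤ)
    obtain ⟨u, hu⟩ := exists_int_of_isIntegral (K := K) (q := 2 * p) (by
      have h : algebraMap ℚ K (2 * p) = algebraMap (𝓞 K) K x + σ (algebraMap (𝓞 K) K x) := by
        rw [hσx, hx, map_mul, map_ofNat]; ring
      rw [h]
      exact hi.add hi')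
    obtain ⟨n, hn⟩ := exists_int_of_isIntegral (K := K) (q := (2 * q) ^ 2 * D) (by
      have h : algebraMap ℚ K ((2 * q) ^ 2 * D) = (algebraMap (𝓞 K) K x - σ (algebraMap (𝓞 K) K x)) ^ 2 := by
        rw [hσx, hx, map_mul, map_pow, map_mul, map_ofNat, map_intCast, ← hs]; ring
      rw [h]
      exact (hi.sub hi').pow 2)
    obtain ⟨v, hv⟩ := exists_int_of_sq_mul hD hn.symm
    refine ⟨u, v, ?_⟩
    apply RingOfIntegers.coe_injective
    have hu' := congrArg (algebraMap ℚ K) hu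
    have hv' := congrArg (algebraMap ℚ K) hv
    simp only [map_mul, map_ofNat, map_intCast] at hu' hv'
    simp only [map_mul, map_ofNat, map_intCast, map_add]
    rw [hu', hv', hδ, hx]
    ring
  · rw [RingOfIntegers.rank, hK]

lemma nonempty_QF_quadField {D : ℤ} (hD : Squarefree D) (h1 : D ≠ 1) :
    Nonempty (QF (quadField D) D) := by
  obtain ⟨σ, hσ⟩ := exists_conj_quadField hD h1
  exact nonempty_QF hD (quadGen_sq D) (exists_eq_add_mul_quadGen hD h1) σ hσ
    (finrank_quadField hD h1)

lemma QF.units_rank_ne_zero {K : Type*} [Field K] [NumberField K] {D : ℤ} (S : QF K D)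
    (h0 : 0 < D) : Units.rank K ≠ 0 := by
  have h := InfinitePlace.card_add_two_mul_card_eq_rank K
  rw [← RingOfIntegers.rank, S.rank] at h
  let φ : K →+* ℂ := Classical.arbitrary _
  let ψ : 𝓞 K →+* ℂ := φ.comp (algebraMap (𝓞 K) K)
  have hs : (starRingEnd ℂ) (ψ S.δ) = ψ S.δ := by
    rw [Complex.conj_eq_iff_im]
    have h : ψ S.δ ^ 2 = D := by
      rw [← map_pow, S.sq, map_intCast]
    have hre := congrArg Complex.re h
    have him := congrArg Complex.im h
    simp only [pow_two, Complex.mul_re, Complex.mul_im, Complex.intCast_re,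
      Complex.intCast_im] at hre him
    have : (0 : ℝ) < D := by exact_mod_cast h0
    by_contra hne
    have : (ψ S.δ).re = 0 := by
      have : (ψ S.δ).re * (ψ S.δ).im = 0 := by linarith
      exact (mul_eq_zero.1 this).resolve_right hne
    rw [this] at hre
    nlinarith [mul_self_nonneg (ψ S.δ).im]
  have hφ : ∀ x : 𝓞 K, (starRingEnd ℂ) (ψ x) = ψ x := fun x => by
    obtain ⟨u, v, hx⟩ := S.half x
    have h2 : 2 * ψ x = u + v * ψ S.δ := by
      rw [← map_ofNat ψ 2, ← map_mul, hx, map_add, map_mul, map_intCast, map_intCast]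
    have h3 := congrArg (starRingEnd ℂ) h2
    rw [map_mul, map_add, map_mul, map_intCast, map_intCast, hs, ← h2, map_ofNat] at h3
    exact mul_left_cancel₀ two_ne_zero h3
  have hreal : ComplexEmbedding.IsReal φ := by
    rw [ComplexEmbedding.isReal_iff]
    refine IsFractionRing.ringHom_ext (A := 𝓞 K) fun x => ?_
    exact hφ x
  have hpos : 0 < InfinitePlace.nrRealPlaces K := by
    classical
    exact Fintype.card_pos_iff.2 ⟨⟨InfinitePlace.mk φ, InfinitePlace.isReal_mk_iff.2 hreal⟩⟩
  have := InfinitePlace.card_eq_nrRealPlaces_add_nrComplexPlaces K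
  rw [Units.rank]
  lia

/-- Kishi's refinement of Scholz's reflection theorem. -/
theorem statement_4 (a b : ℤ) (hb : ¬ (3 : ℤ) ∣ b) (d : ℤ)
    (hd : d = -4 * a ^ 3 + 9 * b ^ 2) (hsf : Squarefree d) :
    (0 < d →
      pRank (ClassGroup (𝓞 (quadField d))) 3 Nat.prime_three =
        pRank (ClassGroup (𝓞 (quadField (-3 * d)))) 3 Nat.prime_three) ∧
    (d < 0 →
      pRank (ClassGroup (𝓞 (quadField d))) 3 Nat.prime_three =
        pRank (ClassGroup (𝓞 (quadField (-3 * d)))) 3 Nat.prime_three + 1) := by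
  have h3d : ¬ (3 : ℤ) ∣ d := not_three_dvd_of_squarefree hd hsf
  have hsf' : Squarefree (-3 * d) := by
    refine (squarefree_mul_iff).2 ⟨?_, ?_, hsf⟩
    · exact ((Prime.coprime_iff_not_dvd (by exact Int.prime_three.neg)).2
        (by rwa [neg_dvd])).isRelPrime
    · exact (Int.prime_three.neg).squarefree
  have hd1 : d ≠ 1 := by
    rintro rfl
    have h3a : ¬ (3 : ℤ) ∣ a := fun ⟨c, hc⟩ => h3d ⟨-36 * c ^ 3 + 3 * b ^ 2, by
      rw [hc] at hd; linarith⟩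
    have h9 : a ^ 3 % 9 = 1 ∨ a ^ 3 % 9 = 8 := by
      have : a % 9 = 1 ∨ a % 9 = 2 ∨ a % 9 = 4 ∨ a % 9 = 5 ∨ a % 9 = 7 ∨ a % 9 = 8 := by lia
      rcases this with h | h | h | h | h | h <;> simp [pow_succ, Int.mul_emod, h]
    lia
  obtain ⟨S⟩ := nonempty_QF_quadField hsf hd1
  obtain ⟨S'⟩ := nonempty_QF_quadField hsf' (by lia)
  have h6 : (6 : ℕ) ≠ 0 := by norm_num
  refine ⟨fun h0 => ?_, fun h0 => ?_⟩
  all_goals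
    have hp := pow_pRank (G := ClassGroup (𝓞 (quadField d))) 3 Nat.prime_three
    have hp' := pow_pRank (G := ClassGroup (𝓞 (quadField (-3 * d)))) 3 Nat.prime_three
    refine Nat.pow_right_injective (le_refl 2 |>.trans (by norm_num) : 2 ≤ 3) ?_
  · obtain ⟨η, hη⟩ := exists_family_units_three (S.units_rank_ne_zero h0)
    obtain ⟨η', hη'⟩ := exists_family_units_one (K := quadField (-3 * d))
    obtain ⟨x, J, hJ, hx0, hx6, hx⟩ := exists_family η hη h6
    obtain ⟨y, J', hJ', hy0, hy6, hy⟩ := exists_family η' hη' h6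
    have h1 := S.card_le_of_family_left S' hd hsf x J hJ hx0 hx6 hx
    have h2 := S.card_le_of_family_right S' hb hd hsf y J' hJ' hy0 hy6 hy
    simp only [Nat.card_prod, Nat.card_fin] at h1 h2
    dsimp only
    rw [hp, hp']
    lia
  · obtain ⟨η, hη⟩ := exists_family_units_one (K := quadField d)
    obtain ⟨η', hη'⟩ := exists_family_units_three (S'.units_rank_ne_zero (by lia))
    obtain ⟨x, J, hJ, hx0, hx6, hx⟩ := exists_family η hη h6
    obtain ⟨y, J', hJ', hy0, hy6, hy⟩ := exists_family η' hη' h6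
    have h1 := S.card_le_of_family_left S' hd hsf x J hJ hx0 hx6 hx
    have h2 := S.card_le_of_family_right S' hb hd hsf y J' hJ' hy0 hy6 hy
    simp only [Nat.card_prod, Nat.card_fin] at h1 h2
    dsimp only
    rw [pow_succ, hp, hp']
    lia

end PaperStmt
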